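/- Let α > 1 be an irrational number of finite type, and let 𝓑_α be the set of primes of the form ⌊αn⌋ for some positive integer n. Then the limit lim_{X→∞} Σ_{2 ≤ n ≤ X, p_min(n) ∈ 𝓑_α} μ(n)/n exists and equals −1/α. -/

import Mathlib

open Filter ArithmeticFunction

noncomputable section

namespace AlladiGen

section Part0
/-- Summatory function of the Möbius function. -/
def Mf (t : ℝ) : ℝ := ∑ k ∈ Finset.Icc 1 ⌊t⌋₊, (moebius k : ℝ)

/-- Normalised summatory function in logarithmic scale. -/
def phi (u : ℝ) : ℝ := Mf (Real.exp u) * Real.exp (-u)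

lemma abs_moebius_real_le_one (n : ℕ) : |(moebius n : ℝ)| ≤ 1 := by
  have := abs_moebius_le_one (n := n)
  exact_mod_cast this

lemma Mf_sub_le {s t : ℝ} (hs : 0 ≤ s) (hst : s ≤ t) : |Mf t - Mf s| ≤ t - s + 1 := by
  have hfl : ⌊s⌋₊ ≤ ⌊t⌋₊ := Nat.floor_mono hst
  have h1 : Mf t - Mf s = ∑ k ∈ Finset.Ioc ⌊s⌋₊ ⌊t⌋₊, (moebius k : ℝ) := by
    unfold Mf
    rw [sub_eq_iff_eq_add']
    have : Finset.Icc 1 ⌊t⌋₊ = Finset.Icc 1 ⌊s⌋₊ ∪ Finset.Ioc ⌊s⌋₊ ⌊t⌋₊ := by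
      ext k; simp only [Finset.mem_Icc, Finset.mem_union, Finset.mem_Ioc]; omega
    rw [this, Finset.sum_union]
    rw [Finset.disjoint_left]
    intro k; simp only [Finset.mem_Icc, Finset.mem_Ioc]; omega
  rw [h1]
  refine (Finset.abs_sum_le_sum_abs _ _).trans ?_
  refine (Finset.sum_le_sum (fun k _ => abs_moebius_real_le_one k)).trans ?_
  simp only [Finset.sum_const, Nat.card_Ioc, nsmul_eq_mul, mul_one]
  rw [Nat.cast_sub hfl]
  have := Nat.floor_le (hs.trans hst)
  have := Nat.lt_floor_add_one s
  linarith

lemma abs_Mf_le {t : ℝ} (ht : 0 ≤ t) : |Mf t| ≤ t := by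
  unfold Mf
  refine (Finset.abs_sum_le_sum_abs _ _).trans ?_
  refine (Finset.sum_le_sum (fun k _ => abs_moebius_real_le_one k)).trans ?_
  simp only [Finset.sum_const, Nat.card_Icc, nsmul_eq_mul, mul_one]
  simpa using Nat.floor_le ht

lemma Mf_zero {t : ℝ} (ht : t < 1) : Mf t = 0 := by
  unfold Mf
  rw [Nat.floor_eq_zero.mpr ht]; simp

lemma measurable_Mf : Measurable Mf := by
  have : Mf = (fun n : ℕ => ∑ k ∈ Finset.Icc 1 n, (moebius k : ℝ)) ∘ (fun t : ℝ => ⌊t⌋₊) := rfl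
  rw [this]
  exact (measurable_of_countable _).comp Nat.measurable_floor

lemma measurable_phi : Measurable phi := by
  unfold phi
  exact (measurable_Mf.comp Real.measurable_exp).mul (Real.measurable_exp.comp measurable_neg)

lemma abs_phi_le (u : ℝ) : |phi u| ≤ 1 := by
  unfold phi
  rw [abs_mul, Real.abs_exp]
  calc _ ≤ Real.exp u * Real.exp (-u) := by
        gcongr; exact abs_Mf_le (Real.exp_pos u).le
    _ = 1 := by rw [← Real.exp_add]; simp

lemma phi_neg {u : ℝ} (hu : u < 0) : phi u = 0 := by
  unfold phi; rw [Mf_zero (by simpa using hu)]; simp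

lemma phi_slow (v h : ℝ) (hh : 0 ≤ h) : |phi (v + h) - phi v| ≤ 2 * h + Real.exp (-v) := by
  have h0 : phi (v + h) - phi v = (Mf (Real.exp (v+h)) - Mf (Real.exp v)) * Real.exp (-(v+h))
      - phi v * (1 - Real.exp (-h)) := by
    unfold phi
    rw [neg_add, Real.exp_add (-v) (-h)]; ring
  have h1 := Mf_sub_le (Real.exp_pos v).le (Real.exp_le_exp.mpr (by linarith : v ≤ v + h))
  have h2 := abs_phi_le v
  have h3 : 1 - Real.exp (-h) ≤ h := by have := Real.add_one_le_exp (-h); linarith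
  have h4 : 0 ≤ 1 - Real.exp (-h) := by
    have : Real.exp (-h) ≤ 1 := Real.exp_le_one_iff.mpr (by linarith)
    linarith
  rw [h0]
  refine (abs_sub _ _).trans ?_
  rw [abs_mul, abs_mul, Real.abs_exp, abs_of_nonneg h4]
  have h5 : |Mf (Real.exp (v+h)) - Mf (Real.exp v)| * Real.exp (-(v+h)) ≤
      (Real.exp (v+h) - Real.exp v + 1) * Real.exp (-(v+h)) := by gcongr
  have h6 : (Real.exp (v+h) - Real.exp v + 1) * Real.exp (-(v+h)) =
      1 - Real.exp (-h) + Real.exp (-v) * Real.exp (-h) := by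
    have e1 : Real.exp (v+h) * Real.exp (-(v+h)) = 1 := by rw [← Real.exp_add]; simp
    have e2 : Real.exp v * Real.exp (-(v+h)) = Real.exp (-h) := by
      rw [← Real.exp_add]; congr 1; ring
    have e3 : Real.exp (-(v+h)) = Real.exp (-v) * Real.exp (-h) := by
      rw [← Real.exp_add]; congr 1; ring
    rw [add_mul, sub_mul, e1, e2, e3, one_mul]
  have h7 : Real.exp (-v) * Real.exp (-h) ≤ Real.exp (-v) := by
    have := Real.exp_pos (-v); nlinarith
  nlinarith [abs_nonneg (phi v)]

lemma phi_slow' (v w : ℝ) : |phi (v + w) - phi v| ≤ 2 * |w| + Real.exp (-v + |w|) := by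
  rcases le_total 0 w with h | h
  · refine (phi_slow v w h).trans ?_
    rw [abs_of_nonneg h]; gcongr; linarith
  · have := phi_slow (v + w) (-w) (by linarith)
    rw [abs_of_nonpos h, abs_sub_comm]
    simpa [add_comm] using this

/-- The Laplace transform of `phi`, extended to the closed right half plane. -/
def Gf (s : ℂ) : ℂ := if s = 0 then 0 else 1 / ((1 + s) * riemannZeta (1 + s))

lemma Gf_cont : ContinuousOn Gf {s : ℂ | 0 ≤ s.re} := by
  intro s hs
  by_cases h0 : s = 0
  · subst h0
    have h1 : Tendsto (fun s : ℂ => 1 + s) (nhdsWithin 0 {0}ᶜ) (nhdsWithin 1 {1}ᶜ) := by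
      apply tendsto_nhdsWithin_of_tendsto_nhds_of_eventually_within
      · have : Tendsto (fun s : ℂ => 1 + s) (nhds 0) (nhds (1 + 0)) :=
          (continuous_const.add continuous_id).tendsto 0
        rw [add_zero] at this
        exact this.mono_left nhdsWithin_le_nhds
      · filter_upwards [self_mem_nhdsWithin] with s hs
        simpa using hs
    have h2 := riemannZeta_residue_one.comp h1
    have h3 : Tendsto (fun s : ℂ => s / ((1 + s) * (s * riemannZeta (1 + s))))
        (nhdsWithin 0 {0}ᶜ) (nhds (0 / ((1 + 0) * 1))) := by
      apply Tendsto.div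
      · exact (continuous_id.tendsto 0).mono_left nhdsWithin_le_nhds
      · apply Tendsto.mul
        · exact ((continuous_const.add continuous_id).tendsto 0).mono_left nhdsWithin_le_nhds
        · simpa [Function.comp_def] using h2
      · simp
    have h4 : ContinuousAt Gf 0 := by
      rw [continuousAt_iff_punctured_nhds]
      have : Gf 0 = 0 / ((1 + 0) * 1) := by simp [Gf]
      rw [this]
      refine h3.congr' ?_
      filter_upwards [self_mem_nhdsWithin] with s hs
      have hs' : s ≠ 0 := hs
      simp only [Gf, hs', if_false]
      rw [show (1 + s) * (s * riemannZeta (1 + s)) = s * ((1 + s) * riemannZeta (1 + s)) by ring]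
      rw [← div_div, div_self hs']
    exact h4.continuousWithinAt
  · have hs' : 0 ≤ s.re := hs
    have h1 : (1 + s) ≠ 1 := by simpa using h0
    have h2 : riemannZeta (1 + s) ≠ 0 := riemannZeta_ne_zero_of_one_le_re (by simpa using hs')
    have h3 : (1 + s) ≠ 0 := by
      intro h; have := congrArg Complex.re h; simp at this; linarith
    have h4 : ContinuousAt (fun s => 1 / ((1 + s) * riemannZeta (1 + s))) s := by
      apply ContinuousAt.div continuousAt_const
      · apply ContinuousAt.mul (by fun_prop)
        exact ContinuousAt.comp (f := fun s : ℂ => 1 + s) (g := riemannZeta)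
          (differentiableAt_riemannZeta h1).continuousAt (by fun_prop)
      · exact mul_ne_zero h3 h2
    have h5 : ContinuousAt Gf s := by
      refine h4.congr ?_
      filter_upwards [isOpen_ne.mem_nhds h0] with t ht
      simp [Gf, show t ≠ 0 from ht]
    exact h5.continuousWithinAt

lemma Gf_eq (s : ℂ) (hs : 0 < s.re) :
    ∫ u : ℝ, (phi u : ℂ) * Complex.exp (-s * u) = Gf s := by
  have hs1 : 1 < (1 + s).re := by simpa using hs
  have h1 := LSeries_eq_mul_integral' (fun n => ((moebius n : ℤ) : ℂ)) (r := 1) zero_le_one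
    (s := 1 + s) hs1 (by
      apply Asymptotics.isBigO_of_le
      intro n
      rw [Real.norm_of_nonneg (Finset.sum_nonneg (fun _ _ => norm_nonneg _))]
      refine (Finset.sum_le_sum (g := fun _ => (1:ℝ)) (fun k _ => ?_)).trans ?_
      · have := abs_moebius_real_le_one k
        simpa using this
      · simp)
  have h2 := LSeries_one_mul_Lseries_moebius hs1
  rw [LSeries_one_eq_riemannZeta hs1] at h2
  have h0 : s ≠ 0 := by intro h; simp [h] at hs
  have h3 : (1 + s) ≠ 0 := by
      intro h; have := congrArg Complex.re h; simp at this; linarith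
  have hz : riemannZeta (1 + s) ≠ 0 := left_ne_zero_of_mul_eq_one h2
  have h5 : ∫ u : ℝ, (phi u : ℂ) * Complex.exp (-s * u) =
      ∫ t in Set.Ioi (1:ℝ), (∑ k ∈ Finset.Icc 1 ⌊t⌋₊, ((moebius k : ℤ) : ℂ)) * (t:ℂ) ^ (-(1 + s + 1)) := by
    have e1 := MeasureTheory.integral_image_eq_integral_abs_deriv_smul (s := Set.univ)
      (f := Real.exp) (f' := Real.exp) MeasurableSet.univ
      (fun x _ => (Real.hasDerivAt_exp x).hasDerivWithinAt) Real.exp_injective.injOn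
      (fun t : ℝ => (∑ k ∈ Finset.Icc 1 ⌊t⌋₊, ((moebius k : ℤ) : ℂ)) * (t:ℂ) ^ (-(1 + s + 1)))
    rw [Set.image_univ, Real.range_exp, MeasureTheory.setIntegral_univ] at e1
    have e2 : ∫ t in Set.Ioi (1:ℝ), (∑ k ∈ Finset.Icc 1 ⌊t⌋₊, ((moebius k : ℤ) : ℂ)) * (t:ℂ) ^ (-(1 + s + 1))
       = ∫ t in Set.Ioi (0:ℝ), (∑ k ∈ Finset.Icc 1 ⌊t⌋₊, ((moebius k : ℤ) : ℂ)) * (t:ℂ) ^ (-(1 + s + 1)) := by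
      rw [← MeasureTheory.integral_Ici_eq_integral_Ioi]
      symm
      apply MeasureTheory.setIntegral_eq_of_subset_of_forall_sdiff_eq_zero measurableSet_Ioi
      · intro t ht
        exact lt_of_lt_of_le zero_lt_one (Set.mem_Ici.mp ht)
      · intro t ht
        have : t < 1 := not_le.mp ht.2
        rw [Nat.floor_eq_zero.mpr this]; simp
    rw [e2, e1]
    congr 1
    ext u
    rw [abs_of_pos (Real.exp_pos u)]
    have : ((Real.exp u : ℝ) : ℂ) ^ (-(1 + s + 1)) = Complex.exp (-s * u) * Complex.exp (-u) * Complex.exp (-u) := by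
      rw [Complex.cpow_def_of_ne_zero (by exact_mod_cast (Real.exp_pos u).ne'), ← Complex.ofReal_log (Real.exp_pos u).le,
        Real.log_exp, ← Complex.exp_add, ← Complex.exp_add]
      congr 1; ring
    rw [this]
    simp only [phi, Mf, Complex.real_smul]
    push_cast
    have e : Complex.exp u * Complex.exp (-u) = 1 := by rw [← Complex.exp_add]; simp
    linear_combination (-(∑ k ∈ Finset.Icc 1 ⌊Real.exp u⌋₊, ((moebius k : ℤ) : ℂ)) * Complex.exp (-u) * Complex.exp (-s * u)) * e
  rw [h5]
  simp only [Gf, h0, if_false]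
  rw [eq_div_iff (mul_ne_zero h3 hz)]
  rw [h1] at h2
  linear_combination h2

end Part0

section Part1
open MeasureTheory FourierTransform in
lemma exists_chi : ∃ χ : SchwartzMap ℝ ℂ, HasCompactSupport χ ∧ χ 0 = 1 := by
  let b : ContDiffBump (0:ℝ) := ⟨1, 2, one_pos, one_lt_two⟩
  have h1 : HasCompactSupport (fun x => ((b x : ℝ) : ℂ)) :=
    b.hasCompactSupport.comp_left (g := Complex.ofReal) Complex.ofReal_zero
  have h2 : ContDiff ℝ (↑(⊤ : ℕ∞)) (fun x => ((b x : ℝ) : ℂ)) :=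
    Complex.ofRealCLM.contDiff.comp b.contDiff
  refine ⟨h1.toSchwartzMap h2, ?_, ?_⟩
  · exact h1
  · have : b 0 = 1 := b.one_of_mem_closedBall (by simp [b])
    show ((b 0 : ℝ) : ℂ) = 1
    rw [this]; simp

open MeasureTheory

lemma integrable_phi_exp (σ : ℝ) (hσ : 0 < σ) :
    Integrable (fun u : ℝ => (phi u : ℂ) * Complex.exp (-(σ:ℂ) * u)) := by
  have h1 : IntegrableOn (fun u : ℝ => Real.exp (-σ * u)) (Set.Ioi 0) :=
    exp_neg_integrableOn_Ioi 0 hσ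
  have h2 : Integrable (Set.indicator (Set.Ici 0) (fun u : ℝ => Real.exp (-σ * u))) := by
    rw [integrable_indicator_iff measurableSet_Ici, integrableOn_Ici_iff_integrableOn_Ioi]
    exact h1
  refine h2.mono' ?_ ?_
  · apply Measurable.aestronglyMeasurable
    exact (Complex.measurable_ofReal.comp measurable_phi).mul (by fun_prop)
  · refine Eventually.of_forall (fun u => ?_)
    by_cases hu : u < 0
    · rw [phi_neg hu]
      simp only [Complex.ofReal_zero, zero_mul, norm_zero]
      exact Set.indicator_nonneg (fun _ _ => (Real.exp_pos _).le) _
    · rw [Set.indicator_of_mem (by simpa using hu), norm_mul, Complex.norm_real, Complex.norm_exp]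
      have := abs_phi_le u
      rw [Real.norm_eq_abs]
      have e : (-(σ:ℂ) * u).re = -σ * u := by simp
      rw [e]
      have := Real.exp_pos (-σ * u)
      nlinarith

/-- the character used in the Fourier argument -/
def ee (x : ℝ) : ℂ := Complex.exp (2 * Real.pi * x * Complex.I)

lemma norm_ee (x : ℝ) : ‖ee x‖ = 1 := by
  unfold ee
  have : (2 * (Real.pi:ℂ) * x * Complex.I) = ((2 * Real.pi * x : ℝ) : ℂ) * Complex.I := by push_cast; ring
  rw [this, Complex.norm_exp_ofReal_mul_I]

lemma continuous_ee : Continuous ee := by unfold ee; fun_prop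

lemma ee_add (x y : ℝ) : ee (x + y) = ee x * ee y := by
  unfold ee; rw [← Complex.exp_add]; congr 1; push_cast; ring

open FourierTransform in
lemma fourier_chi (χ : SchwartzMap ℝ ℂ) (w : ℝ) : (𝓕 χ) w = ∫ t, ee (-(t * w)) * χ t := by
  rw [SchwartzMap.fourier_coe, Real.fourier_real_eq]
  congr 1; ext t
  rw [Circle.smul_def, Real.fourierChar_apply]
  simp only [ee, smul_eq_mul]
  congr 2
  push_cast; ring

open FourierTransform in
lemma fubini_step (χ : SchwartzMap ℝ ℂ) (T v σ : ℝ) (hσ : 0 < σ) :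
    ∫ u : ℝ, (phi u : ℂ) * Complex.exp (-(σ:ℂ) * u) * (𝓕 χ) (T * (u - v)) =
    ∫ t : ℝ, ee (T * t * v) * (χ t * Gf (σ + 2 * Real.pi * T * t * Complex.I)) := by
  have hIntg : Integrable (fun p : ℝ × ℝ => ((phi p.1 : ℂ) * Complex.exp (-(σ:ℂ) * p.1) * χ p.2) *
      ee (-(p.2 * (T * (p.1 - v))))) (volume.prod volume) := by
    refine ((integrable_phi_exp σ hσ).mul_prod χ.integrable).mul_bdd (c := 1) ?_ ?_
    · apply Continuous.aestronglyMeasurable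
      exact continuous_ee.comp (by fun_prop)
    · exact Eventually.of_forall (fun p => (norm_ee _).le)
  calc _ = ∫ u : ℝ, ∫ t : ℝ, ((phi u : ℂ) * Complex.exp (-(σ:ℂ) * u) * χ t) *
      ee (-(t * (T * (u - v)))) := by
        congr 1; ext u
        rw [fourier_chi, ← integral_const_mul]
        congr 1; ext t; ring
    _ = ∫ t : ℝ, ∫ u : ℝ, ((phi u : ℂ) * Complex.exp (-(σ:ℂ) * u) * χ t) *
      ee (-(t * (T * (u - v)))) := integral_integral_swap hIntg
    _ = _ := by
        congr 1; ext t
        rw [← Gf_eq _ (by simpa using hσ), ← mul_assoc, ← integral_const_mul]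
        congr 1; ext u
        have : ee (-(t * (T * (u - v)))) = ee (T * t * v) * Complex.exp (-(2 * Real.pi * T * t * Complex.I) * u) := by
          unfold ee; rw [← Complex.exp_add]; congr 1; push_cast; ring
        rw [this, neg_add, add_mul (-(σ:ℂ)), Complex.exp_add]
        ring

open FourierTransform in
lemma limit_step (χ : SchwartzMap ℝ ℂ) (hχ : HasCompactSupport χ) (T v : ℝ) (hT : 0 < T) :
    ∫ u : ℝ, (phi u : ℂ) * (𝓕 χ) (T * (u - v)) =
    ∫ t : ℝ, ee (T * t * v) * (χ t * Gf (2 * Real.pi * T * t * Complex.I)) := by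
  have hL : Tendsto (fun σ : ℝ => ∫ u : ℝ, (phi u : ℂ) * Complex.exp (-(σ:ℂ) * u) * (𝓕 χ) (T * (u - v)))
      (nhdsWithin 0 (Set.Ioi 0)) (nhds (∫ u : ℝ, (phi u : ℂ) * (𝓕 χ) (T * (u - v)))) := by
    apply tendsto_integral_filter_of_dominated_convergence (fun u => ‖(𝓕 χ) (T * (u - v))‖)
    · refine Eventually.of_forall (fun σ => ?_)
      apply AEStronglyMeasurable.mul
      · apply Measurable.aestronglyMeasurable
        exact (Complex.measurable_ofReal.comp measurable_phi).mul (by fun_prop)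
      · apply Continuous.aestronglyMeasurable
        exact (𝓕 χ).continuous.comp (by fun_prop)
    · filter_upwards [self_mem_nhdsWithin] with σ hσ
      have hσ' : 0 < σ := hσ
      refine Eventually.of_forall (fun u => ?_)
      rw [norm_mul]
      have : ‖(phi u : ℂ) * Complex.exp (-(σ:ℂ) * u)‖ ≤ 1 := by
        by_cases hu : u < 0
        · rw [phi_neg hu]; simp
        · rw [norm_mul, Complex.norm_real, Complex.norm_exp, Real.norm_eq_abs]
          have e : (-(σ:ℂ) * u).re = -σ * u := by simp
          rw [e]
          have h1 : Real.exp (-σ * u) ≤ 1 := Real.exp_le_one_iff.mpr (by nlinarith)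
          exact mul_le_one₀ (abs_phi_le u) (Real.exp_pos _).le h1
      exact mul_le_of_le_one_left (norm_nonneg _) this
    · have h1 := ((𝓕 χ).integrable (μ := volume)).norm
      have h2 := (h1.comp_mul_left' hT.ne').comp_sub_right v
      exact h2
    · refine Eventually.of_forall (fun u => ?_)
      have : Tendsto (fun σ : ℝ => (phi u : ℂ) * Complex.exp (-(σ:ℂ) * u) * (𝓕 χ) (T * (u - v)))
        (nhds 0) (nhds ((phi u : ℂ) * Complex.exp (-((0:ℝ):ℂ) * u) * (𝓕 χ) (T * (u - v)))) := by
        generalize (𝓕 χ) (T * (u - v)) = c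
        have hc : Continuous (fun σ : ℝ => (phi u : ℂ) * Complex.exp (-(σ:ℂ) * u) * c) := by fun_prop
        exact hc.tendsto 0
      simp only [Complex.ofReal_zero, neg_zero, zero_mul, Complex.exp_zero, mul_one] at this
      exact this.mono_left nhdsWithin_le_nhds
  have hcont : ContinuousOn (fun p : ℝ × ℝ => Gf (p.1 + 2 * Real.pi * T * p.2 * Complex.I))
      (Set.Icc 0 1 ×ˢ Set.univ) := by
    apply Gf_cont.comp (by fun_prop)
    intro p hp
    simpa using hp.1.1
  have hR : Tendsto (fun σ : ℝ => ∫ t : ℝ, ee (T * t * v) * (χ t * Gf (σ + 2 * Real.pi * T * t * Complex.I)))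
      (nhdsWithin 0 (Set.Ioi 0)) (nhds (∫ t : ℝ, ee (T * t * v) * (χ t * Gf (2 * Real.pi * T * t * Complex.I)))) := by
    obtain ⟨C, hC⟩ := (isCompact_Icc.prod hχ).exists_bound_of_continuousOn
      (hcont.mono (Set.prod_mono_right (Set.subset_univ _)))
    have hσmem : ∀ᶠ σ : ℝ in nhdsWithin 0 (Set.Ioi 0), σ ∈ Set.Icc (0:ℝ) 1 := by
      have : Set.Ioc (0:ℝ) 1 ∈ nhdsWithin (0:ℝ) (Set.Ioi 0) := Ioc_mem_nhdsGT one_pos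
      filter_upwards [this] with σ hσ using ⟨hσ.1.le, hσ.2⟩
    apply tendsto_integral_filter_of_dominated_convergence (fun t => ‖χ t‖ * C)
    · filter_upwards [hσmem] with σ hσ
      apply Continuous.aestronglyMeasurable
      apply Continuous.mul (continuous_ee.comp (by fun_prop))
      apply Continuous.mul χ.continuous
      have : ContinuousOn (fun t : ℝ => Gf (σ + 2 * Real.pi * T * t * Complex.I)) Set.univ :=
        hcont.comp (f := fun t : ℝ => (σ, t)) (by fun_prop) (fun t _ => ⟨hσ, trivial⟩)
      exact continuousOn_univ.mp this
    · filter_upwards [hσmem] with σ hσ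
      refine Eventually.of_forall (fun t => ?_)
      rw [norm_mul, norm_ee, one_mul, norm_mul]
      by_cases ht : t ∈ tsupport χ
      · gcongr
        exact hC (σ, t) ⟨hσ, ht⟩
      · rw [image_eq_zero_of_notMem_tsupport ht]; simp
    · exact (χ.integrable (μ := volume)).norm.mul_const C
    · refine Eventually.of_forall (fun t => ?_)
      apply Tendsto.const_mul
      apply Tendsto.const_mul
      have h0 : ContinuousWithinAt (fun σ : ℝ => Gf (σ + 2 * Real.pi * T * t * Complex.I)) (Set.Icc 0 1) 0 := by
        have : ContinuousOn (fun σ : ℝ => Gf (σ + 2 * Real.pi * T * t * Complex.I)) (Set.Icc 0 1) :=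
          hcont.comp (f := fun σ : ℝ => (σ, t)) (by fun_prop) (fun σ hσ => ⟨hσ, trivial⟩)
        exact this 0 (by simp)
      have h1 := h0.tendsto
      simp only [Complex.ofReal_zero, zero_add] at h1
      refine h1.mono_left ?_
      exact le_inf nhdsWithin_le_nhds (le_principal_iff.mpr hσmem)
  refine tendsto_nhds_unique hL (hR.congr' ?_)
  filter_upwards [self_mem_nhdsWithin] with σ hσ
  exact (fubini_step χ T v σ hσ).symm

open FourierTransform in
lemma smooth_limit (χ : SchwartzMap ℝ ℂ) (hχ : HasCompactSupport χ) (T : ℝ) (hT : 0 < T) :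
    Tendsto (fun v => ∫ u : ℝ, (phi u : ℂ) * (𝓕 χ) (T * (u - v))) atTop (nhds 0) := by
  simp_rw [limit_step χ hχ T _ hT]
  have h := Real.tendsto_integral_exp_smul_cocompact
    (fun t : ℝ => χ t * Gf (2 * Real.pi * T * t * Complex.I))
  have h2 : Tendsto (fun v : ℝ => -(T * v)) atTop (cocompact ℝ) := by
    have : Tendsto (fun v : ℝ => -(T * v)) atTop atBot :=
      tendsto_neg_atTop_atBot.comp (tendsto_id.const_mul_atTop hT)
    exact this.mono_right atBot_le_cocompact
  refine (h.comp h2).congr (fun v => ?_)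
  simp only [Function.comp]
  congr 1; ext t
  rw [Circle.smul_def, Real.fourierChar_apply, smul_eq_mul]
  congr 1
  unfold ee
  congr 1; push_cast; ring

open FourierTransform in
lemma tendsto_phi : Tendsto phi atTop (nhds 0) := by
  obtain ⟨χ, hχ, hχ0⟩ := exists_chi
  have hKint := (𝓕 χ).integrable (μ := volume)
  have hK : ∫ w, (𝓕 χ) w = 1 := by
    have h1 := Continuous.fourierInv_fourier_eq χ.continuous χ.integrable
      (by have := hKint; rwa [SchwartzMap.fourier_coe] at this)
    have h2 := congrFun h1 0
    rw [hχ0, Real.fourierInv_eq'] at h2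
    rw [← h2]
    congr 1; ext w
    simp [SchwartzMap.fourier_coe]
  -- change of variables
  have hsub : ∀ T > 0, ∀ v, ∫ u : ℝ, (phi u : ℂ) * (𝓕 χ) (T * (u - v)) =
      (T⁻¹ : ℝ) * ∫ w : ℝ, (phi (v + w / T) : ℂ) * (𝓕 χ) w := by
    intro T hT v
    have e := Measure.integral_comp_mul_left (fun w : ℝ => (phi (v + w / T) : ℂ) * (𝓕 χ) w) T
    have e' := integral_sub_right_eq_self (μ := volume) (fun x : ℝ => (phi (v + T * x / T) : ℂ) * (𝓕 χ) (T * x)) v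
    rw [abs_of_pos (inv_pos.mpr hT)] at e
    rw [e] at e'
    rw [← Complex.real_smul, ← e']
    congr 1; ext u
    rw [mul_div_cancel_left₀ _ hT.ne']; congr 3; ring
  have hlim : ∀ T > 0, Tendsto (fun v => ∫ w : ℝ, (phi (v + w / T) : ℂ) * (𝓕 χ) w) atTop (nhds 0) := by
    intro T hT
    have := (smooth_limit χ hχ T hT).const_mul (T : ℂ)
    rw [mul_zero] at this
    refine this.congr (fun v => ?_)
    rw [hsub T hT v, ← mul_assoc, Complex.ofReal_inv, mul_inv_cancel₀ (by exact_mod_cast hT.ne'), one_mul]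
  -- error term
  let D : ℝ → ℝ → ℝ := fun T v => ∫ w : ℝ, min 2 (2 * |w / T| + Real.exp (-v + |w / T|)) * ‖(𝓕 χ) w‖
  let D' : ℝ → ℝ := fun T => ∫ w : ℝ, min 2 (2 * |w / T|) * ‖(𝓕 χ) w‖
  have hmeas : ∀ T v, AEStronglyMeasurable (fun w : ℝ => min 2 (2 * |w / T| + Real.exp (-v + |w / T|)) * ‖(𝓕 χ) w‖) := by
    intro T v
    apply Continuous.aestronglyMeasurable
    have := (𝓕 χ).continuous
    fun_prop
  have hb : ∀ T v w, ‖min 2 (2 * |w / T| + Real.exp (-v + |w / T|)) * ‖(𝓕 χ) w‖‖ ≤ 2 * ‖(𝓕 χ) w‖ := by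
    intro T v w
    rw [norm_mul, norm_norm]
    gcongr
    rw [Real.norm_of_nonneg (by positivity)]
    exact min_le_left _ _
  have hD : ∀ T, Tendsto (D T) atTop (nhds (D' T)) := by
    intro T
    apply tendsto_integral_filter_of_dominated_convergence (fun w => 2 * ‖(𝓕 χ) w‖)
    · exact Eventually.of_forall (fun v => hmeas T v)
    · exact Eventually.of_forall (fun v => Eventually.of_forall (fun w => hb T v w))
    · exact hKint.norm.const_mul 2
    · refine Eventually.of_forall (fun w => ?_)
      apply Tendsto.mul_const
      apply Tendsto.min tendsto_const_nhds
      have : Tendsto (fun v : ℝ => Real.exp (-v + |w / T|)) atTop (nhds 0) :=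
        Real.tendsto_exp_atBot.comp (tendsto_atBot_add_const_right _ _ tendsto_neg_atTop_atBot)
      simpa using this.const_add (2 * |w / T|)
  have hD' : Tendsto D' atTop (nhds 0) := by
    have : Tendsto D' atTop (nhds (∫ w : ℝ, (0:ℝ))) := by
      apply tendsto_integral_filter_of_dominated_convergence (fun w => 2 * ‖(𝓕 χ) w‖)
      · refine Eventually.of_forall (fun v => ?_)
        apply Continuous.aestronglyMeasurable
        have := (𝓕 χ).continuous
        fun_prop
      · refine Eventually.of_forall (fun v => Eventually.of_forall (fun w => ?_))
        rw [norm_mul, norm_norm]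
        gcongr
        rw [Real.norm_of_nonneg (by positivity)]
        exact min_le_left _ _
      · exact hKint.norm.const_mul 2
      · refine Eventually.of_forall (fun w => ?_)
        have h1 : Tendsto (fun T : ℝ => |w / T|) atTop (nhds 0) := by
          have := (tendsto_const_nhds (x := w)).div_atTop tendsto_id
          simpa using this.abs
        have h2 := ((tendsto_const_nhds (x := (2:ℝ))).min (h1.const_mul 2)).mul_const ‖(𝓕 χ) w‖
        simpa using h2
    simpa using this
  have hmain : ∀ T > 0, ∀ v, |phi v| ≤ ‖∫ w : ℝ, (phi (v + w / T) : ℂ) * (𝓕 χ) w‖ + D T v := by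
    intro T hT v
    have e1 : (phi v : ℂ) = (∫ w : ℝ, (phi (v + w / T) : ℂ) * (𝓕 χ) w) -
        ∫ w : ℝ, ((phi (v + w / T) : ℂ) - phi v) * (𝓕 χ) w := by
      rw [← integral_sub]
      · have : ∀ w : ℝ, (phi (v + w / T) : ℂ) * (𝓕 χ) w - ((phi (v + w / T) : ℂ) - phi v) * (𝓕 χ) w = phi v * (𝓕 χ) w := by
          intro w; ring
        simp_rw [this]
        rw [integral_const_mul, hK, mul_one]
      · refine hKint.bdd_mul (c := 1) ?_ ?_
        · apply Measurable.aestronglyMeasurable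
          exact Complex.measurable_ofReal.comp (measurable_phi.comp (by fun_prop))
        · exact Eventually.of_forall (fun w => by simpa using abs_phi_le _)
      · refine hKint.bdd_mul (c := 2) ?_ ?_
        · apply Measurable.aestronglyMeasurable
          exact (Complex.measurable_ofReal.comp (measurable_phi.comp (by fun_prop))).sub measurable_const
        · refine Eventually.of_forall (fun w => ?_)
          refine (norm_sub_le _ _).trans ?_
          have h1 := abs_phi_le (v + w / T)
          have h2 := abs_phi_le v
          simp only [Complex.norm_real, Real.norm_eq_abs]; linarith
    have e2 : |phi v| = ‖(phi v : ℂ)‖ := by simp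
    rw [e2, e1]
    refine (norm_sub_le _ _).trans ?_
    gcongr
    apply norm_integral_le_of_norm_le
    · exact (hKint.norm.const_mul 2).mono' (hmeas T v) (Eventually.of_forall (hb T v))
    · refine Eventually.of_forall (fun w => ?_)
      rw [norm_mul]
      gcongr
      rw [← Complex.ofReal_sub, Complex.norm_real, Real.norm_eq_abs]
      apply le_min
      · refine (abs_sub _ _).trans ?_
        have h1 := abs_phi_le (v + w / T)
        have h2 := abs_phi_le v
        linarith
      · exact phi_slow' v (w / T)
  rw [Metric.tendsto_atTop']
  intro ε hε
  obtain ⟨T, hT1, hT2⟩ := ((hD'.eventually_lt_const (half_pos (half_pos hε))).and (eventually_gt_atTop 0)).exists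
  have h1 := (hlim T hT2).norm
  rw [norm_zero] at h1
  have h2 := (h1.eventually_lt_const (half_pos hε)).and ((hD T).eventually_lt_const (hT1.trans (half_lt_self (half_pos hε))))
  obtain ⟨V, hV⟩ := eventually_atTop.mp h2
  refine ⟨V, fun v hv => ?_⟩
  have := hV v hv.le
  have := hmain T hT2 v
  rw [Real.dist_eq, sub_zero]
  linarith [this]

/-- `M(n) = o(n)`, equivalent to the prime number theorem. -/
theorem tendsto_M : Tendsto (fun n : ℕ => (∑ k ∈ Finset.Icc 1 n, (moebius k : ℝ)) / n) atTop (nhds 0) := by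
  have h := tendsto_phi.comp (Real.tendsto_log_atTop.comp tendsto_natCast_atTop_atTop)
  refine h.congr' ?_
  filter_upwards [eventually_gt_atTop 0] with n hn
  have : (0:ℝ) < n := by exact_mod_cast hn
  simp only [Function.comp, phi, Mf]
  rw [Real.exp_neg, Real.exp_log this, Nat.floor_natCast]
  rfl

end Part1

section Part2
section abel
variable {E : Type*} [NormedAddCommGroup E] [NormedSpace ℝ E]

lemma abel_aux (w : ℕ → ℝ) (c : ℕ → E) (m n : ℕ) (hmn : m ≤ n) (B : ℝ)
    (hw : ∀ i, m ≤ i → w (i+1) ≤ w i)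
    (hB : ∀ k, m ≤ k → k ≤ n → ‖∑ i ∈ Finset.Ico m k, c i‖ ≤ B) :
    ‖∑ i ∈ Finset.Ico m n, w i • c i - w n • ∑ i ∈ Finset.Ico m n, c i‖ ≤ B * (w m - w n) := by
  induction n, hmn using Nat.le_induction with
  | base => simp
  | succ n hn ih =>
    have ih' := ih (fun k h1 h2 => hB k h1 (by omega))
    have hBn := hB (n+1) (by omega) le_rfl
    rw [Finset.sum_Ico_succ_top hn] at hBn ⊢
    rw [Finset.sum_Ico_succ_top hn]
    have e : ∑ i ∈ Finset.Ico m n, w i • c i + w n • c n - w (n+1) • (∑ i ∈ Finset.Ico m n, c i + c n)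
      = (∑ i ∈ Finset.Ico m n, w i • c i - w n • ∑ i ∈ Finset.Ico m n, c i)
        + (w n - w (n+1)) • (∑ i ∈ Finset.Ico m n, c i + c n) := by
      simp only [sub_smul, smul_add]; abel
    rw [e]
    refine (norm_add_le _ _).trans ?_
    rw [norm_smul, Real.norm_of_nonneg (by linarith [hw n hn])]
    have := hw n hn
    nlinarith [mul_le_mul_of_nonneg_left hBn (sub_nonneg.mpr this)]

lemma abel_antitone (w : ℕ → ℝ) (c : ℕ → E) (m n : ℕ) (B : ℝ) (hB0 : 0 ≤ B)
    (hw : ∀ i, m ≤ i → w (i+1) ≤ w i) (h0 : ∀ i, m ≤ i → 0 ≤ w i)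
    (hB : ∀ k, m ≤ k → k ≤ n → ‖∑ i ∈ Finset.Ico m k, c i‖ ≤ B) :
    ‖∑ i ∈ Finset.Ico m n, w i • c i‖ ≤ B * w m := by
  rcases le_total m n with hmn | hmn
  · have h1 := abel_aux w c m n hmn B hw hB
    have h2 : ‖w n • ∑ i ∈ Finset.Ico m n, c i‖ ≤ B * w n := by
      rw [norm_smul, Real.norm_of_nonneg (h0 n hmn), mul_comm]
      exact mul_le_mul_of_nonneg_right (hB n hmn le_rfl) (h0 n hmn)
    have h3 := norm_add_le (∑ i ∈ Finset.Ico m n, w i • c i - w n • ∑ i ∈ Finset.Ico m n, c i) (w n • ∑ i ∈ Finset.Ico m n, c i)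
    rw [sub_add_cancel] at h3
    linarith
  · rw [Finset.Ico_eq_empty_of_le hmn]
    simpa using mul_nonneg hB0 (h0 m le_rfl)

lemma abel_monotone (w : ℕ → ℝ) (c : ℕ → E) (m n : ℕ) (B : ℝ) (hmn : m ≤ n)
    (hw : ∀ i, m ≤ i → w i ≤ w (i+1)) (h0 : 0 ≤ w m) (hB0 : 0 ≤ B)
    (hB : ∀ k, m ≤ k → k ≤ n → ‖∑ i ∈ Finset.Ico m k, c i‖ ≤ B) :
    ‖∑ i ∈ Finset.Ico m n, w i • c i‖ ≤ 2 * B * w n := by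
  have h1 := abel_aux (fun i => - w i) c m n hmn B (fun i hi => by simpa using hw i hi) hB
  have hwn : 0 ≤ w n := by
    have : w m ≤ w n := Nat.le_induction (P := fun n _ => w m ≤ w n) le_rfl (fun k hk ih => ih.trans (hw k hk)) n hmn
    linarith
  have h2 : ‖w n • ∑ i ∈ Finset.Ico m n, c i‖ ≤ B * w n := by
    rw [norm_smul, Real.norm_of_nonneg hwn, mul_comm]
    exact mul_le_mul_of_nonneg_right (hB n hmn le_rfl) hwn
  have h3 := norm_add_le (∑ i ∈ Finset.Ico m n, w i • c i - w n • ∑ i ∈ Finset.Ico m n, c i) (w n • ∑ i ∈ Finset.Ico m n, c i)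
  rw [sub_add_cancel] at h3
  have h4 : ‖∑ i ∈ Finset.Ico m n, w i • c i - w n • ∑ i ∈ Finset.Ico m n, c i‖ ≤ B * (w n - w m) := by
    rw [← norm_neg]
    convert h1 using 1
    · congr 1; simp only [neg_smul, Finset.sum_neg_distrib]; abel
    · ring
  nlinarith [mul_nonneg hB0 h0]
end abel

/-- Axer's theorem. -/
lemma axer (g : ℕ → ℝ) (hg : ∀ n, |g n| ≤ 1)
    (hG : Tendsto (fun n : ℕ => (∑ k ∈ Finset.Ioc 0 n, g k) / n) atTop (nhds 0)) :
    Tendsto (fun X : ℕ => (∑ d ∈ Finset.Ioc 0 X, g d / d) - (∑ d ∈ Finset.Ioc 0 X, g d * ((X / d : ℕ) : ℝ)) / X)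
      atTop (nhds 0) := by
  rw [Metric.tendsto_atTop]
  intro ε hε
  obtain ⟨K, hK⟩ := exists_nat_gt (2 / ε)
  have hK0 : 0 < K := by
    have : (0:ℝ) < K := lt_trans (by positivity) hK
    exact_mod_cast this
  set δ : ℝ := ε / (16 * K) with hδ
  have hδ0 : 0 < δ := by positivity
  rw [Metric.tendsto_atTop] at hG
  obtain ⟨N0, hN0⟩ := hG δ hδ0
  have hGb : ∀ n : ℕ, ∀ X : ℕ, n ≤ X → |∑ k ∈ Finset.Ioc 0 n, g k| ≤ δ * X + N0 := by
    intro n X hnX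
    by_cases hn : N0 ≤ n ∧ 0 < n
    · have h1 := hN0 n hn.1
      rw [Real.dist_eq, sub_zero, abs_div, Nat.abs_cast, div_lt_iff₀ (by exact_mod_cast hn.2)] at h1
      have : (n:ℝ) ≤ X := by exact_mod_cast hnX
      have : δ * n ≤ δ * X := by gcongr
      have : (0:ℝ) ≤ N0 := by positivity
      linarith
    · have hn' : n ≤ N0 := by omega
      have h1 : |∑ k ∈ Finset.Ioc 0 n, g k| ≤ n := by
        refine (Finset.abs_sum_le_sum_abs _ _).trans ((Finset.sum_le_sum (fun k _ => hg k)).trans ?_)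
        simp
      have : (n:ℝ) ≤ N0 := by exact_mod_cast hn'
      have : 0 ≤ δ * X := by positivity
      linarith
  obtain ⟨N1, hN1⟩ := exists_nat_gt (16 * K * N0 / ε)
  refine ⟨N1 + 1, fun X hX => ?_⟩
  have hX0 : (0:ℝ) < X := by exact_mod_cast (by omega : 0 < X)
  obtain ⟨D, hD⟩ : ∃ D, D = X / K := ⟨_, rfl⟩
  have hDX : D ≤ X := hD ▸ Nat.div_le_self _ _
  have hsplit : Finset.Ioc 0 X = Finset.Ioc 0 D ∪ Finset.Ico (D+1) (X+1) := by
    ext; simp only [Finset.mem_Ioc, Finset.mem_union, Finset.mem_Ico]; omega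
  have hdisj : Disjoint (Finset.Ioc 0 D) (Finset.Ico (D+1) (X+1)) := by
    rw [Finset.disjoint_left]; intro a; simp only [Finset.mem_Ioc, Finset.mem_Ico]; omega
  set B := 2 * (δ * X + N0) with hB
  have hB0 : 0 ≤ B := by positivity
  have hBk : ∀ k, D + 1 ≤ k → k ≤ X + 1 → ‖∑ i ∈ Finset.Ico (D+1) k, g i‖ ≤ B := by
    intro k h1 h2
    have e : ∑ i ∈ Finset.Ico (D+1) k, g i = ∑ i ∈ Finset.Ioc 0 (k-1), g i - ∑ i ∈ Finset.Ioc 0 D, g i := by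
      rw [eq_sub_iff_add_eq', ← Finset.sum_union]
      · apply Finset.sum_congr _ (fun _ _ => rfl)
        ext; simp only [Finset.mem_Ioc, Finset.mem_union, Finset.mem_Ico]; omega
      · rw [Finset.disjoint_left]; intro a; simp only [Finset.mem_Ioc, Finset.mem_Ico]; omega
    rw [e, Real.norm_eq_abs]
    have a1 := hGb (k-1) X (by omega)
    have a2 := hGb D X hDX
    refine (abs_sub _ _).trans ?_
    linarith
  have hXD : (X:ℝ) / ((D+1 : ℕ):ℝ) ≤ K := by
    rw [div_le_iff₀ (by positivity)]
    have : X < K * (D + 1) := hD ▸ Nat.lt_mul_div_succ X hK0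
    exact_mod_cast this.le
  -- tail estimates
  have t1 : |∑ d ∈ Finset.Ico (D+1) (X+1), (X/d : ℝ) * g d| ≤ B * K := by
    have := abel_antitone (fun d => (X:ℝ)/d) g (D+1) (X+1) B hB0 (by
      intro i hi
      have : (0:ℝ) < i := by exact_mod_cast (by omega : 0 < i)
      push_cast
      gcongr
      linarith) (fun i _ => by positivity) hBk
    simp only [smul_eq_mul] at this
    refine this.trans ?_
    gcongr
  have t2 : |∑ d ∈ Finset.Ico (D+1) (X+1), ((X/d : ℕ) : ℝ) * g d| ≤ B * K := by
    have := abel_antitone (fun d => ((X/d : ℕ) : ℝ)) g (D+1) (X+1) B hB0 (by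
      intro i hi
      have : X / (i+1) ≤ X / i := Nat.div_le_div_left (by omega) (by omega)
      exact_mod_cast this) (fun i _ => by positivity) hBk
    simp only [smul_eq_mul] at this
    refine this.trans ?_
    exact mul_le_mul_of_nonneg_left (Nat.cast_div_le.trans hXD) hB0
  have t3 : |∑ d ∈ Finset.Ioc 0 D, ((X/d : ℝ) - ((X/d : ℕ) : ℝ)) * g d| ≤ D := by
    refine (Finset.abs_sum_le_sum_abs _ _).trans ((Finset.sum_le_sum (g := fun _ => (1:ℝ)) (fun d hd => ?_)).trans (by simp))
    have hd0 : 0 < d := (Finset.mem_Ioc.mp hd).1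
    rw [abs_mul]
    refine mul_le_one₀ ?_ (abs_nonneg _) (hg d)
    have h1 : ((X/d : ℕ) : ℝ) ≤ (X/d : ℝ) := Nat.cast_div_le
    have h2 : (X/d : ℝ) ≤ ((X/d : ℕ) : ℝ) + 1 := by
      rw [div_le_iff₀ (by exact_mod_cast hd0)]
      have : X < d * (X/d + 1) := Nat.lt_mul_div_succ X hd0
      have : (X:ℝ) ≤ d * (((X/d : ℕ):ℝ) + 1) := by exact_mod_cast this.le
      linarith
    rw [abs_of_nonneg (by linarith)]; linarith
  have key : X * ((∑ d ∈ Finset.Ioc 0 X, g d / d) - (∑ d ∈ Finset.Ioc 0 X, g d * ((X / d : ℕ) : ℝ)) / X) =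
      ∑ d ∈ Finset.Ioc 0 D, ((X/d : ℝ) - ((X/d : ℕ) : ℝ)) * g d +
      (∑ d ∈ Finset.Ico (D+1) (X+1), (X/d : ℝ) * g d - ∑ d ∈ Finset.Ico (D+1) (X+1), ((X/d : ℕ) : ℝ) * g d) := by
    rw [mul_sub, mul_div_cancel₀ _ hX0.ne', Finset.mul_sum, ← Finset.sum_sub_distrib, ← Finset.sum_sub_distrib, hsplit,
      Finset.sum_union hdisj]
    congr 1 <;> (apply Finset.sum_congr rfl; intro d _; ring)
  have hfin : X * |(∑ d ∈ Finset.Ioc 0 X, g d / d) - (∑ d ∈ Finset.Ioc 0 X, g d * ((X / d : ℕ) : ℝ)) / X| ≤ D + 2 * (B * K) := by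
    have : (X:ℝ) * |(∑ d ∈ Finset.Ioc 0 X, g d / d) - (∑ d ∈ Finset.Ioc 0 X, g d * ((X / d : ℕ) : ℝ)) / X| = 
      |X * ((∑ d ∈ Finset.Ioc 0 X, g d / d) - (∑ d ∈ Finset.Ioc 0 X, g d * ((X / d : ℕ) : ℝ)) / X)| := by
      rw [abs_mul, Nat.abs_cast]
    rw [this, key]
    refine (abs_add_le _ _).trans ?_
    have := abs_sub (∑ d ∈ Finset.Ico (D+1) (X+1), (X/d : ℝ) * g d) (∑ d ∈ Finset.Ico (D+1) (X+1), ((X/d : ℕ) : ℝ) * g d)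
    linarith
  rw [Real.dist_eq, sub_zero]
  have hDle : (D:ℝ) < ε / 2 * X := by
    have h1 : (D:ℝ) ≤ X / K := hD ▸ Nat.cast_div_le
    have hKr : (0:ℝ) < K := by exact_mod_cast hK0
    have h2 : (X:ℝ) / K < ε / 2 * X := by
      rw [div_lt_iff₀ hKr]
      rw [div_lt_iff₀ hε] at hK
      nlinarith
    linarith
  have hBK : 2 * (B * K) ≤ ε / 2 * X := by
    have hKr : (0:ℝ) < K := by exact_mod_cast hK0
    have e1 : δ * K = ε / 16 := by rw [hδ]; field_simp
    have e2 : 16 * K * N0 ≤ ε * X := by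
      rw [div_lt_iff₀ hε] at hN1
      have : (N1:ℝ) ≤ X := by exact_mod_cast (by omega : N1 ≤ X)
      nlinarith
    have e3 : 2 * (B * K) = 4 * X * (δ * K) + 4 * (K * N0) := by rw [hB]; ring
    rw [e3, e1]; nlinarith
  have : X * |(∑ d ∈ Finset.Ioc 0 X, g d / d) - (∑ d ∈ Finset.Ioc 0 X, g d * ((X / d : ℕ) : ℝ)) / X| < X * ε := by
    linarith
  exact lt_of_mul_lt_mul_left this hX0.le

end Part2

section Part3
/-- the largest prime factor -/
def Pmax (n : ℕ) : ℕ := n.primeFactors.sup id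

def gg (f : ℕ → ℝ) : ArithmeticFunction ℝ :=
  ⟨fun d => if d ≤ 1 then 0 else (moebius d : ℝ) * f d.minFac, by simp⟩

lemma gg_apply (f : ℕ → ℝ) (d : ℕ) :
    gg f d = if d ≤ 1 then 0 else (moebius d : ℝ) * f d.minFac := rfl

lemma sum_divisors_coprime_mul {M : Type*} [AddCommMonoid M] {a b : ℕ} (h : a.Coprime b) (F : ℕ → M) :
    ∑ d ∈ (a * b).divisors, F d = ∑ i ∈ a.divisors, ∑ j ∈ b.divisors, F (i * j) := by
  rw [← Finset.sum_product']
  symm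
  refine Finset.sum_bij (fun x _ => x.1 * x.2) ?_ ?_ ?_ ?_
  · rintro ⟨i, j⟩ hx
    simp only [Finset.mem_product, Nat.mem_divisors] at hx ⊢
    exact ⟨mul_dvd_mul hx.1.1 hx.2.1, mul_ne_zero hx.1.2 hx.2.2⟩
  · rintro ⟨i, j⟩ hx ⟨i', j'⟩ hx' he
    simp only [Finset.mem_product, Nat.mem_divisors] at hx hx' he
    have c1 : i.Coprime j' := Nat.Coprime.coprime_dvd_left hx.1.1 (Nat.Coprime.coprime_dvd_right hx'.2.1 h)
    have c2 : i'.Coprime j := Nat.Coprime.coprime_dvd_left hx'.1.1 (Nat.Coprime.coprime_dvd_right hx.2.1 h)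
    have hi : i = i' := by
      apply Nat.dvd_antisymm
      · exact c1.dvd_of_dvd_mul_right (he ▸ Dvd.intro _ rfl)
      · exact c2.dvd_of_dvd_mul_right (he ▸ Dvd.intro _ rfl)
    subst hi
    have : i ≠ 0 := fun h0 => by simp [h0] at hx
    rw [Nat.mul_right_inj this] at he
    rw [he]
  · intro d hd
    obtain ⟨i, hi, j, hj, rfl⟩ := Finset.mem_mul.mp (Nat.divisors_mul a b ▸ hd)
    exact ⟨(i, j), Finset.mem_product.mpr ⟨hi, hj⟩, rfl⟩
  · intros; rfl

lemma sum_gg_divisors (f : ℕ → ℝ) (n : ℕ) (hn : 2 ≤ n) :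
    ∑ d ∈ n.divisors, gg f d = - f (Pmax n) := by
  induction n using Nat.strong_induction_on with
  | _ n ih =>
  set p := n.minFac with hp
  have pp : p.Prime := Nat.minFac_prime (by omega)
  obtain ⟨k, m, hpm, hnm⟩ := Nat.exists_eq_pow_mul_and_not_dvd (by omega : n ≠ 0) p pp.ne_one
  have hk : k ≠ 0 := by
    rintro rfl
    apply hpm
    rw [pow_zero, one_mul] at hnm
    rw [← hnm]; exact Nat.minFac_dvd n
  have hm0 : m ≠ 0 := by rintro rfl; simp at hpm
  have hcop : (p ^ k).Coprime m := Nat.Coprime.pow_left _ ((Nat.Prime.coprime_iff_not_dvd pp).mpr hpm)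
  have hdn : ∀ e, e ∣ m → e ∣ n := fun e he => hnm ▸ he.mul_left _
  -- main recursion
  have hsecond : ∀ e ∈ m.divisors, gg f (p * e) = - f p * (moebius e : ℝ) := by
    intro e he
    have hem := Nat.dvd_of_mem_divisors he
    have he0 : e ≠ 0 := fun h => by simp [h] at he
    have hpe : p.Coprime e := (Nat.Prime.coprime_iff_not_dvd pp).mpr (fun h => hpm (h.trans hem))
    have h2 := pp.two_le
    have hbig : 2 ≤ p * e := by nlinarith [Nat.pos_of_ne_zero he0]
    rw [gg_apply, if_neg (by omega)]
    have hmf : (p * e).minFac = p := by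
      apply le_antisymm
      · exact Nat.minFac_le_of_dvd pp.two_le (Dvd.intro _ rfl)
      · have hq := Nat.minFac_prime (show p * e ≠ 1 by omega)
        have hqd := Nat.minFac_dvd (p * e)
        apply Nat.minFac_le_of_dvd hq.two_le
        rcases (Nat.Prime.dvd_mul hq).mp hqd with h | h
        · exact h.trans (Nat.minFac_dvd n)
        · exact h.trans (hdn e hem)
    rw [hmf, isMultiplicative_moebius.map_mul_of_coprime hpe, moebius_apply_prime pp]
    push_cast; ring
  have hmu : ∑ e ∈ m.divisors, (moebius e : ℝ) = if m = 1 then 1 else 0 := by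
    have := congrArg (fun F : ArithmeticFunction ℝ => F m) (coe_moebius_mul_coe_zeta (R := ℝ))
    simp only [coe_mul_zeta_apply, one_apply, intCoe_apply] at this
    exact this
  have hrec : ∑ d ∈ n.divisors, gg f d = ∑ e ∈ m.divisors, gg f e - f p * (if m = 1 then 1 else 0) := by
    rw [hnm, sum_divisors_coprime_mul hcop, Nat.sum_divisors_prime_pow pp]
    rw [← Finset.sum_subset (s₁ := {0, 1})]
    · rw [Finset.sum_pair (by norm_num)]
      simp only [pow_zero, one_mul, pow_one]
      rw [Finset.sum_congr rfl hsecond, ← Finset.mul_sum, hmu]; ring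
    · intro x hx
      simp only [Finset.mem_insert, Finset.mem_singleton] at hx
      simp only [Finset.mem_range]; omega
    · intro x _ hx
      simp only [Finset.mem_insert, Finset.mem_singleton] at hx
      apply Finset.sum_eq_zero
      intro e he
      rw [gg_apply]
      split_ifs
      · rfl
      · rw [moebius_eq_zero_of_not_squarefree, Int.cast_zero, zero_mul]
        intro hsq
        have : p * p ∣ p ^ x * e := by
          rw [← sq]
          exact (pow_dvd_pow p (by omega)).mul_right _
        exact pp.not_isUnit (hsq p this)
  have hpf : n.primeFactors = {p} ∪ m.primeFactors := by
    rw [hnm, Nat.primeFactors_mul (pow_ne_zero _ pp.ne_zero) hm0, Nat.primeFactors_prime_pow hk pp]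
  rw [hrec]
  by_cases hm1 : m = 1
  · subst hm1
    have : Pmax n = p := by rw [Pmax, hpf]; simp
    simp [this, gg_apply]
  · rw [if_neg hm1, mul_zero, sub_zero, ih m ?_ (by omega)]
    · congr 2
      rw [Pmax, Pmax, hpf, Finset.sup_union, Finset.sup_singleton]
      symm
      apply sup_eq_right.mpr
      obtain ⟨q, hq⟩ := Nat.exists_prime_and_dvd hm1
      refine le_trans ?_ (Finset.le_sup (f := id) (Nat.mem_primeFactors.mpr ⟨hq.1, hq.2, hm0⟩))
      exact Nat.minFac_le_of_dvd hq.1.two_le (hdn _ hq.2)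
    · rw [hnm]
      have : 1 < p ^ k := Nat.one_lt_pow hk pp.one_lt
      nlinarith [Nat.pos_of_ne_zero hm0]

lemma sum_gg_mul_div (f : ℕ → ℝ) (X : ℕ) :
    ∑ d ∈ Finset.Ioc 0 X, gg f d * ((X / d : ℕ) : ℝ) = - ∑ n ∈ Finset.Ioc 1 X, f (Pmax n) := by
  rw [← sum_Ioc_mul_zeta_eq_sum, ← Finset.sum_neg_distrib]
  rw [← Finset.sum_subset (s₁ := Finset.Ioc 1 X)]
  · apply Finset.sum_congr rfl
    intro n hn
    rw [coe_mul_zeta_apply, sum_gg_divisors f n (by simp at hn; omega)]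
  · intro n; simp only [Finset.mem_Ioc]; omega
  · intro n hn hn'
    simp only [Finset.mem_Ioc] at hn hn'
    have : n = 1 := by omega
    subst this
    rw [coe_mul_zeta_apply]; simp [gg_apply]

end Part3

section Part4
lemma tendsto_div_of_bound {A : ℕ → ℝ} (h : ∀ ε > 0, ∃ C, ∀ x : ℕ, |A x| ≤ ε * x + C * √x) :
    Tendsto (fun x : ℕ => A x / x) atTop (nhds 0) := by
  rw [Metric.tendsto_atTop]
  intro ε hε
  obtain ⟨C, hC⟩ := h (ε/3) (by positivity)
  obtain ⟨N, hN⟩ := exists_nat_gt ((3 * |C| / ε)^2)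
  refine ⟨N+1, fun x hx => ?_⟩
  have hx0 : (0:ℝ) < x := by exact_mod_cast (by omega : 0 < x)
  have hs : 0 < √(x:ℝ) := Real.sqrt_pos.mpr hx0
  have h1 : 3 * |C| / ε ≤ √(x:ℝ) := by
    apply Real.le_sqrt_of_sq_le
    have : (N:ℝ) ≤ x := by exact_mod_cast (by omega : N ≤ x)
    linarith
  rw [Real.dist_eq, sub_zero, abs_div, Nat.abs_cast, div_lt_iff₀ hx0]
  refine (hC x).trans_lt ?_
  rw [div_le_iff₀ hε] at h1
  have h2 : C * √x ≤ |C| * √x := mul_le_mul_of_nonneg_right (le_abs_self C) hs.le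
  have h3 : √(x:ℝ) * √x = x := Real.mul_self_sqrt hx0.le
  have h4 : 3 * (|C| * √x) ≤ ε * x := by
    calc 3 * (|C| * √x) = 3 * |C| * √x := by ring
      _ ≤ √x * ε * √x := mul_le_mul_of_nonneg_right h1 hs.le
      _ = ε * x := by rw [← h3]; simp only [h3]; nlinarith
  have : 0 < ε * x := by positivity
  linarith

lemma bound_of_tendsto_div {B : ℕ → ℝ} (h : Tendsto (fun x : ℕ => B x / x) atTop (nhds 0)) (ε : ℝ) (hε : 0 < ε) :
    ∃ C, 0 ≤ C ∧ ∀ x : ℕ, |B x| ≤ ε * x + C := by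
  rw [Metric.tendsto_atTop] at h
  obtain ⟨N, hN⟩ := h ε hε
  refine ⟨∑ n ∈ Finset.range (N+1), |B n|, Finset.sum_nonneg (fun _ _ => abs_nonneg _), fun x => ?_⟩
  by_cases hx : x < N + 1
  · have := Finset.single_le_sum (f := fun n => |B n|) (fun i _ => abs_nonneg _) (Finset.mem_range.mpr hx)
    have : 0 ≤ ε * x := by positivity
    linarith
  · have h1 := hN x (by omega)
    have hx0 : (0:ℝ) < x := by exact_mod_cast (by omega : 0 < x)
    rw [Real.dist_eq, sub_zero, abs_div, Nat.abs_cast, div_lt_iff₀ hx0] at h1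
    have : 0 ≤ ∑ n ∈ Finset.range (N+1), |B n| := Finset.sum_nonneg (fun _ _ => abs_nonneg _)
    linarith

lemma tendsto_of_recursion {A B : ℕ → ℝ} {p : ℕ} (hp : 2 ≤ p) (h0 : A 0 = 0)
    (hrec : ∀ x, A x = B x + A (x / p)) (hB : Tendsto (fun x : ℕ => B x / x) atTop (nhds 0)) :
    Tendsto (fun x : ℕ => A x / x) atTop (nhds 0) := by
  apply tendsto_div_of_bound
  intro ε hε
  obtain ⟨C, hC0, hC⟩ := bound_of_tendsto_div hB (ε/2) (by positivity)
  refine ⟨4 * C, fun x => ?_⟩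
  induction x using Nat.strong_induction_on with
  | _ x ih =>
  rcases Nat.eq_zero_or_pos x with rfl | hx
  · simp [h0]
  · have hlt : x / p < x := Nat.div_lt_self hx (by omega)
    have h1 := ih _ hlt
    have h2 := hC x
    rw [hrec]
    have h3 : ((x/p : ℕ) : ℝ) ≤ x / 2 := by
      have : x / p ≤ x / 2 := Nat.div_le_div_left hp (by norm_num)
      have h' : ((x/p : ℕ) : ℝ) ≤ ((x/2 : ℕ) : ℝ) := by exact_mod_cast this
      have h'' : ((x/2 : ℕ) : ℝ) ≤ x / 2 := by exact_mod_cast (Nat.cast_div_le (α := ℝ) (m := x) (n := 2))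
      linarith
    have hx1 : (1:ℝ) ≤ x := by exact_mod_cast hx
    have hs1 : 1 ≤ √(x:ℝ) := Real.one_le_sqrt.mpr hx1
    have h4 : √((x/p : ℕ) : ℝ) ≤ 3/4 * √x := by
      rw [Real.sqrt_le_left (by positivity), mul_pow, Real.sq_sqrt (by positivity)]
      linarith
    refine (abs_add_le _ _).trans ?_
    have h5 : ε * ((x/p : ℕ) : ℝ) ≤ ε * (x/2) := by gcongr
    have h6 : 4 * C * √((x/p : ℕ) : ℝ) ≤ 4 * C * (3/4 * √x) := by gcongr
    nlinarith [mul_le_mul_of_nonneg_left hs1 hC0]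

def Rz (z d : ℕ) : Prop := (primorial z).Coprime d
instance (z d : ℕ) : Decidable (Rz z d) := by unfold Rz; infer_instance

lemma primorial_succ_prime {z : ℕ} (hz : (z+1).Prime) : primorial (z+1) = (z+1) * primorial z := by
  unfold primorial
  rw [Finset.range_add_one (n := z+1), Finset.filter_insert, if_pos hz, Finset.prod_insert (by simp)]

lemma primorial_succ_not_prime {z : ℕ} (hz : ¬ (z+1).Prime) : primorial (z+1) = primorial z := by
  unfold primorial
  rw [Finset.range_add_one (n := z+1), Finset.filter_insert, if_neg hz]

lemma Rz_succ {z d : ℕ} (hz : (z+1).Prime) : Rz (z+1) d ↔ ¬ (z+1) ∣ d ∧ Rz z d := by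
  unfold Rz
  rw [primorial_succ_prime hz, Nat.coprime_mul_iff_left, Nat.Prime.coprime_iff_not_dvd hz]

lemma Rz_succ_not {z d : ℕ} (hz : ¬ (z+1).Prime) : Rz (z+1) d ↔ Rz z d := by
  unfold Rz
  rw [primorial_succ_not_prime hz]

def Mz (z x : ℕ) : ℝ := ∑ d ∈ Finset.Ioc 0 x with Rz z d, (moebius d : ℝ)

lemma Mz_rec {z : ℕ} (hz : (z+1).Prime) (x : ℕ) : Mz z x = Mz (z+1) x - Mz (z+1) (x / (z+1)) := by
  unfold Mz
  have e1 : (Finset.Ioc 0 x).filter (Rz z) = (Finset.Ioc 0 x).filter (Rz (z+1)) ∪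
      (Finset.Ioc 0 x).filter (fun d => Rz z d ∧ (z+1) ∣ d) := by
    ext d; simp only [Finset.mem_filter, Finset.mem_union, Rz_succ hz]; tauto
  rw [e1, Finset.sum_union, sub_eq_add_neg]
  swap
  · rw [Finset.disjoint_left]; intro d; simp only [Finset.mem_filter, Rz_succ hz]; tauto
  congr 1
  have hcopz : (primorial z).Coprime (z+1) := by
    rw [Nat.coprime_comm, Nat.Prime.coprime_iff_not_dvd hz, hz.dvd_primorial_iff]; omega
  rw [← Finset.sum_neg_distrib, ← Finset.sum_subset (s₁ := ((Finset.Ioc 0 (x/(z+1))).filter (Rz (z+1))).image (fun e => (z+1) * e))]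
  · rw [Finset.sum_image (fun a _ b _ h => Nat.eq_of_mul_eq_mul_left (Nat.succ_pos z) h)]
    apply Finset.sum_congr rfl
    intro e he
    rw [Finset.mem_filter, Rz_succ hz] at he
    rw [isMultiplicative_moebius.map_mul_of_coprime ((Nat.Prime.coprime_iff_not_dvd hz).mpr he.2.1), moebius_apply_prime hz]
    push_cast; ring
  · intro d hd
    rw [Finset.mem_image] at hd
    obtain ⟨e, he, rfl⟩ := hd
    rw [Finset.mem_filter, Rz_succ hz, Finset.mem_Ioc] at he
    rw [Finset.mem_filter, Finset.mem_Ioc]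
    refine ⟨⟨Nat.mul_pos (Nat.succ_pos z) he.1.1, ?_⟩, ?_, Dvd.intro _ rfl⟩
    · have := (Nat.le_div_iff_mul_le (Nat.succ_pos z)).mp he.1.2
      linarith
    · exact Nat.Coprime.mul_right hcopz he.2.2
  · intro d hd hnd
    rw [Finset.mem_filter, Finset.mem_Ioc] at hd
    obtain ⟨⟨hd0, hdx⟩, hR, e, rfl⟩ := hd
    have : ¬ Squarefree ((z+1) * e) := by
      intro hsq
      apply hnd
      rw [Finset.mem_image]
      refine ⟨e, ?_, rfl⟩
      rw [Finset.mem_filter, Rz_succ hz, Finset.mem_Ioc, Nat.le_div_iff_mul_le (Nat.succ_pos z)]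
      refine ⟨⟨Nat.pos_of_mul_pos_left hd0, by linarith⟩, ?_, Nat.Coprime.coprime_dvd_right (Dvd.intro_left _ rfl) hR⟩
      intro hdvd
      exact hz.not_isUnit (hsq (z+1) (mul_dvd_mul_left _ hdvd))
    rw [moebius_eq_zero_of_not_squarefree this]; simp

lemma tendsto_Mz (z : ℕ) : Tendsto (fun x : ℕ => Mz z x / x) atTop (nhds 0) := by
  induction z with
  | zero =>
    convert tendsto_M using 3 with x
    unfold Mz
    rw [Finset.filter_true_of_mem (fun d _ => by simp [Rz])]
    rfl
  | succ z ih =>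
    by_cases hz : (z+1).Prime
    · exact tendsto_of_recursion (p := z+1) hz.two_le (by simp [Mz]) (fun x => by rw [Mz_rec hz]; ring) ih
    · refine ih.congr (fun x => ?_)
      unfold Mz
      rw [Finset.filter_congr (fun d _ => (Rz_succ_not hz).symm)]

def Gz (f : ℕ → ℝ) (z x : ℕ) : ℝ := ∑ d ∈ Finset.Ioc 0 x with Rz z d, gg f d

lemma Gz_rec (f : ℕ → ℝ) (z x : ℕ) (hz : (z+1).Prime) : Gz f z x - Gz f (z+1) x = f (z+1) * (Mz z x - Mz (z+1) x) := by
  have e1 : (Finset.Ioc 0 x).filter (Rz z) = (Finset.Ioc 0 x).filter (Rz (z+1)) ∪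
      (Finset.Ioc 0 x).filter (fun d => Rz z d ∧ (z+1) ∣ d) := by
    ext d; simp only [Finset.mem_filter, Finset.mem_union, Rz_succ hz]; tauto
  have hdis : Disjoint ((Finset.Ioc 0 x).filter (Rz (z+1))) ((Finset.Ioc 0 x).filter (fun d => Rz z d ∧ (z+1) ∣ d)) := by
    rw [Finset.disjoint_left]; intro d; simp only [Finset.mem_filter, Rz_succ hz]; tauto
  unfold Gz Mz
  rw [e1, Finset.sum_union hdis, Finset.sum_union hdis, add_sub_cancel_left, add_sub_cancel_left, Finset.mul_sum]
  apply Finset.sum_congr rfl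
  intro d hd
  rw [Finset.mem_filter, Finset.mem_Ioc] at hd
  have h2 := Nat.le_of_dvd hd.1.1 hd.2.2
  have := hz.two_le
  rw [gg_apply, if_neg (by omega), mul_comm]
  congr 2
  apply le_antisymm
  · exact Nat.minFac_le_of_dvd hz.two_le hd.2.2
  · have hq := Nat.minFac_prime (show d ≠ 1 by omega)
    by_contra hlt
    have h3 : d.minFac ∣ primorial z := hq.dvd_primorial_iff.mpr (by omega)
    exact hq.one_lt.ne' (Nat.eq_one_of_dvd_coprimes hd.2.1 h3 (Nat.minFac_dvd d))

lemma tendsto_Gz_diff (f : ℕ → ℝ) (z : ℕ) : Tendsto (fun x : ℕ => (Gz f 0 x - Gz f z x) / x) atTop (nhds 0) := by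
  induction z with
  | zero => simp
  | succ z ih =>
    by_cases hz : (z+1).Prime
    · have h := ih.add (((tendsto_Mz z).sub (tendsto_Mz (z+1))).const_mul (f (z+1)))
      simp only [sub_zero, mul_zero, add_zero] at h
      refine h.congr (fun x => ?_)
      have := Gz_rec f z x hz
      rw [← sub_div, ← mul_div_assoc, ← this]; ring
    · refine ih.congr (fun x => ?_)
      unfold Gz
      rw [Finset.filter_congr (fun d _ => (Rz_succ_not hz).symm)]

lemma totient_ratio_small (ε : ℝ) (hε : 0 < ε) : ∃ z, ((primorial z).totient : ℝ) ≤ ε * primorial z := by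
  have h := not_summable_one_div_on_primes
  rw [not_summable_iff_tendsto_nat_atTop_of_nonneg (fun n => by
    apply Set.indicator_nonneg; intros; positivity)] at h
  obtain ⟨n, hn⟩ := (h.eventually_ge_atTop (- Real.log ε)).exists
  refine ⟨n, ?_⟩
  have h1 := Nat.totient_eq_mul_prod_factors (primorial n)
  have h2 : ((primorial n).totient : ℝ) = primorial n * ∏ p ∈ (primorial n).primeFactors, (1 - (p:ℝ)⁻¹) := by
    have := congrArg (fun q : ℚ => (q : ℝ)) h1
    push_cast at this
    exact this
  rw [h2, mul_comm]
  apply mul_le_mul_of_nonneg_right _ (Nat.cast_nonneg _)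
  calc ∏ p ∈ (primorial n).primeFactors, (1 - (p:ℝ)⁻¹) ≤ ∏ p ∈ (primorial n).primeFactors, Real.exp (-(p:ℝ)⁻¹) := by
        apply Finset.prod_le_prod
        · intro p hp
          have : 1 ≤ (p:ℝ) := by exact_mod_cast (Nat.prime_of_mem_primeFactors hp).one_lt.le
          linarith [inv_le_one_of_one_le₀ this]
        · intro p _
          linarith [Real.add_one_le_exp (-(p:ℝ)⁻¹)]
    _ = Real.exp (- ∑ p ∈ (primorial n).primeFactors, (p:ℝ)⁻¹) := by
        rw [← Real.exp_sum, Finset.sum_neg_distrib]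
    _ ≤ Real.exp (Real.log ε) := by
        apply Real.exp_le_exp.mpr
        have : ∑ i ∈ Finset.range n, ({p | Nat.Prime p} : Set ℕ).indicator (fun n : ℕ => (1:ℝ) / n) i ≤ 
            ∑ p ∈ (primorial n).primeFactors, (p:ℝ)⁻¹ := by
          rw [primeFactors_primorial]
          have e : ∑ i ∈ Finset.range n, ({p | Nat.Prime p} : Set ℕ).indicator (fun n : ℕ => (1:ℝ) / n) i = 
            ∑ i ∈ Finset.range n with i.Prime, (i:ℝ)⁻¹ := by
            rw [Finset.sum_filter]
            apply Finset.sum_congr rfl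
            intro i _
            simp [Set.indicator_apply]
          rw [e]
          apply Finset.sum_le_sum_of_subset_of_nonneg
          · intro p; simp only [Finset.mem_filter, Finset.mem_range, Nat.mem_primesLE]; intro h; exact ⟨h.1.le, h.2⟩
          · intros; positivity
        linarith
    _ = ε := Real.exp_log hε

lemma card_Rz_le (z x : ℕ) : (((Finset.Ioc 0 x).filter (Rz z)).card : ℝ) ≤
    (primorial z).totient * ((x:ℝ) / primorial z + 1) := by
  have h := Nat.Ico_filter_coprime_le 1 x (primorial_ne_zero z)
  have e : (Finset.Ioc 0 x).filter (Rz z) = (Finset.Ico 1 (1+x)).filter (fun d => (primorial z).Coprime d) := by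
    ext d; simp only [Finset.mem_filter, Finset.mem_Ioc, Finset.mem_Ico, Rz]
    constructor <;> (rintro ⟨h1, h2⟩; exact ⟨by omega, h2⟩)
  rw [e]
  calc _ ≤ (((primorial z).totient * (x / primorial z + 1) : ℕ) : ℝ) := by exact_mod_cast h
    _ ≤ _ := by
      push_cast
      gcongr
      exact Nat.cast_div_le

lemma abs_gg_le (f : ℕ → ℝ) (hf : ∀ n, |f n| ≤ 1) (d : ℕ) : |gg f d| ≤ 1 := by
  rw [gg_apply]
  split_ifs
  · simp
  · rw [abs_mul]
    exact mul_le_one₀ (abs_moebius_real_le_one d) (abs_nonneg _) (hf _)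

lemma tendsto_sum_gg (f : ℕ → ℝ) (hf : ∀ n, |f n| ≤ 1) :
    Tendsto (fun n : ℕ => (∑ k ∈ Finset.Ioc 0 n, gg f k) / n) atTop (nhds 0) := by
  have h0 : ∀ n, ∑ k ∈ Finset.Ioc 0 n, gg f k = Gz f 0 n := by
    intro n; unfold Gz; rw [Finset.filter_true_of_mem (fun d _ => by simp [Rz])]
  simp only [h0]
  apply tendsto_div_of_bound
  intro ε hε
  obtain ⟨z, hz⟩ := totient_ratio_small (ε/2) (by positivity)
  obtain ⟨C, hC0, hC⟩ := bound_of_tendsto_div (tendsto_Gz_diff f z) (ε/2) (by positivity)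
  refine ⟨C + (primorial z).totient, fun x => ?_⟩
  rcases Nat.eq_zero_or_pos x with rfl | hx
  · simp [Gz]
  have hG : |Gz f z x| ≤ (primorial z).totient * ((x:ℝ) / primorial z + 1) := by
    refine le_trans ?_ (card_Rz_le z x)
    unfold Gz
    refine (Finset.abs_sum_le_sum_abs _ _).trans ((Finset.sum_le_sum (fun k _ => abs_gg_le f hf k)).trans ?_)
    simp
  have hP : (0:ℝ) < primorial z := by exact_mod_cast primorial_pos z
  have h2 : (primorial z).totient * ((x:ℝ) / primorial z + 1) ≤ ε / 2 * x + (primorial z).totient := by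
    rw [mul_add, mul_one, mul_div_assoc']
    have : (primorial z).totient * (x:ℝ) / primorial z ≤ ε / 2 * x := by
      rw [div_le_iff₀ hP]
      nlinarith [mul_le_mul_of_nonneg_right hz (Nat.cast_nonneg (α := ℝ) x)]
    linarith
  have hs1 : 1 ≤ √(x:ℝ) := Real.one_le_sqrt.mpr (by exact_mod_cast hx)
  have h3 := abs_add_le (Gz f 0 x - Gz f z x) (Gz f z x)
  rw [sub_add_cancel] at h3
  have h4 := hC x
  have h5 : 0 ≤ C + (primorial z).totient := by positivity
  nlinarith [mul_le_mul_of_nonneg_left hs1 h5]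

/-- Reduction to the distribution of the largest prime factor. -/
lemma reduction1 (f : ℕ → ℝ) (hf : ∀ n, |f n| ≤ 1) (δ : ℝ)
    (h : Tendsto (fun X : ℕ => (∑ n ∈ Finset.Ioc 1 X, f (Pmax n)) / X) atTop (nhds δ)) :
    Tendsto (fun X : ℕ => ∑ n ∈ Finset.Icc 2 X, (moebius n : ℝ) / n * f n.minFac) atTop (nhds (-δ)) := by
  have h1 := (axer (gg f) (abs_gg_le f hf) (tendsto_sum_gg f hf)).add h.neg
  rw [zero_add] at h1
  refine h1.congr (fun X => ?_)
  rw [sum_gg_mul_div, neg_div, sub_neg_eq_add, add_neg_cancel_right]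
  rw [← Finset.sum_subset (s₁ := Finset.Icc 2 X)]
  · apply Finset.sum_congr rfl
    intro n hn
    rw [Finset.mem_Icc] at hn
    rw [gg_apply, if_neg (by omega)]; ring
  · intro n; simp only [Finset.mem_Ioc, Finset.mem_Icc]; omega
  · intro n hn hn'
    simp only [Finset.mem_Ioc, Finset.mem_Icc] at hn hn'
    rw [gg_apply, if_pos (by omega)]; simp

end Part4

section Part5
lemma sum_factorization_Ioc (p X : ℕ) :
    ∑ n ∈ Finset.Ioc 0 X, n.factorization p = (X.factorial).factorization p := by
  induction X with
  | zero => simp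
  | succ X ih =>
    rw [Finset.sum_Ioc_succ_top (by omega), ih, Nat.factorial_succ, 
      Nat.factorization_mul (by omega) (Nat.factorial_ne_zero X)]
    simp [add_comm]

lemma factorization_factorial_le {p : ℕ} (hp : p.Prime) (X : ℕ) :
    ((X.factorial).factorization p : ℝ) ≤ 2 * X / p := by
  have := Fact.mk hp
  have h := sub_one_mul_padicValNat_factorial (p := p) X
  rw [Nat.factorization_def _ hp]
  have h1 : (p - 1) * padicValNat p X.factorial ≤ X := by rw [h]; exact Nat.sub_le _ _
  have h2 : ((p:ℝ) - 1) * padicValNat p X.factorial ≤ X := by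
    have : (((p - 1 : ℕ) : ℝ)) * padicValNat p X.factorial ≤ X := by exact_mod_cast h1
    rwa [Nat.cast_sub hp.one_lt.le, Nat.cast_one] at this
  have hp2 : (2:ℝ) ≤ p := by exact_mod_cast hp.two_le
  rw [le_div_iff₀ (by linarith)]
  have h3 : (0:ℝ) ≤ padicValNat p X.factorial := Nat.cast_nonneg _
  nlinarith

lemma mertens_upper (z : ℕ) (hz : 1 ≤ z) :
    ∑ d ∈ Finset.Ioc 0 z, Λ d / d ≤ Real.log z + (Real.log 4 + 4) := by
  have hz0 : (0:ℝ) < z := by exact_mod_cast hz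
  have h1 := sum_Ioc_mul_zeta_eq_sum Λ z
  rw [vonMangoldt_mul_zeta] at h1
  have h2 : ∑ n ∈ Finset.Ioc 0 z, ArithmeticFunction.log n ≤ z * Real.log z := by
    calc _ ≤ ∑ n ∈ Finset.Ioc 0 z, Real.log z := by
          apply Finset.sum_le_sum
          intro n hn
          rw [Finset.mem_Ioc] at hn
          rw [log_apply]
          exact Real.log_le_log (by exact_mod_cast hn.1) (by exact_mod_cast hn.2)
      _ = _ := by simp
  have h3 : z * ∑ d ∈ Finset.Ioc 0 z, Λ d / d ≤ ∑ d ∈ Finset.Ioc 0 z, Λ d * ((z/d : ℕ) : ℝ) + ∑ d ∈ Finset.Ioc 0 z, Λ d := by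
    rw [Finset.mul_sum, ← Finset.sum_add_distrib]
    apply Finset.sum_le_sum
    intro d hd
    have hd0 := (Finset.mem_Ioc.mp hd).1
    have : (z:ℝ)/d ≤ ((z/d : ℕ) : ℝ) + 1 := by
      rw [div_le_iff₀ (by exact_mod_cast hd0)]
      have : z < d * (z/d + 1) := Nat.lt_mul_div_succ z hd0
      have : (z:ℝ) ≤ d * (((z/d : ℕ):ℝ) + 1) := by exact_mod_cast this.le
      linarith
    have h4 : (0:ℝ) ≤ Λ d := vonMangoldt_nonneg
    calc z * (Λ d / d) = Λ d * (z / d) := by ring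
      _ ≤ Λ d * (((z/d : ℕ) : ℝ) + 1) := by gcongr
      _ = _ := by ring
  have h5 : ∑ d ∈ Finset.Ioc 0 z, Λ d ≤ (Real.log 4 + 4) * z := by
    have := Chebyshev.psi_le_const_mul_self (x := z) hz0.le
    unfold Chebyshev.psi at this
    rwa [Nat.floor_natCast] at this
  have : z * ∑ d ∈ Finset.Ioc 0 z, Λ d / d ≤ z * (Real.log z + (Real.log 4 + 4)) := by
    rw [← h1] at h3; linarith
  exact le_of_mul_le_mul_left this hz0

lemma sum_log_primes_div (z : ℕ) (hz : 1 ≤ z) :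
    ∑ p ∈ Nat.primesLE z, Real.log p / p ≤ Real.log z + (Real.log 4 + 4) := by
  refine le_trans ?_ (mertens_upper z hz)
  calc ∑ p ∈ Nat.primesLE z, Real.log p / p = ∑ p ∈ Nat.primesLE z, Λ p / p := by
        apply Finset.sum_congr rfl
        intro p hp
        rw [vonMangoldt_apply_prime (Nat.mem_primesLE.mp hp).2]
    _ ≤ _ := by
        apply Finset.sum_le_sum_of_subset_of_nonneg
        · intro p hp
          rw [Nat.mem_primesLE] at hp
          rw [Finset.mem_Ioc]; exact ⟨hp.2.pos, hp.1⟩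
        · intro i _ _
          exact div_nonneg vonMangoldt_nonneg (Nat.cast_nonneg _)

lemma le_Pmax {n p : ℕ} (hp : p ∈ n.primeFactors) : p ≤ Pmax n := Finset.le_sup (f := id) hp

lemma sum_log_smooth (X z : ℕ) (hz : 1 ≤ z) :
    ∑ n ∈ Finset.Ioc 0 X with Pmax n ≤ z, Real.log n ≤ 2 * X * (Real.log z + (Real.log 4 + 4)) := by
  calc ∑ n ∈ Finset.Ioc 0 X with Pmax n ≤ z, Real.log n 
      ≤ ∑ n ∈ Finset.Ioc 0 X with Pmax n ≤ z, ∑ p ∈ Nat.primesLE z, (n.factorization p : ℝ) * Real.log p := by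
        apply Finset.sum_le_sum
        intro n hn
        rw [Finset.mem_filter] at hn
        rw [Real.log_nat_eq_sum_factorization, Finsupp.sum]
        apply Finset.sum_le_sum_of_subset_of_nonneg
        · intro p hp
          rw [Nat.support_factorization] at hp
          rw [Nat.mem_primesLE]
          exact ⟨(le_Pmax hp).trans hn.2, Nat.prime_of_mem_primeFactors hp⟩
        · intro p hp _
          exact mul_nonneg (Nat.cast_nonneg _) (Real.log_natCast_nonneg p)
    _ ≤ ∑ n ∈ Finset.Ioc 0 X, ∑ p ∈ Nat.primesLE z, (n.factorization p : ℝ) * Real.log p := by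
        apply Finset.sum_le_sum_of_subset_of_nonneg (Finset.filter_subset _ _)
        intro n _ _
        apply Finset.sum_nonneg
        intro p _
        exact mul_nonneg (Nat.cast_nonneg _) (Real.log_natCast_nonneg p)
    _ = ∑ p ∈ Nat.primesLE z, ((X.factorial).factorization p : ℝ) * Real.log p := by
        rw [Finset.sum_comm]
        apply Finset.sum_congr rfl
        intro p _
        rw [← Finset.sum_mul, ← sum_factorization_Ioc]
        push_cast; rfl
    _ ≤ ∑ p ∈ Nat.primesLE z, (2 * X) * (Real.log p / p) := by
        apply Finset.sum_le_sum
        intro p hp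
        have := factorization_factorial_le (Nat.mem_primesLE.mp hp).2 X
        calc _ ≤ 2 * X / p * Real.log p := mul_le_mul_of_nonneg_right this (Real.log_natCast_nonneg p)
          _ = _ := by ring
    _ ≤ _ := by
        rw [← Finset.mul_sum]
        exact mul_le_mul_of_nonneg_left (sum_log_primes_div z hz) (by positivity)

lemma card_smooth (X z : ℕ) (hz : 1 ≤ z) (hX : 2 ≤ X) :
    (((Finset.Ioc 0 X).filter (fun n => Pmax n ≤ z)).card : ℝ) ≤ 
      √X + 4 * X * (Real.log z + (Real.log 4 + 4)) / Real.log X := by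
  have hlog : 0 < Real.log X := Real.log_pos (by exact_mod_cast hX)
  have hX0 : (0:ℝ) < X := by exact_mod_cast (by omega : 0 < X)
  set S := (Finset.Ioc 0 X).filter (fun n => Pmax n ≤ z) with hS
  have h1 : (S.card : ℝ) = (S.filter (fun n => n ≤ Nat.sqrt X)).card + (S.filter (fun n => ¬ n ≤ Nat.sqrt X)).card := by
    exact_mod_cast (Finset.card_filter_add_card_filter_not (s := S) (fun n => n ≤ Nat.sqrt X)).symm
  have h2 : ((S.filter (fun n => n ≤ Nat.sqrt X)).card : ℝ) ≤ √X := by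
    have : (S.filter (fun n => n ≤ Nat.sqrt X)).card ≤ (Finset.Ioc 0 (Nat.sqrt X)).card := by
      apply Finset.card_le_card
      intro n hn
      simp only [hS, Finset.mem_filter, Finset.mem_Ioc] at hn ⊢
      exact ⟨hn.1.1.1, hn.2⟩
    rw [Nat.card_Ioc] at this
    calc _ ≤ ((Nat.sqrt X : ℕ) : ℝ) := by exact_mod_cast this
      _ ≤ √X := Real.nat_sqrt_le_real_sqrt
  have h3 : ((S.filter (fun n => ¬ n ≤ Nat.sqrt X)).card : ℝ) * (Real.log X / 2) ≤ 2 * X * (Real.log z + (Real.log 4 + 4)) := by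
    refine le_trans ?_ (sum_log_smooth X z hz)
    calc _ = ∑ n ∈ S.filter (fun n => ¬ n ≤ Nat.sqrt X), (Real.log X / 2) := by simp
      _ ≤ ∑ n ∈ S.filter (fun n => ¬ n ≤ Nat.sqrt X), Real.log n := by
        apply Finset.sum_le_sum
        intro n hn
        have hn2 := (Finset.mem_filter.mp hn).2
        have : X < n * n := Nat.sqrt_lt.mp (by omega)
        have hn0 : (n:ℝ) ≠ 0 := by
          have : n ≠ 0 := by rintro rfl; omega
          exact_mod_cast this
        have : Real.log X ≤ Real.log (n * n) := Real.log_le_log hX0 (by exact_mod_cast this.le)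
        rw [Real.log_mul hn0 hn0] at this
        linarith
      _ ≤ ∑ n ∈ S, Real.log n := by
        apply Finset.sum_le_sum_of_subset_of_nonneg (Finset.filter_subset _ _)
        intro n _ _
        exact Real.log_natCast_nonneg n
  rw [h1]
  apply add_le_add h2
  rw [le_div_iff₀ hlog]
  linarith

lemma Pmax_mem {n : ℕ} (hn : 2 ≤ n) : Pmax n ∈ n.primeFactors := by
  have hne : n.primeFactors.Nonempty := by rw [Nat.nonempty_primeFactors]; omega
  obtain ⟨p, hp, h⟩ := Finset.exists_mem_eq_sup n.primeFactors hne id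
  unfold Pmax; rw [h]; exact hp

lemma Pmax_mul_prime {m p : ℕ} (hm : 0 < m) (hp : p.Prime) (h : Pmax m ≤ p) : Pmax (m * p) = p := by
  unfold Pmax at *
  rw [Nat.primeFactors_mul hm.ne' hp.ne_zero, Finset.sup_union, hp.primeFactors, Finset.sup_singleton]
  exact sup_eq_right.mpr h

lemma Pmax_dvd_le {m n : ℕ} (hn : n ≠ 0) (h : m ∣ n) : Pmax m ≤ Pmax n :=
  Finset.sup_mono (Nat.primeFactors_mono h hn)

lemma sum_rough (F : ℕ → ℝ) (X z : ℕ) :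
    ∑ n ∈ Finset.Ioc 1 X with z < Pmax n, F (Pmax n) =
      ∑ m ∈ Finset.Ioc 0 (X / (z+1)), ∑ p ∈ (Nat.primesLE (X / m)) with max z (Pmax m - 1) < p, F p := by
  rw [Finset.sum_sigma']
  refine Finset.sum_bij' (fun n _ => ⟨n / Pmax n, Pmax n⟩) (fun x _ => x.1 * x.2) ?_ ?_ ?_ ?_ ?_
  · intro n hn
    simp only [Finset.mem_filter, Finset.mem_Ioc] at hn
    obtain ⟨⟨hn1, hnX⟩, hz⟩ := hn
    have hmem := Pmax_mem (n := n) (by omega)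
    rw [Nat.mem_primeFactors] at hmem
    obtain ⟨hp, hd, _⟩ := hmem
    have hmul : n / Pmax n * Pmax n = n := Nat.div_mul_cancel hd
    have hpos : 0 < n / Pmax n := Nat.div_pos (Nat.le_of_dvd (by omega) hd) hp.pos
    have hle : Pmax (n / Pmax n) ≤ Pmax n := Pmax_dvd_le (by omega) (Nat.div_dvd_of_dvd hd)
    simp only [Finset.mem_sigma, Finset.mem_Ioc, Finset.mem_filter, Nat.mem_primesLE]
    refine ⟨⟨hpos, ?_⟩, ⟨?_, hp⟩, ?_⟩
    · rw [Nat.le_div_iff_mul_le (by omega)]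
      calc n / Pmax n * (z+1) ≤ n / Pmax n * Pmax n := Nat.mul_le_mul_left _ hz
        _ ≤ X := by omega
    · rw [Nat.le_div_iff_mul_le hpos, mul_comm, hmul]; exact hnX
    · have := hp.pos
      rw [max_lt_iff]; exact ⟨hz, by omega⟩
  · rintro ⟨m, p⟩ hx
    simp only [Finset.mem_sigma, Finset.mem_Ioc, Finset.mem_filter, Nat.mem_primesLE, max_lt_iff] at hx
    obtain ⟨⟨hm, hmX⟩, ⟨hpX, hp⟩, hzp, hPp⟩ := hx
    rw [Nat.le_div_iff_mul_le hm] at hpX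
    simp only [Finset.mem_filter, Finset.mem_Ioc]
    rw [Pmax_mul_prime hm hp (by omega)]
    refine ⟨⟨?_, by rw [mul_comm]; exact hpX⟩, hzp⟩
    have := hp.two_le
    nlinarith
  · intro n hn
    simp only [Finset.mem_filter, Finset.mem_Ioc] at hn
    exact Nat.div_mul_cancel (Nat.mem_primeFactors.mp (Pmax_mem (n := n) (by omega))).2.1
  · rintro ⟨m, p⟩ hx
    simp only [Finset.mem_sigma, Finset.mem_Ioc, Finset.mem_filter, Nat.mem_primesLE, max_lt_iff] at hx
    obtain ⟨⟨hm, hmX⟩, ⟨hpX, hp⟩, hzp, hPp⟩ := hx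
    have : Pmax (m * p) = p := Pmax_mul_prime hm hp (by omega)
    simp only [this, Nat.mul_div_cancel _ hp.pos]
  · intros; rfl

lemma sum_rough_le (F : ℕ → ℝ) (X z : ℕ) (E : ℝ) (hE : 0 ≤ E)
    (h : ∀ y, z < y → y ≤ X → ∀ t ≤ y, |∑ p ∈ Nat.primesLE t, F p| ≤ E * y) (hX : 1 ≤ X) :
    |∑ n ∈ Finset.Ioc 1 X with z < Pmax n, F (Pmax n)| ≤ 2 * E * X * (1 + Real.log X) := by
  rw [sum_rough]
  refine (Finset.abs_sum_le_sum_abs _ _).trans ?_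
  have key : ∀ m ∈ Finset.Ioc 0 (X / (z+1)), |∑ p ∈ (Nat.primesLE (X / m)) with max z (Pmax m - 1) < p, F p| ≤ 2 * E * X * (m:ℝ)⁻¹ := by
    intro m hm
    rw [Finset.mem_Ioc, Nat.le_div_iff_mul_le (by omega)] at hm
    obtain ⟨hm0, hm⟩ := hm
    have hzy : z < X / m := by rw [Nat.lt_iff_add_one_le, Nat.le_div_iff_mul_le hm0]; linarith
    set a := max z (Pmax m - 1)
    have hm0' : (0:ℝ) < m := by exact_mod_cast hm0
    by_cases ha : X / m ≤ a
    · rw [Finset.filter_false_of_mem]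
      · simp only [Finset.sum_empty, abs_zero]; positivity
      · intro p hp; rw [Nat.mem_primesLE] at hp; omega
    · have e : ∑ p ∈ (Nat.primesLE (X / m)) with a < p, F p = ∑ p ∈ Nat.primesLE (X/m), F p - ∑ p ∈ Nat.primesLE a, F p := by
        rw [eq_sub_iff_add_eq, ← Finset.sum_union]
        · apply Finset.sum_congr _ (fun _ _ => rfl)
          ext p; simp only [Finset.mem_union, Finset.mem_filter, Nat.mem_primesLE]
          constructor
          · rintro (h | h)
            · exact h.1
            · exact ⟨by omega, h.2⟩
          · intro h
            by_cases hh : a < p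
            · left; exact ⟨h, hh⟩
            · right; exact ⟨by omega, h.2⟩
        · rw [Finset.disjoint_left]; intro p; simp only [Finset.mem_filter, Nat.mem_primesLE]; omega
      rw [e]
      have b1 := h (X/m) hzy (Nat.div_le_self _ _) (X/m) le_rfl
      have b2 := h (X/m) hzy (Nat.div_le_self _ _) a (by omega)
      have b3 : E * ((X/m : ℕ) : ℝ) ≤ E * (X * (m:ℝ)⁻¹) := by
        rw [← div_eq_mul_inv]
        exact mul_le_mul_of_nonneg_left Nat.cast_div_le hE
      refine (abs_sub _ _).trans ?_
      linarith
  refine (Finset.sum_le_sum key).trans ?_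
  rw [← Finset.mul_sum]
  apply mul_le_mul_of_nonneg_left _ (by positivity)
  calc ∑ m ∈ Finset.Ioc 0 (X / (z+1)), (m:ℝ)⁻¹ ≤ ∑ m ∈ Finset.Icc 1 X, (m:ℝ)⁻¹ := by
        apply Finset.sum_le_sum_of_subset_of_nonneg
        · intro m; simp only [Finset.mem_Ioc, Finset.mem_Icc]
          have := Nat.div_le_self X (z+1)
          omega
        · intros; positivity
    _ ≤ 1 + Real.log X := by
        have := harmonic_le_one_add_log X
        rw [harmonic_eq_sum_Icc] at this
        push_cast at this
        exact this

end Part5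

section Part6
lemma sum_F_Pmax (F : ℕ → ℝ) (hF : ∀ n, |F n| ≤ 1)
    (H : ∀ ε > 0, ∃ Y0 : ℕ, ∀ y ≥ Y0, ∀ t ≤ y, |∑ p ∈ Nat.primesLE t, F p| ≤ ε * y / Real.log y) :
    Tendsto (fun X : ℕ => (∑ n ∈ Finset.Ioc 1 X, F (Pmax n)) / X) atTop (nhds 0) := by
  rw [Metric.tendsto_nhds]
  intro ε hε
  set η := ε / 16 with hη
  have hη0 : 0 < η := by positivity
  obtain ⟨Y0, hY0⟩ := H (η * ε / 16) (by positivity)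
  have hcast := tendsto_natCast_atTop_atTop (R := ℝ)
  have c1 := (Real.tendsto_log_atTop.comp hcast).eventually_ge_atTop (max 1 (192 / ε))
  have c2 := (Real.tendsto_sqrt_atTop.comp hcast).eventually_ge_atTop (8 / ε)
  have c3 := ((tendsto_rpow_atTop hη0).comp hcast).eventually_ge_atTop ((Y0:ℝ) + 1)
  filter_upwards [c1, c2, c3, eventually_ge_atTop 2] with X c1 c2 c3 hX2
  simp only [Function.comp] at c1 c2 c3
  have hX0 : (0:ℝ) < X := by exact_mod_cast (by omega : 0 < X)
  set L := Real.log X with hL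
  have hL1 : 1 ≤ L := le_trans (le_max_left _ _) c1
  have hL2 : 192 / ε ≤ L := le_trans (le_max_right _ _) c1
  have hrp : 0 < (X:ℝ) ^ η := Real.rpow_pos_of_pos hX0 _
  have hlogrp : Real.log ((X:ℝ)^η) = η * L := Real.log_rpow hX0 _
  obtain ⟨z, hz⟩ : ∃ z : ℕ, z = ⌊(X:ℝ)^η⌋₊ := ⟨_, rfl⟩
  have hzle : (z:ℝ) ≤ (X:ℝ)^η := hz ▸ Nat.floor_le hrp.le
  have hzlt : (X:ℝ)^η < z + 1 := hz ▸ Nat.lt_floor_add_one _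
  have hzY : Y0 + 1 ≤ z := by rw [hz]; apply Nat.le_floor; exact_mod_cast c3
  have hz1 : 1 ≤ z := by omega
  have hz0 : (0:ℝ) < z := by exact_mod_cast hz1
  have hlz : Real.log z ≤ η * L := by rw [← hlogrp]; exact Real.log_le_log hz0 hzle
  have rough := sum_rough_le F X z (ε / 16 / L) (by positivity) (by
    intro y hy _ t ht
    refine (hY0 y (by omega) t ht).trans ?_
    have hy' : (z:ℝ) + 1 ≤ y := by exact_mod_cast hy
    have hly : η * L ≤ Real.log y := by
      rw [← hlogrp]; exact Real.log_le_log hrp (by linarith)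
    have : 0 < η * L := by positivity
    rw [div_le_iff₀ (by linarith)]
    calc η * ε / 16 * y = ε / 16 / L * y * (η * L) := by field_simp
      _ ≤ _ := by gcongr) (by omega)
  have smooth : |∑ n ∈ Finset.Ioc 1 X with ¬ z < Pmax n, F (Pmax n)| ≤ √X + 4 * X * (Real.log z + (Real.log 4 + 4)) / L := by
    refine le_trans ?_ (card_smooth X z hz1 hX2)
    refine (Finset.abs_sum_le_sum_abs _ _).trans ((Finset.sum_le_sum (fun k _ => hF _)).trans ?_)
    rw [Finset.sum_const, nsmul_eq_mul, mul_one]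
    have : ((Finset.Ioc 1 X).filter (fun n => ¬ z < Pmax n)).card ≤ ((Finset.Ioc 0 X).filter (fun n => Pmax n ≤ z)).card := by
      apply Finset.card_le_card
      intro n; simp only [Finset.mem_filter, Finset.mem_Ioc]; omega
    exact_mod_cast this
  have hlog4 : Real.log 4 ≤ 2 := by
    have : Real.log 4 = 2 * Real.log 2 := by
      rw [show (4:ℝ) = 2^2 by norm_num, Real.log_pow]; norm_num
    linarith [Real.log_two_lt_d9]
  have s1 : √(X:ℝ) ≤ ε / 8 * X := by
    have h3 : √(X:ℝ) * √X = X := Real.mul_self_sqrt hX0.le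
    rw [div_le_iff₀ hε] at c2
    have := mul_le_mul_of_nonneg_right c2 (Real.sqrt_nonneg (X:ℝ))
    nlinarith
  have s2 : 4 * X * (Real.log z + (Real.log 4 + 4)) / L ≤ (ε / 4 + ε / 8) * X := by
    rw [div_le_iff₀ (by linarith)]
    rw [div_le_iff₀ hε] at hL2
    have : Real.log z + (Real.log 4 + 4) ≤ η * L + 6 := by linarith
    calc 4 * X * (Real.log z + (Real.log 4 + 4)) ≤ 4 * X * (η * L + 6) := by gcongr
      _ = X * (ε / 4 * L + 24) := by rw [hη]; ring
      _ ≤ X * (ε / 4 * L + L * ε / 8) := by gcongr; linarith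
      _ = _ := by ring
  have s3 : 2 * (ε / 16 / L) * X * (1 + L) ≤ ε / 4 * X := by
    have : (ε / 16 / L) * (1 + L) ≤ ε / 8 := by
      rw [div_mul_eq_mul_div, div_le_iff₀ (by linarith)]; nlinarith
    nlinarith
  rw [Real.dist_eq, sub_zero, abs_div, Nat.abs_cast, div_lt_iff₀ hX0,
    ← Finset.sum_filter_add_sum_filter_not _ (fun n => z < Pmax n)]
  refine (abs_add_le _ _).trans_lt ?_
  have : 0 < ε * X := by positivity
  linarith

lemma reduction (f : ℕ → ℝ) (δ : ℝ) (hf0 : ∀ n, 0 ≤ f n) (hf1 : ∀ n, f n ≤ 1) (hδ0 : 0 ≤ δ) (hδ1 : δ ≤ 1)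
    (H : ∀ ε > 0, ∃ Y0 : ℕ, ∀ y ≥ Y0, ∀ t ≤ y, |∑ p ∈ Nat.primesLE t, (f p - δ)| ≤ ε * y / Real.log y) :
    Tendsto (fun X : ℕ => ∑ n ∈ Finset.Icc 2 X, (moebius n : ℝ) / n * f n.minFac) atTop (nhds (-δ)) := by
  apply reduction1 f (fun n => by rw [abs_of_nonneg (hf0 n)]; exact hf1 n)
  have h1 := sum_F_Pmax (fun n => f n - δ) (fun n => by
    rw [abs_le]; constructor <;> linarith [hf0 n, hf1 n]) H
  have h2 : Tendsto (fun X : ℕ => δ - δ * (X:ℝ)⁻¹) atTop (nhds δ) := by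
    have := (tendsto_inv_atTop_nhds_zero_nat (𝕜 := ℝ)).const_mul δ
    simpa using tendsto_const_nhds.sub this
  have h3 := h1.add h2
  rw [zero_add] at h3
  refine h3.congr' ?_
  filter_upwards [eventually_ge_atTop 1] with X hX
  have hX0 : (0:ℝ) < X := by exact_mod_cast hX
  rw [Finset.sum_sub_distrib, Finset.sum_const, Nat.card_Ioc, nsmul_eq_mul, Nat.cast_sub hX]
  field_simp
  push_cast
  ring

end Part6

section Part7
lemma ee_int (k : ℤ) : ee k = 1 := by
  unfold ee
  rw [Complex.exp_eq_one_iff]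
  exact ⟨k, by push_cast; ring⟩

lemma ee_zero : ee 0 = 1 := by simpa using ee_int 0

lemma norm_ee_sub_one (β η : ℝ) (h : ∀ k : ℤ, η ≤ |β - k|) : 4 * η ≤ ‖ee β - 1‖ := by
  set r := β - round β with hr
  have h1 : ee β = ee r := by
    have : β = r + (round β : ℤ) := by rw [hr]; ring
    rw [this, ee_add, ee_int, mul_one]
  have h2 : |r| ≤ 1/2 := abs_sub_round β
  have h3 : η ≤ |r| := h (round β)
  have h4 : ee r = Complex.exp (Complex.I * ((2 * Real.pi * r : ℝ) : ℂ)) := by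
    unfold ee; congr 1; push_cast; ring
  rw [h1, h4, Complex.norm_exp_I_mul_ofReal_sub_one, norm_mul, Real.norm_eq_abs, Real.norm_eq_abs]
  have hpi := Real.pi_pos
  have e : 2 * Real.pi * r / 2 = Real.pi * r := by ring
  rw [e]
  have h5 : |Real.pi * r| ≤ Real.pi / 2 := by
    rw [abs_mul, abs_of_pos hpi]; nlinarith
  have h6 := Real.mul_abs_le_abs_sin h5
  rw [abs_mul Real.pi r, abs_of_pos hpi] at h6
  have h7 : 2 / Real.pi * (Real.pi * |r|) = 2 * |r| := by field_simp
  rw [h7] at h6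
  rw [abs_of_pos (by norm_num : (0:ℝ) < 2)]
  linarith

lemma geom_bound (β η : ℝ) (hη : 0 < η) (h : ∀ k : ℤ, η ≤ |β - k|) (a b : ℕ) :
    ‖∑ i ∈ Finset.Ico a b, ee (i * β)‖ ≤ 1 / η := by
  rcases le_total a b with hab | hab
  · have tel : (∑ i ∈ Finset.Ico a b, ee (i * β)) * (ee β - 1) = ee (b * β) - ee (a * β) := by
      induction b, hab using Nat.le_induction with
      | base => simp
      | succ n hn ih =>
        rw [Finset.sum_Ico_succ_top hn, add_mul, ih]
        have : ee ((n+1 : ℕ) * β) = ee (n * β) * ee β := by rw [← ee_add]; congr 1; push_cast; ring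
        rw [this]; ring
    have h1 := congrArg norm tel
    rw [norm_mul] at h1
    have h2 : ‖ee (b * β) - ee (a * β)‖ ≤ 2 := by
      refine (norm_sub_le _ _).trans ?_
      rw [norm_ee, norm_ee]; norm_num
    have h3 := norm_ee_sub_one β η h
    rw [le_div_iff₀ hη]
    nlinarith [mul_le_mul_of_nonneg_left h3 (norm_nonneg (∑ i ∈ Finset.Ico a b, ee (i * β)))]
  · rw [Finset.Ico_eq_empty_of_le hab]; simp; positivity

lemma Ioc_eq_Ico (a b : ℕ) : Finset.Ioc a b = Finset.Ico (a+1) (b+1) := by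
  ext; simp only [Finset.mem_Ioc, Finset.mem_Ico]; omega

/-- weighted sum with weight `n` -/
lemma weighted_bound (β η : ℝ) (hη : 0 < η) (h : ∀ k : ℤ, η ≤ |β - k|) (a b : ℕ) :
    ‖∑ i ∈ Finset.Ioc a b, (i:ℝ) • ee (i * β)‖ ≤ 2 * (1 / η) * (b + 1) := by
  rw [Ioc_eq_Ico]
  rcases le_total (a+1) (b+1) with hab | hab
  · have := abel_monotone (fun i => (i:ℝ)) (fun i => ee (i * β)) (a+1) (b+1) (1/η) hab
      (fun i _ => by push_cast; linarith) (by positivity) (by positivity) (fun k _ _ => geom_bound β η hη h _ _)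
    push_cast at this ⊢
    exact this
  · rw [Finset.Ico_eq_empty_of_le hab]; simp; positivity

lemma weighted_trivial (β : ℝ) (a b : ℕ) :
    ‖∑ i ∈ Finset.Ioc a b, (i:ℝ) • ee (i * β)‖ ≤ (b:ℝ) * b := by
  calc _ ≤ ∑ i ∈ Finset.Ioc a b, (b:ℝ) := by
        refine (norm_sum_le _ _).trans (Finset.sum_le_sum ?_)
        intro i hi
        rw [norm_smul, norm_ee, mul_one, Real.norm_eq_abs, Nat.abs_cast]
        exact_mod_cast (Finset.mem_Ioc.mp hi).2
    _ ≤ _ := by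
        rw [Finset.sum_const, nsmul_eq_mul, Nat.card_Ioc]
        gcongr
        exact_mod_cast Nat.sub_le _ _

lemma log_bound (β η : ℝ) (hη : 0 < η) (h : ∀ k : ℤ, η ≤ |β - k|) (b : ℕ) :
    ‖∑ i ∈ Finset.Ioc 0 b, Real.log i • ee (i * β)‖ ≤ 2 * (1 / η) * Real.log (b + 1) := by
  rw [Ioc_eq_Ico]
  have := abel_monotone (fun i => Real.log i) (fun i => ee (i * β)) (0+1) (b+1) (1/η) (by omega)
      (fun i hi => Real.log_le_log (by exact_mod_cast hi) (by push_cast; linarith)) (by simp) (by positivity) (fun k _ _ => geom_bound β η hη h _ _)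
  push_cast at this ⊢
  exact this

def Dio (c : ℝ) (N : ℕ) (β : ℝ) : Prop := ∀ m : ℕ, 1 ≤ m → ∀ k : ℤ, c / (m:ℝ)^N ≤ |m * β - k|

/-- sums over products -/
lemma sum_mul_ee (F G : ArithmeticFunction ℝ) (h : ℕ → ℂ) (x : ℕ) :
    ∑ n ∈ Finset.Ioc 0 x, (F * G) n • h n = 
      ∑ m ∈ Finset.Ioc 0 x, F m • ∑ k ∈ Finset.Ioc 0 (x / m), G k • h (m * k) := by
  simp only [mul_apply]
  trans ∑ n ∈ Finset.Ioc 0 x, ∑ y ∈ Finset.Ioc 0 x ×ˢ Finset.Ioc 0 x with y.1 * y.2 = n, (F y.1 * G y.2) • h (y.1 * y.2)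
  · refine Finset.sum_congr rfl fun n hn ↦ ?_
    simp only [Finset.mem_Ioc] at hn
    rw [Nat.divisorsAntidiagonal_eq_prod_filter_of_le hn.1.ne' hn.2, Finset.sum_smul]
    apply Finset.sum_congr rfl
    intro y hy
    rw [(Finset.mem_filter.mp hy).2]
  trans ∑ y ∈ Finset.Ioc 0 x ×ˢ Finset.Ioc 0 x with y.1 * y.2 ≤ x, (F y.1 * G y.2) • h (y.1 * y.2)
  · simp_rw [Finset.sum_filter]
    rw [Finset.sum_comm]
    apply Finset.sum_congr rfl
    intro y hy
    simp only [Finset.mem_product, Finset.mem_Ioc] at hy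
    rw [Finset.sum_ite_eq]
    have : 0 < y.1 * y.2 := Nat.mul_pos hy.1.1 hy.2.1
    simp [this]
  rw [Finset.sum_filter, Finset.sum_product]
  refine Finset.sum_congr rfl fun m hm ↦ ?_
  rw [← Finset.sum_filter, Finset.smul_sum]
  rw [Finset.mem_Ioc] at hm
  apply Finset.sum_congr
  · ext k
    simp only [Finset.mem_filter, Finset.mem_Ioc, Nat.le_div_iff_mul_le hm.1, mul_comm k m]
    constructor
    · rintro ⟨⟨h1, _⟩, h2⟩; exact ⟨h1, h2⟩
    · rintro ⟨h1, h2⟩; exact ⟨⟨h1, by nlinarith⟩, h2⟩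
  · intro k _
    rw [mul_smul]

/-- type I, constant weight -/
lemma typeI_one (c : ℝ) (hc : 0 < c) (N : ℕ) (β : ℝ) (hD : Dio c N β) (F : ArithmeticFunction ℝ) (A : ℝ) (hA : 0 ≤ A) (D x : ℕ)
    (hF : ∀ m, m ≤ x → |F m| ≤ A) (hF0 : ∀ m, D < m → F m = 0) :
    ‖∑ n ∈ Finset.Ioc 0 x, (F * (zeta : ArithmeticFunction ℝ)) n • ee (n * β)‖ ≤ A / c * (D:ℝ)^(N+1) := by
  rw [sum_mul_ee F _ (fun n => ee (n * β))]
  refine (norm_sum_le _ _).trans ?_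
  have key : ∀ m ∈ Finset.Ioc 0 x, ‖F m • ∑ k ∈ Finset.Ioc 0 (x/m), (zeta : ArithmeticFunction ℝ) k • ee ((m * k : ℕ) * β)‖
     ≤ if m ≤ D then A / c * (D:ℝ)^N else 0 := by
    intro m hm
    rw [Finset.mem_Ioc] at hm
    split_ifs with hmD
    · have e : ∑ k ∈ Finset.Ioc 0 (x/m), (zeta : ArithmeticFunction ℝ) k • ee ((m * k : ℕ) * β) = 
        ∑ k ∈ Finset.Ico 1 (x/m+1), ee (k * (m * β)) := by
        rw [Ioc_eq_Ico]
        apply Finset.sum_congr rfl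
        intro k hk
        rw [Finset.mem_Ico] at hk
        rw [natCoe_apply, zeta_apply, if_neg (by omega)]
        simp only [Nat.cast_one, one_smul]
        congr 1; push_cast; ring
      have hm0 : (0:ℝ) < m := by exact_mod_cast hm.1
      have hg := geom_bound (m * β) (c / (m:ℝ)^N) (by positivity) (hD m hm.1) 1 (x/m+1)
      rw [e, norm_smul, Real.norm_eq_abs]
      calc |F m| * _ ≤ A * (1 / (c / (m:ℝ)^N)) := mul_le_mul (hF m hm.2) hg (norm_nonneg _) hA
        _ = A / c * (m:ℝ)^N := by field_simp
        _ ≤ _ := by gcongr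
    · rw [hF0 m (by omega)]; simp
  refine (Finset.sum_le_sum key).trans ?_
  rw [← Finset.sum_filter, Finset.sum_const, nsmul_eq_mul, pow_succ]
  have : ((Finset.Ioc 0 x).filter (fun m => m ≤ D)).card ≤ (Finset.Ioc 0 D).card := by
    apply Finset.card_le_card
    intro m; simp only [Finset.mem_filter, Finset.mem_Ioc]; omega
  rw [Nat.card_Ioc] at this
  have h2 : (((Finset.Ioc 0 x).filter (fun m => m ≤ D)).card : ℝ) ≤ D := by exact_mod_cast this
  calc _ ≤ (D:ℝ) * (A / c * (D:ℝ)^N) := by gcongr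
    _ = _ := by ring

/-- type I, log weight -/
lemma typeI_log (c : ℝ) (hc : 0 < c) (N : ℕ) (β : ℝ) (hD : Dio c N β) (F : ArithmeticFunction ℝ) (A : ℝ) (hA : 0 ≤ A) (D x : ℕ)
    (hF : ∀ m, m ≤ x → |F m| ≤ A) (hF0 : ∀ m, D < m → F m = 0) :
    ‖∑ n ∈ Finset.Ioc 0 x, (F * ArithmeticFunction.log) n • ee (n * β)‖ ≤ 2 * Real.log (x+1) * A / c * (D:ℝ)^(N+1) := by
  rw [sum_mul_ee F _ (fun n => ee (n * β))]
  refine (norm_sum_le _ _).trans ?_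
  have hlx : 0 ≤ Real.log (x+1) := Real.log_nonneg (by linarith [Nat.cast_nonneg (α := ℝ) x])
  have key : ∀ m ∈ Finset.Ioc 0 x, ‖F m • ∑ k ∈ Finset.Ioc 0 (x/m), ArithmeticFunction.log k • ee ((m * k : ℕ) * β)‖
     ≤ if m ≤ D then 2 * Real.log (x+1) * A / c * (D:ℝ)^N else 0 := by
    intro m hm
    rw [Finset.mem_Ioc] at hm
    split_ifs with hmD
    · have e : ∑ k ∈ Finset.Ioc 0 (x/m), ArithmeticFunction.log k • ee ((m * k : ℕ) * β) = 
        ∑ k ∈ Finset.Ioc 0 (x/m), Real.log k • ee (k * (m * β)) := by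
        apply Finset.sum_congr rfl
        intro k hk
        rw [log_apply]
        congr 2; push_cast; ring
      have hm0 : (0:ℝ) < m := by exact_mod_cast hm.1
      have hg := log_bound (m * β) (c / (m:ℝ)^N) (by positivity) (hD m hm.1) (x/m)
      have hg2 : Real.log (((x/m : ℕ):ℝ) + 1) ≤ Real.log (x+1) := by
        apply Real.log_le_log (by positivity)
        have : x / m ≤ x := Nat.div_le_self _ _
        have : ((x/m : ℕ):ℝ) ≤ x := by exact_mod_cast this
        linarith
      rw [e, norm_smul, Real.norm_eq_abs]
      calc |F m| * _ ≤ A * (2 * (1 / (c / (m:ℝ)^N)) * Real.log (((x/m : ℕ):ℝ) + 1)) := mul_le_mul (hF m hm.2) hg (norm_nonneg _) hA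
        _ ≤ A * (2 * (1 / (c / (m:ℝ)^N)) * Real.log (x + 1)) := by gcongr
        _ = 2 * Real.log (x+1) * A / c * (m:ℝ)^N := by field_simp
        _ ≤ _ := by gcongr
    · rw [hF0 m (by omega)]; simp
  refine (Finset.sum_le_sum key).trans ?_
  rw [← Finset.sum_filter, Finset.sum_const, nsmul_eq_mul, pow_succ]
  have : ((Finset.Ioc 0 x).filter (fun m => m ≤ D)).card ≤ (Finset.Ioc 0 D).card := by
    apply Finset.card_le_card
    intro m; simp only [Finset.mem_filter, Finset.mem_Ioc]; omega
  rw [Nat.card_Ioc] at this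
  have h2 : (((Finset.Ioc 0 x).filter (fun m => m ≤ D)).card : ℝ) ≤ D := by exact_mod_cast this
  calc _ ≤ (D:ℝ) * (2 * Real.log (x+1) * A / c * (D:ℝ)^N) := by gcongr
    _ = _ := by ring

end Part7

section Part8
/-- weighted sum -/
def Wsum (β : ℝ) (V M : ℕ) : ℂ := ∑ n ∈ Finset.Ioc V M, (n:ℝ) • ee (n * β)

open Classical in
lemma card_bad (c : ℝ) (N : ℕ) (β : ℝ) (hD : Dio c N β) (hc : 0 < c) (K : ℕ) (hK : 1 ≤ K) (m : ℕ) :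
    (((Finset.range m).filter (fun h : ℕ => ∃ k : ℤ, |h * β - k| < c / (2 * (K:ℝ)^N))).card : ℝ) ≤ m / K + 1 := by
  set S := (Finset.range m).filter (fun h : ℕ => ∃ k : ℤ, |h * β - k| < c / (2 * (K:ℝ)^N)) with hS
  have hK0 : (0:ℝ) < K := by exact_mod_cast hK
  have hsep : ∀ h ∈ S, ∀ h' ∈ S, h < h' → h + K < h' := by
    intro h hh h' hh' hlt
    rw [hS, Finset.mem_filter] at hh hh'
    obtain ⟨-, k, hk⟩ := hh
    obtain ⟨-, k', hk'⟩ := hh'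
    by_contra hcon
    have hle : h' - h ≤ K := by omega
    have h1 := hD (h' - h) (by omega) (k' - k)
    rw [Nat.cast_sub hlt.le] at h1
    have h2 : |((h':ℝ) - h) * β - ((k' - k : ℤ) : ℝ)| ≤ |h' * β - k'| + |h * β - k| := by
      have : ((h':ℝ) - h) * β - ((k' - k : ℤ) : ℝ) = (h' * β - k') - (h * β - k) := by push_cast; ring
      rw [this]; exact abs_sub _ _
    have h0 : (0:ℝ) < (h':ℝ) - h := by
      have : (h:ℝ) < h' := by exact_mod_cast hlt
      linarith
    have h3 : c / (K:ℝ)^N ≤ c / ((h':ℝ) - h)^N := by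
      have : (h':ℝ) - h ≤ K := by
        have : ((h' - h : ℕ):ℝ) ≤ K := by exact_mod_cast hle
        rwa [Nat.cast_sub hlt.le] at this
      gcongr
    have h4 : c / (2 * (K:ℝ)^N) + c / (2 * (K:ℝ)^N) = c / (K:ℝ)^N := by field_simp; ring
    linarith
  have hcard : S.card ≤ (Finset.range (m / K + 1)).card := by
    apply Finset.card_le_card_of_injOn (fun h => h / K)
    · intro h hh
      have : h < m := Finset.mem_range.mp (Finset.mem_filter.mp hh).1
      simp only [Finset.coe_range, Set.mem_Iio]
      have := Nat.div_le_div_right (c := K) this.le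
      omega
    · intro h hh h' hh' he
      by_contra hne
      rcases lt_or_gt_of_ne hne with hl | hl
      · have := hsep h hh h' hh' hl
        have h5 : h / K + 1 ≤ h' / K := by
          rw [Nat.le_div_iff_mul_le (by omega)]
          have := Nat.div_mul_le_self h K
          nlinarith
        simp only at he; omega
      · have := hsep h' hh' h hh hl
        have h5 : h' / K + 1 ≤ h / K := by
          rw [Nat.le_div_iff_mul_le (by omega)]
          have := Nat.div_mul_le_self h' K
          nlinarith
        simp only at he; omega
  rw [Finset.card_range] at hcard
  calc (S.card : ℝ) ≤ ((m / K + 1 : ℕ) : ℝ) := by exact_mod_cast hcard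
    _ ≤ _ := by
      push_cast
      gcongr
      exact Nat.cast_div_le

lemma sum_Wsum (c : ℝ) (N : ℕ) (β : ℝ) (hD : Dio c N β) (hc : 0 < c) (K : ℕ) (hK : 1 ≤ K) (m V M : ℕ) :
    ∑ h ∈ Finset.range m, ‖Wsum (h * β) V M‖ ≤ 
      m * (2 * (2 * (K:ℝ)^N / c) * (M + 1)) + ((m:ℝ) / K + 1) * (M * M) := by
  classical
  have hK0 : (0:ℝ) < K := by exact_mod_cast hK
  rw [← Finset.sum_filter_add_sum_filter_not _ (fun h : ℕ => ∃ k : ℤ, |h * β - k| < c / (2 * (K:ℝ)^N)), add_comm]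
  apply add_le_add
  · calc _ ≤ ∑ h ∈ (Finset.range m).filter (fun h : ℕ => ¬ ∃ k : ℤ, |h * β - k| < c / (2 * (K:ℝ)^N)), 
          (2 * (2 * (K:ℝ)^N / c) * (M + 1)) := by
          apply Finset.sum_le_sum
          intro h hh
          have hh2 := (Finset.mem_filter.mp hh).2
          push Not at hh2
          have := weighted_bound (h * β) (c / (2 * (K:ℝ)^N)) (by positivity) hh2 V M
          rw [one_div_div] at this
          exact this
      _ ≤ _ := by
          rw [Finset.sum_const, nsmul_eq_mul]
          apply mul_le_mul_of_nonneg_right _ (by positivity)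
          have := Finset.card_filter_le (Finset.range m) (fun h : ℕ => ¬ ∃ k : ℤ, |h * β - k| < c / (2 * (K:ℝ)^N))
          rw [Finset.card_range] at this
          exact_mod_cast this
  · calc _ ≤ ∑ h ∈ (Finset.range m).filter (fun h : ℕ => ∃ k : ℤ, |h * β - k| < c / (2 * (K:ℝ)^N)), 
          ((M:ℝ) * M) := by
          apply Finset.sum_le_sum
          intro h _
          exact weighted_trivial _ _ _
      _ ≤ _ := by
          rw [Finset.sum_const, nsmul_eq_mul]
          exact mul_le_mul_of_nonneg_right (card_bad c N β hD hc K hK m) (by positivity)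

def wpair (β : ℝ) (V x m1 m2 : ℕ) : ℂ := 
  ∑ n ∈ Finset.Ioc V x with n * m1 ≤ x ∧ n * m2 ≤ x, (n:ℝ) • ee (n * (((m1:ℝ) - m2) * β))

lemma ee_neg (x : ℝ) : ee (-x) = (starRingEnd ℂ) (ee x) := by
  unfold ee
  rw [← Complex.exp_conj]
  congr 1
  have e : (starRingEnd ℂ) (2:ℂ) = 2 := Complex.conj_ofNat 2
  simp [Complex.conj_ofReal, Complex.conj_I, e]

lemma wpair_symm (β : ℝ) (V x m1 m2 : ℕ) : ‖wpair β V x m1 m2‖ = ‖wpair β V x m2 m1‖ := by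
  have : wpair β V x m2 m1 = (starRingEnd ℂ) (wpair β V x m1 m2) := by
    unfold wpair
    rw [map_sum]
    apply Finset.sum_congr
    · ext n; simp only [Finset.mem_filter]; tauto
    · intro n _
      have e : (n:ℝ) * (((m2:ℝ) - m1) * β) = -(n * (((m1:ℝ) - m2) * β)) := by ring
      rw [e, ee_neg]
      simp
  rw [this, RCLike.norm_conj]

lemma wpair_eq (β : ℝ) (V x m1 m2 : ℕ) (h : m2 ≤ m1) (h0 : 0 < m1) :
    wpair β V x m1 m2 = Wsum ((m1 - m2 : ℕ) * β) V (x / m1) := by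
  unfold wpair Wsum
  rw [Nat.cast_sub h]
  apply Finset.sum_congr _ (fun _ _ => rfl)
  ext n
  simp only [Finset.mem_filter, Finset.mem_Ioc, Nat.le_div_iff_mul_le h0]
  constructor
  · rintro ⟨⟨h1, _⟩, h2, _⟩; exact ⟨h1, h2⟩
  · rintro ⟨h1, h2⟩; exact ⟨⟨h1, by nlinarith⟩, h2, by nlinarith⟩

lemma sum_wpair (c : ℝ) (N : ℕ) (β : ℝ) (hD : Dio c N β) (hc : 0 < c) (K : ℕ) (hK : 1 ≤ K) (x : ℕ) (hx : 1 ≤ x) :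
    ∑ m1 ∈ Finset.Ioc K x, ∑ m2 ∈ Finset.Ioc K x, ‖wpair β (K^(N+1)) x m1 m2‖ ≤ 
      2 * ((x:ℝ)^2 / K * (8 / c + 2 * (1 + Real.log x))) := by
  set V := K^(N+1) with hV
  have hK0 : (0:ℝ) < K := by exact_mod_cast hK
  have hx0 : (0:ℝ) < x := by exact_mod_cast hx
  have hV0 : 0 < V := by positivity
  set w := fun m1 m2 => ‖wpair β V x m1 m2‖ with hw
  -- half
  have half : ∑ m1 ∈ Finset.Ioc K x, ∑ m2 ∈ Finset.Ioc K x, w m1 m2 ≤ 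
      2 * ∑ m1 ∈ Finset.Ioc K x, ∑ m2 ∈ Finset.Ioc K x with m2 ≤ m1, w m1 m2 := by
    have s1 : ∑ m1 ∈ Finset.Ioc K x, ∑ m2 ∈ Finset.Ioc K x, w m1 m2 = 
      ∑ m1 ∈ Finset.Ioc K x, ∑ m2 ∈ Finset.Ioc K x with m2 ≤ m1, w m1 m2 + 
      ∑ m1 ∈ Finset.Ioc K x, ∑ m2 ∈ Finset.Ioc K x with ¬ m2 ≤ m1, w m1 m2 := by
      rw [← Finset.sum_add_distrib]
      apply Finset.sum_congr rfl
      intro m1 _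
      rw [Finset.sum_filter_add_sum_filter_not]
    have s2 : ∑ m1 ∈ Finset.Ioc K x, ∑ m2 ∈ Finset.Ioc K x with ¬ m2 ≤ m1, w m1 m2 ≤ 
      ∑ m1 ∈ Finset.Ioc K x, ∑ m2 ∈ Finset.Ioc K x with m2 ≤ m1, w m1 m2 := by
      simp_rw [Finset.sum_filter]
      rw [Finset.sum_comm]
      apply Finset.sum_le_sum
      intro m1 _
      apply Finset.sum_le_sum
      intro m2 _
      have : w m2 m1 = w m1 m2 := wpair_symm _ _ _ _ _
      rw [this]
      have h0 : 0 ≤ w m1 m2 := norm_nonneg _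
      split_ifs <;> first | exact le_rfl | exact h0 | omega
    linarith
  refine half.trans (mul_le_mul_of_nonneg_left ?_ (by norm_num))
  have inner : ∀ m1 ∈ Finset.Ioc K x, ∑ m2 ∈ Finset.Ioc K x with m2 ≤ m1, w m1 m2 ≤ 
      (if m1 ≤ x / V then (8 * x * (K:ℝ)^N / c) else 0) + (2 * (x:ℝ)^2 / K) * (m1:ℝ)⁻¹ := by
    intro m1 hm1
    rw [Finset.mem_Ioc] at hm1
    have hm0 : 0 < m1 := by omega
    have hm0' : (0:ℝ) < m1 := by exact_mod_cast hm0
    have st : ∑ m2 ∈ Finset.Ioc K x with m2 ≤ m1, w m1 m2 ≤ ∑ h ∈ Finset.range m1, ‖Wsum (h * β) V (x / m1)‖ := by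
      calc _ = ∑ m2 ∈ Finset.Ioc K x with m2 ≤ m1, ‖Wsum ((m1 - m2 : ℕ) * β) V (x / m1)‖ := by
            apply Finset.sum_congr rfl
            intro m2 hm2
            rw [Finset.mem_filter] at hm2
            simp only [hw]
            rw [wpair_eq _ _ _ _ _ hm2.2 hm0]
        _ = ∑ h ∈ ((Finset.Ioc K x).filter (fun m2 => m2 ≤ m1)).image (fun m2 => m1 - m2), ‖Wsum (h * β) V (x / m1)‖ := by
            rw [Finset.sum_image]
            intro a ha b hb hab
            simp only [Finset.coe_filter, Set.mem_ofPred_eq] at ha hb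
            simp only at hab
            omega
        _ ≤ _ := by
            apply Finset.sum_le_sum_of_subset_of_nonneg
            · intro h hh
              rw [Finset.mem_image] at hh
              obtain ⟨m2, hm2, rfl⟩ := hh
              simp only [Finset.mem_filter, Finset.mem_Ioc] at hm2
              rw [Finset.mem_range]; omega
            · intros; exact norm_nonneg _
    refine st.trans ?_
    split_ifs with hmV
    · refine (sum_Wsum c N β hD hc K hK m1 V (x/m1)).trans ?_
      have hM : ((x/m1 : ℕ):ℝ) ≤ x / m1 := Nat.cast_div_le
      have hM1 : (1:ℝ) ≤ x / m1 := by
        rw [le_div_iff₀ hm0', one_mul]; exact_mod_cast hm1.2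
      apply add_le_add
      · calc (m1:ℝ) * (2 * (2 * (K:ℝ)^N / c) * (((x/m1 : ℕ):ℝ) + 1)) ≤ (m1:ℝ) * (2 * (2 * (K:ℝ)^N / c) * (2 * (x/m1))) := by
              gcongr; linarith
          _ = _ := by field_simp; ring
      · have hKm : (K:ℝ) ≤ m1 := by exact_mod_cast hm1.1.le
        have h1 : (m1:ℝ) / K + 1 ≤ 2 * (m1 / K) := by
          have : (1:ℝ) ≤ m1 / K := by rw [le_div_iff₀ hK0, one_mul]; exact hKm
          linarith
        calc ((m1:ℝ) / K + 1) * (((x/m1 : ℕ):ℝ) * ((x/m1 : ℕ):ℝ)) ≤ (2 * (m1 / K)) * ((x / m1) * (x / m1)) := by gcongr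
          _ = _ := by field_simp
    · have : x / m1 ≤ V := by
        by_contra hcon
        apply hmV
        rw [Nat.le_div_iff_mul_le hV0]
        have := (Nat.le_div_iff_mul_le hm0).mp (not_le.mp hcon).le
        linarith
      have e : ∀ h ∈ Finset.range m1, ‖Wsum (h * β) V (x / m1)‖ = 0 := by
        intro h _; unfold Wsum; rw [Finset.Ioc_eq_empty_of_le this]; simp
      rw [Finset.sum_eq_zero e]; positivity
  refine (Finset.sum_le_sum inner).trans ?_
  rw [Finset.sum_add_distrib, ← Finset.mul_sum, ← Finset.sum_filter, Finset.sum_const, nsmul_eq_mul]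
  have c1 : (((Finset.Ioc K x).filter (fun m => m ≤ x / V)).card : ℝ) ≤ x / (K:ℝ)^(N+1) := by
    have : ((Finset.Ioc K x).filter (fun m => m ≤ x / V)).card ≤ (Finset.Ioc 0 (x/V)).card := by
      apply Finset.card_le_card
      intro m; simp only [Finset.mem_filter, Finset.mem_Ioc]; omega
    rw [Nat.card_Ioc] at this
    calc _ ≤ ((x / V : ℕ) : ℝ) := by exact_mod_cast this
      _ ≤ (x:ℝ) / (V:ℕ) := Nat.cast_div_le
      _ = _ := by rw [hV]; push_cast; rfl
  have c2 : ∑ m ∈ Finset.Ioc K x, (m:ℝ)⁻¹ ≤ 1 + Real.log x := by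
    calc _ ≤ ∑ m ∈ Finset.Icc 1 x, (m:ℝ)⁻¹ := by
          apply Finset.sum_le_sum_of_subset_of_nonneg
          · intro m; simp only [Finset.mem_Ioc, Finset.mem_Icc]; omega
          · intros; positivity
      _ ≤ _ := by
        have := harmonic_le_one_add_log x
        rw [harmonic_eq_sum_Icc] at this
        push_cast at this
        exact this
  calc _ ≤ (x / (K:ℝ)^(N+1)) * (8 * x * (K:ℝ)^N / c) + (2 * (x:ℝ)^2 / K) * (1 + Real.log x) := by gcongr
    _ = _ := by field_simp; ring

/-- the type II quadratic form -/
lemma typeII_quad (c : ℝ) (N : ℕ) (β : ℝ) (hD : Dio c N β) (hc : 0 < c) (K : ℕ) (hK : 1 ≤ K) (x : ℕ) (hx : 1 ≤ x)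
    (a : ℕ → ℝ) (A : ℝ) (hA : 0 ≤ A) (ha : ∀ m, m ≤ x → |a m| ≤ A) (ha0 : ∀ m, m ≤ K → a m = 0) :
    ∑ n ∈ Finset.Ioc (K^(N+1)) x, (n:ℝ) * ‖∑ m ∈ Finset.Ioc 0 (x / n), a m • ee ((n * m : ℕ) * β)‖^2 ≤
     A^2 * (2 * ((x:ℝ)^2 / K * (8 / c + 2 * (1 + Real.log x)))) := by
  set V := K^(N+1) with hV
  have hs : ∀ n ∈ Finset.Ioc V x, ∑ m ∈ Finset.Ioc 0 (x / n), a m • ee ((n * m : ℕ) * β) = 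
      ∑ m ∈ Finset.Ioc K x, if n * m ≤ x then a m • ee ((n * m : ℕ) * β) else 0 := by
    intro n hn
    rw [Finset.mem_Ioc] at hn
    have hn0 : 0 < n := by omega
    rw [← Finset.sum_filter]
    symm
    apply Finset.sum_subset
    · intro m; simp only [Finset.mem_filter, Finset.mem_Ioc, Nat.le_div_iff_mul_le hn0, mul_comm n m]
      rintro ⟨h1, h2⟩; exact ⟨by omega, h2⟩
    · intro m hm hm'
      rw [Finset.mem_Ioc, Nat.le_div_iff_mul_le hn0] at hm
      rw [ha0 m, zero_smul]
      by_contra hcon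
      apply hm'
      simp only [Finset.mem_filter, Finset.mem_Ioc]
      refine ⟨⟨by omega, by nlinarith⟩, by linarith⟩
  have expand : ((∑ n ∈ Finset.Ioc V x, (n:ℝ) * ‖∑ m ∈ Finset.Ioc 0 (x / n), a m • ee ((n * m : ℕ) * β)‖^2 : ℝ) : ℂ) = 
      ∑ m1 ∈ Finset.Ioc K x, ∑ m2 ∈ Finset.Ioc K x, (a m1 * a m2) • wpair β V x m1 m2 := by
    have e1 : ∀ n ∈ Finset.Ioc V x, (((n:ℝ) * ‖∑ m ∈ Finset.Ioc 0 (x / n), a m • ee ((n * m : ℕ) * β)‖^2 : ℝ) : ℂ) = 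
       ∑ m1 ∈ Finset.Ioc K x, ∑ m2 ∈ Finset.Ioc K x, if n * m1 ≤ x ∧ n * m2 ≤ x then 
         (a m1 * a m2) • ((n:ℝ) • ee (n * (((m1:ℝ) - m2) * β))) else 0 := by
      intro n hn
      rw [hs n hn]
      push_cast
      rw [← Complex.mul_conj', map_sum, Finset.sum_mul_sum, Finset.mul_sum]
      apply Finset.sum_congr rfl
      intro m1 _
      rw [Finset.mul_sum]
      apply Finset.sum_congr rfl
      intro m2 _
      by_cases h1 : n * m1 ≤ x <;> by_cases h2 : n * m2 ≤ x
      · rw [if_pos h1, if_pos h2, if_pos ⟨h1, h2⟩]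
        have : ee (n * (((m1:ℝ) - m2) * β)) = ee (n * m1 * β) * (starRingEnd ℂ) (ee (n * m2 * β)) := by
          rw [← ee_neg, ← ee_add]; congr 1; ring
        rw [this]
        simp only [Complex.real_smul, map_mul, Complex.conj_ofReal, Complex.ofReal_mul, Complex.ofReal_natCast]
        ring
      · simp [h2]
      · simp [h1]
      · simp [h1]
    rw [Complex.ofReal_sum, Finset.sum_congr rfl e1, Finset.sum_comm]
    apply Finset.sum_congr rfl
    intro m1 _
    rw [Finset.sum_comm]
    apply Finset.sum_congr rfl
    intro m2 _
    unfold wpair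
    rw [Finset.smul_sum, Finset.sum_filter]
  have hnn : 0 ≤ ∑ n ∈ Finset.Ioc V x, (n:ℝ) * ‖∑ m ∈ Finset.Ioc 0 (x / n), a m • ee ((n * m : ℕ) * β)‖^2 := by
    apply Finset.sum_nonneg; intros; positivity
  have := congrArg norm expand
  rw [Complex.norm_real, Real.norm_of_nonneg hnn] at this
  rw [this]
  refine le_trans ?_ (mul_le_mul_of_nonneg_left (sum_wpair c N β hD hc K hK x hx) (sq_nonneg A))
  rw [Finset.mul_sum]
  refine (norm_sum_le _ _).trans (Finset.sum_le_sum fun m1 hm1 => ?_)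
  rw [Finset.mul_sum]
  refine (norm_sum_le _ _).trans (Finset.sum_le_sum fun m2 hm2 => ?_)
  rw [norm_smul, norm_mul, Real.norm_eq_abs, Real.norm_eq_abs, sq]
  rw [Finset.mem_Ioc] at hm1 hm2
  exact mul_le_mul_of_nonneg_right (mul_le_mul (ha m1 hm1.2) (ha m2 hm2.2) (abs_nonneg _) hA) (norm_nonneg _)

/-- type II bound -/
lemma typeII (c : ℝ) (N : ℕ) (β : ℝ) (hD : Dio c N β) (hc : 0 < c) (K : ℕ) (hK : 1 ≤ K) (x : ℕ) (hx : 1 ≤ x)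
    (a b : ArithmeticFunction ℝ) (A B : ℝ) (hA : 0 ≤ A) (ha : ∀ m, m ≤ x → |a m| ≤ A) (ha0 : ∀ m, m ≤ K → a m = 0)
    (hb0 : ∀ n, n ≤ K^(N+1) → b n = 0) (hB : ∑ n ∈ Finset.Ioc 0 x, (b n)^2 / n ≤ B) :
    ‖∑ n ∈ Finset.Ioc 0 x, (b * a) n • ee (n * β)‖^2 ≤ B * (A^2 * (2 * ((x:ℝ)^2 / K * (8 / c + 2 * (1 + Real.log x))))) := by
  rw [sum_mul_ee b a (fun n => ee (n * β))]
  set s := fun n => ∑ k ∈ Finset.Ioc 0 (x/n), a k • ee ((n * k : ℕ) * β) with hs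
  have h1 : ‖∑ n ∈ Finset.Ioc 0 x, b n • s n‖ ≤ ∑ n ∈ Finset.Ioc (K^(N+1)) x, (|b n| / √n) * (√n * ‖s n‖) := by
    rw [← Finset.sum_subset (s₁ := Finset.Ioc (K^(N+1)) x)]
    · refine (norm_sum_le _ _).trans (Finset.sum_le_sum fun n hn => ?_)
      rw [Finset.mem_Ioc] at hn
      have : (0:ℝ) < √n := Real.sqrt_pos.mpr (by exact_mod_cast (by omega : 0 < n))
      rw [norm_smul, Real.norm_eq_abs]
      apply le_of_eq
      field_simp
    · intro n; simp only [Finset.mem_Ioc]; omega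
    · intro n hn hn'
      simp only [Finset.mem_Ioc] at hn hn'
      rw [hb0 n (by omega), zero_smul]
  calc _ ≤ (∑ n ∈ Finset.Ioc (K^(N+1)) x, (|b n| / √n) * (√n * ‖s n‖))^2 := by
        exact pow_le_pow_left₀ (norm_nonneg _) h1 2
    _ ≤ (∑ n ∈ Finset.Ioc (K^(N+1)) x, (|b n| / √n)^2) * (∑ n ∈ Finset.Ioc (K^(N+1)) x, (√n * ‖s n‖)^2) := 
        Finset.sum_mul_sq_le_sq_mul_sq _ _ _
    _ = (∑ n ∈ Finset.Ioc (K^(N+1)) x, (b n)^2 / n) * (∑ n ∈ Finset.Ioc (K^(N+1)) x, (n:ℝ) * ‖s n‖^2) := by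
        congr 1
        · apply Finset.sum_congr rfl; intro n _
          rw [div_pow, sq_abs, Real.sq_sqrt (Nat.cast_nonneg _)]
        · apply Finset.sum_congr rfl; intro n _
          rw [mul_pow, Real.sq_sqrt (Nat.cast_nonneg _)]
    _ ≤ _ := by
        have q := typeII_quad c N β hD hc K hK x hx a A hA ha ha0
        have hB' : ∑ n ∈ Finset.Ioc (K^(N+1)) x, (b n)^2 / n ≤ B := by
          refine le_trans ?_ hB
          apply Finset.sum_le_sum_of_subset_of_nonneg
          · intro n; simp only [Finset.mem_Ioc]; omega
          · intros; positivity
        apply mul_le_mul hB' q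
        · apply Finset.sum_nonneg; intros; positivity
        · refine le_trans ?_ hB'
          apply Finset.sum_nonneg; intros; positivity

end Part8

section Part9
/-- truncation of an arithmetic function -/
def lo (V : ℕ) (F : ArithmeticFunction ℝ) : ArithmeticFunction ℝ := ⟨fun n => if n ≤ V then F n else 0, by simp⟩

/-- tail of an arithmetic function -/
def hi (V : ℕ) (F : ArithmeticFunction ℝ) : ArithmeticFunction ℝ := ⟨fun n => if n ≤ V then 0 else F n, by simp⟩

lemma lo_apply (V : ℕ) (F : ArithmeticFunction ℝ) (n : ℕ) : lo V F n = if n ≤ V then F n else 0 := rfl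
lemma hi_apply (V : ℕ) (F : ArithmeticFunction ℝ) (n : ℕ) : hi V F n = if n ≤ V then 0 else F n := rfl

lemma lo_add_hi (V : ℕ) (F : ArithmeticFunction ℝ) : lo V F + hi V F = F := by
  ext n; rw [ArithmeticFunction.add_apply, lo_apply, hi_apply]; split_ifs <;> simp

/-- the real Möbius function -/
def muR : ArithmeticFunction ℝ := ((moebius : ArithmeticFunction ℤ) : ArithmeticFunction ℝ)

lemma muR_apply (n : ℕ) : muR n = (moebius n : ℝ) := by simp [muR]

lemma abs_muR_le (n : ℕ) : |muR n| ≤ 1 := by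
  rw [muR_apply]
  have := abs_moebius_le_one (n := n)
  exact_mod_cast this

lemma vaughan (U V : ℕ) : vonMangoldt = lo U vonMangoldt + lo V muR * ArithmeticFunction.log
    - (lo V muR * lo U vonMangoldt) * (zeta : ArithmeticFunction ℝ) 
    + (hi V muR * (zeta : ArithmeticFunction ℝ)) * hi U vonMangoldt := by
  have h1 : muR * (zeta : ArithmeticFunction ℝ) = 1 := coe_moebius_mul_coe_zeta
  have h2 : vonMangoldt * (zeta : ArithmeticFunction ℝ) = ArithmeticFunction.log := vonMangoldt_mul_zeta
  have h3 := lo_add_hi V muR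
  have h4 := lo_add_hi U vonMangoldt
  rw [← h3] at h1
  rw [← h2]
  linear_combination (-1 + (lo V muR) * (zeta : ArithmeticFunction ℝ)) * h4 - hi U vonMangoldt * h1

lemma card_divisors_mul_le (a b : ℕ) : (a * b).divisors.card ≤ a.divisors.card * b.divisors.card := by
  rw [Nat.divisors_mul]; exact Finset.card_mul_le

lemma sum_conv_le (F G : ArithmeticFunction ℝ) (hF : ∀ n, 0 ≤ F n) (hG : ∀ n, 0 ≤ G n) (x : ℕ) :
    ∑ n ∈ Finset.Ioc 0 x, (F * G) n ≤ (∑ n ∈ Finset.Ioc 0 x, F n) * (∑ n ∈ Finset.Ioc 0 x, G n) := by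
  rw [sum_Ioc_mul_eq_sum_sum, Finset.sum_mul]
  apply Finset.sum_le_sum
  intro m _
  apply mul_le_mul_of_nonneg_left _ (hF m)
  apply Finset.sum_le_sum_of_subset_of_nonneg
  · intro k; simp only [Finset.mem_Ioc]
    have := Nat.div_le_self x m
    omega
  · intros; exact hG _

/-- `1/n` -/
def ninv : ArithmeticFunction ℝ := ⟨fun n => (n:ℝ)⁻¹, by simp⟩
/-- `d(n)/n` -/
def dninv : ArithmeticFunction ℝ := ⟨fun n => (n.divisors.card:ℝ) / n, by simp⟩

lemma dninv_eq : dninv = ninv * ninv := by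
  ext n
  rw [mul_apply]
  have : ∀ y ∈ n.divisorsAntidiagonal, ninv y.1 * ninv y.2 = (n:ℝ)⁻¹ := by
    intro y hy
    rw [← (Nat.mem_divisorsAntidiagonal.mp hy).1]
    change (y.1:ℝ)⁻¹ * (y.2:ℝ)⁻¹ = _
    push_cast; rw [mul_inv]
  rw [Finset.sum_congr rfl this, Finset.sum_const, nsmul_eq_mul, ← Nat.map_div_right_divisors, Finset.card_map]
  rfl

lemma dsq_le (n : ℕ) : (n.divisors.card:ℝ)^2 / n ≤ (dninv * dninv) n := by
  rw [mul_apply]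
  have : ∀ y ∈ n.divisorsAntidiagonal, (n.divisors.card:ℝ) / n ≤ dninv y.1 * dninv y.2 := by
    intro y hy
    rw [← (Nat.mem_divisorsAntidiagonal.mp hy).1]
    change _ ≤ (y.1.divisors.card:ℝ) / y.1 * ((y.2.divisors.card:ℝ) / y.2)
    push_cast; rw [div_mul_div_comm]
    gcongr
    exact_mod_cast card_divisors_mul_le y.1 y.2
  refine le_trans (le_of_eq ?_) (Finset.sum_le_sum this)
  rw [Finset.sum_const, nsmul_eq_mul, ← Nat.map_div_right_divisors, Finset.card_map]
  ring

lemma sum_dsq (x : ℕ) : ∑ n ∈ Finset.Ioc 0 x, (n.divisors.card:ℝ)^2 / n ≤ (1 + Real.log x)^4 := by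
  have h0 : ∀ n, 0 ≤ ninv n := fun n => by change (0:ℝ) ≤ (n:ℝ)⁻¹; positivity
  have h0' : ∀ n, 0 ≤ dninv n := fun n => by change (0:ℝ) ≤ (n.divisors.card:ℝ) / n; positivity
  have hh : ∑ n ∈ Finset.Ioc 0 x, ninv n ≤ 1 + Real.log x := by
    have := harmonic_le_one_add_log x
    rw [harmonic_eq_sum_Icc] at this
    push_cast at this
    exact this
  have hp : 0 ≤ ∑ n ∈ Finset.Ioc 0 x, ninv n := Finset.sum_nonneg fun _ _ => h0 _
  have hd : ∑ n ∈ Finset.Ioc 0 x, dninv n ≤ (1 + Real.log x)^2 := by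
    rw [dninv_eq]
    refine (sum_conv_le _ _ h0 h0 x).trans ?_
    rw [sq]; gcongr
  have hp' : 0 ≤ ∑ n ∈ Finset.Ioc 0 x, dninv n := Finset.sum_nonneg fun _ _ => h0' _
  calc _ ≤ ∑ n ∈ Finset.Ioc 0 x, (dninv * dninv) n := Finset.sum_le_sum fun n _ => dsq_le n
    _ ≤ _ := sum_conv_le _ _ h0' h0' x
    _ ≤ (1 + Real.log x)^2 * (1 + Real.log x)^2 := by gcongr
    _ = _ := by ring

lemma b_le (V n : ℕ) : |(hi V muR * (zeta : ArithmeticFunction ℝ)) n| ≤ n.divisors.card := by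
  rw [coe_mul_zeta_apply]
  refine (Finset.abs_sum_le_sum_abs _ _).trans ?_
  refine (Finset.sum_le_sum (g := fun _ => (1:ℝ)) ?_).trans (by simp)
  intro i _
  rw [hi_apply]; split_ifs
  · simp
  · exact abs_muR_le i

lemma b_zero (V n : ℕ) (h : n ≤ V) : (hi V muR * (zeta : ArithmeticFunction ℝ)) n = 0 := by
  rw [coe_mul_zeta_apply]
  apply Finset.sum_eq_zero
  intro i hi
  rw [hi_apply, if_pos ((Nat.divisor_le hi).trans h)]

lemma lolo_le (U V n : ℕ) : |(lo V muR * lo U vonMangoldt) n| ≤ Real.log n := by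
  rw [mul_apply, ← vonMangoldt_sum]
  have := Nat.sum_divisorsAntidiagonal' (n := n) (fun _ y => vonMangoldt y)
  rw [← this]
  refine (Finset.abs_sum_le_sum_abs _ _).trans (Finset.sum_le_sum fun y _ => ?_)
  rw [abs_mul]
  have h1 : |lo V muR y.1| ≤ 1 := by
    rw [lo_apply]; split_ifs
    · exact abs_muR_le _
    · simp
  have h2 : |lo U vonMangoldt y.2| ≤ vonMangoldt y.2 := by
    rw [lo_apply]; split_ifs
    · rw [abs_of_nonneg vonMangoldt_nonneg]
    · simp [vonMangoldt_nonneg]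
  calc _ ≤ 1 * vonMangoldt y.2 := mul_le_mul h1 h2 (abs_nonneg _) zero_le_one
    _ = _ := one_mul _

lemma lolo_zero (U V n : ℕ) (h : U * V < n) : (lo V muR * lo U vonMangoldt) n = 0 := by
  rw [mul_apply]
  apply Finset.sum_eq_zero
  intro y hy
  rw [lo_apply, lo_apply]
  have := (Nat.mem_divisorsAntidiagonal.mp hy).1
  split_ifs with h1 h2
  · nlinarith
  all_goals simp


/-- explicit Vaughan bound -/
lemma vaughan_bound (c : ℝ) (hc : 0 < c) (N : ℕ) (β : ℝ) (hD : Dio c N β) (K x : ℕ) (hK : 1 ≤ K) (hx : 1 ≤ x) (L : ℝ)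
    (hL : Real.log (x + 1) ≤ L) :
    ‖∑ n ∈ Finset.Ioc 0 x, vonMangoldt n • ee (n * β)‖ ≤ K * L + 2 * L * 1 / c * ((K ^ (N+1) : ℕ):ℝ)^(N+1)
      + L / c * ((K * K ^ (N+1) : ℕ):ℝ)^(N+1) 
      + √((1 + L)^4 * (L^2 * (2 * ((x:ℝ)^2 / K * (8 / c + 2 * (1 + L)))))) := by
  set V := K^(N+1) with hV
  have hx0 : (0:ℝ) < x := by exact_mod_cast hx
  have hlx : Real.log x ≤ L := (Real.log_le_log hx0 (by linarith)).trans hL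
  have hlx0 : 0 ≤ Real.log x := Real.log_natCast_nonneg x
  have hL0 : 0 ≤ L := hlx0.trans hlx
  have logle : ∀ m : ℕ, m ≤ x → Real.log m ≤ L := by
    intro m hm
    rcases Nat.eq_zero_or_pos m with rfl | h
    · simpa using hL0
    · exact (Real.log_le_log (by exact_mod_cast h) (by exact_mod_cast hm)).trans hlx
  have hsplit : ∑ n ∈ Finset.Ioc 0 x, vonMangoldt n • ee (n * β) = 
     ∑ n ∈ Finset.Ioc 0 x, lo K vonMangoldt n • ee (n * β) 
     + ∑ n ∈ Finset.Ioc 0 x, (lo V muR * ArithmeticFunction.log) n • ee (n * β)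
     - ∑ n ∈ Finset.Ioc 0 x, ((lo V muR * lo K vonMangoldt) * (zeta : ArithmeticFunction ℝ)) n • ee (n * β)
     + ∑ n ∈ Finset.Ioc 0 x, ((hi V muR * (zeta : ArithmeticFunction ℝ)) * hi K vonMangoldt) n • ee (n * β) := by
    rw [← Finset.sum_add_distrib, ← Finset.sum_sub_distrib, ← Finset.sum_add_distrib]
    apply Finset.sum_congr rfl
    intro n _
    rw [← add_smul, ← sub_smul, ← add_smul]
    congr 1
    have := congrArg (fun f : ArithmeticFunction ℝ => f n) (vaughan K V)
    simpa [sub_eq_add_neg] using this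
  rw [hsplit]
  have p1 : ‖∑ n ∈ Finset.Ioc 0 x, lo K vonMangoldt n • ee (n * β)‖ ≤ K * L := by
    refine (norm_sum_le _ _).trans ?_
    calc _ ≤ ∑ n ∈ Finset.Ioc 0 x, if n ≤ K then L else 0 := by
          apply Finset.sum_le_sum
          intro n hn
          rw [Finset.mem_Ioc] at hn
          rw [norm_smul, norm_ee, mul_one, lo_apply]
          split_ifs
          · rw [Real.norm_of_nonneg vonMangoldt_nonneg]
            exact vonMangoldt_le_log.trans (logle n hn.2)
          · simp
      _ ≤ _ := by
          rw [← Finset.sum_filter, Finset.sum_const, nsmul_eq_mul]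
          apply mul_le_mul_of_nonneg_right _ hL0
          have : ((Finset.Ioc 0 x).filter (fun n => n ≤ K)).card ≤ (Finset.Ioc 0 K).card := by
            apply Finset.card_le_card
            intro m; simp only [Finset.mem_filter, Finset.mem_Ioc]; omega
          rw [Nat.card_Ioc] at this
          exact_mod_cast this
  have p2 : ‖∑ n ∈ Finset.Ioc 0 x, (lo V muR * ArithmeticFunction.log) n • ee (n * β)‖ ≤ 2 * L * 1 / c * (V:ℝ)^(N+1) := by
    refine (typeI_log c hc N β hD (lo V muR) 1 zero_le_one V x ?_ ?_).trans ?_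
    · intro m _; rw [lo_apply]; split_ifs
      · exact abs_muR_le _
      · simp
    · intro m hm; rw [lo_apply, if_neg (by omega)]
    · gcongr
  have p3 : ‖∑ n ∈ Finset.Ioc 0 x, ((lo V muR * lo K vonMangoldt) * (zeta : ArithmeticFunction ℝ)) n • ee (n * β)‖ 
      ≤ L / c * ((K * V : ℕ):ℝ)^(N+1) := by
    refine typeI_one c hc N β hD _ L hL0 (K * V) x ?_ ?_
    · intro m hm; exact (lolo_le _ _ _).trans (logle m hm)
    · intro m hm; exact lolo_zero _ _ _ hm
  have p4 : ‖∑ n ∈ Finset.Ioc 0 x, ((hi V muR * (zeta : ArithmeticFunction ℝ)) * hi K vonMangoldt) n • ee (n * β)‖ 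
      ≤ √((1 + L)^4 * (L^2 * (2 * ((x:ℝ)^2 / K * (8 / c + 2 * (1 + L)))))) := by
    apply Real.le_sqrt_of_sq_le
    refine (typeII c N β hD hc K hK x hx (hi K vonMangoldt) (hi V muR * (zeta : ArithmeticFunction ℝ)) L ((1 + L)^4) hL0 ?_ ?_ ?_ ?_).trans ?_
    · intro m hm; rw [hi_apply]; split_ifs
      · simpa using hL0
      · rw [abs_of_nonneg vonMangoldt_nonneg]
        exact vonMangoldt_le_log.trans (logle m hm)
    · intro m hm; rw [hi_apply, if_pos hm]
    · intro n hn; exact b_zero _ _ hn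
    · calc _ ≤ ∑ n ∈ Finset.Ioc 0 x, (n.divisors.card:ℝ)^2 / n := by
            apply Finset.sum_le_sum
            intro n _
            have := b_le V n
            rw [← sq_abs]
            gcongr
        _ ≤ _ := sum_dsq x
        _ ≤ _ := by gcongr
    · gcongr
  refine (norm_add_le _ _).trans (add_le_add ((norm_sub_le _ _).trans (add_le_add ((norm_add_le _ _).trans (add_le_add p1 p2)) p3)) p4)

end Part9

section Part10
lemma exists_root (E x : ℕ) (hE : 1 ≤ E) : ∃ K : ℕ, K^E ≤ x ∧ x < (K+1)^E := by
  refine ⟨Nat.findGreatest (fun k => k^E ≤ x) x, ?_, ?_⟩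
  · have := Nat.findGreatest_spec (P := fun k => k^E ≤ x) (Nat.zero_le x) (by simp [Nat.zero_pow hE])
    exact this
  · by_contra hcon
    push Not at hcon
    have h1 : Nat.findGreatest (fun k => k^E ≤ x) x + 1 ≤ x := 
      (Nat.le_self_pow (by omega) _).trans hcon
    have := Nat.le_findGreatest (P := fun k => k^E ≤ x) h1 hcon
    omega

lemma tendsto_G (C1 C2 : ℝ) : Tendsto (fun y : ℝ => C1 * (Real.log y / y) + √(C2 * ((Real.log y)^7 / y))) atTop (nhds 0) := by
  have h1 : ∀ n : ℕ, Tendsto (fun y : ℝ => (Real.log y)^n / y) atTop (nhds 0) := by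
    intro n
    exact (Real.isLittleO_pow_log_id_atTop (n := n)).tendsto_div_nhds_zero
  have a := (h1 1).const_mul C1
  have b := ((h1 7).const_mul C2).sqrt
  simp only [pow_one] at a
  simpa using a.add b

lemma exp_sum_small (c : ℝ) (hc : 0 < c) (N : ℕ) (β : ℝ) (hD : Dio c N β) (ε : ℝ) (hε : 0 < ε) :
    ∃ X0 : ℕ, ∀ x ≥ X0, ‖∑ n ∈ Finset.Ioc 0 x, vonMangoldt n • ee (n * β)‖ ≤ ε * x := by
  set E := (N+1)*(N+2)+1 with hE
  set C1 : ℝ := 2 * E * (1 + 3 / c) with hC1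
  set C2 : ℝ := 64 * (8 / c + 4) * (E:ℝ)^7 with hC2
  have hG := (tendsto_G C1 C2).comp (tendsto_natCast_atTop_atTop (R := ℝ))
  have hG2 := hG.eventually (gt_mem_nhds hε)
  obtain ⟨Y, hY⟩ := eventually_atTop.mp hG2
  refine ⟨(Y + 3)^E, fun x hx => ?_⟩
  obtain ⟨K, hK1, hK2⟩ := exists_root E x (by omega)
  have hKY : Y + 3 < K + 1 := lt_of_pow_lt_pow_left₀ E (by omega) (lt_of_le_of_lt hx hK2)
  have hK0 : 1 ≤ K := by omega
  have hx1 : 1 ≤ x := le_trans (Nat.one_le_pow _ _ (by omega)) hx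
  have hKr : (0:ℝ) < K := by exact_mod_cast hK0
  have hxr : (0:ℝ) < x := by exact_mod_cast hx1
  set l := Real.log ((K+1 : ℕ):ℝ) with hl
  have hl1 : 1 ≤ l := by
    rw [hl, Real.le_log_iff_exp_le (by positivity)]
    have : (3:ℝ) ≤ ((K+1:ℕ):ℝ) := by exact_mod_cast (by omega)
    linarith [Real.exp_one_lt_d9]
  have hE1 : (1:ℝ) ≤ E := by exact_mod_cast (by omega : 1 ≤ E)
  set L := E * l with hLdef
  have hL1 : 1 ≤ L := by nlinarith
  have hlog : Real.log (x + 1) ≤ L := by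
    rw [hLdef, hl, ← Real.log_pow]
    apply Real.log_le_log (by positivity)
    exact_mod_cast hK2
  have main := vaughan_bound c hc N β hD K x hK0 hx1 L hlog
  refine main.trans ?_
  have hGK := (hY (K+1) (by omega)).le
  simp only [Function.comp] at hGK
  refine le_trans ?_ (mul_le_mul_of_nonneg_right hGK hxr.le)
  have hyK : ((K+1:ℕ):ℝ) ≤ 2 * K := by push_cast; linarith [(by exact_mod_cast hK0 : (1:ℝ) ≤ K)]
  have hy0 : (0:ℝ) < ((K+1:ℕ):ℝ) := by positivity
  have hKinv : 1 / (K:ℝ) ≤ 2 / ((K+1:ℕ):ℝ) := by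
    rw [div_le_div_iff₀ hKr hy0]; linarith
  have hpow : (K:ℝ)^(E-1) ≤ x / K := by
    rw [le_div_iff₀ hKr, ← pow_succ]
    have : E - 1 + 1 = E := by omega
    rw [this]; exact_mod_cast hK1
  have hKge : (1:ℝ) ≤ K := by exact_mod_cast hK0
  have q1 : (K:ℝ) ≤ (K:ℝ)^(E-1) := by
    exact_mod_cast Nat.le_self_pow (by simp [hE]) K
  have q2 : ((K ^ (N+1) : ℕ):ℝ)^(N+1) ≤ (K:ℝ)^(E-1) := by
    push_cast; rw [← pow_mul]
    apply pow_le_pow_right₀ hKge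
    rw [hE]; simp only [Nat.add_sub_cancel]; nlinarith
  have q3 : ((K * K ^ (N+1) : ℕ):ℝ)^(N+1) ≤ (K:ℝ)^(E-1) := by
    push_cast; rw [← pow_succ', ← pow_mul]
    apply pow_le_pow_right₀ hKge
    rw [hE]; simp only [Nat.add_sub_cancel]; nlinarith
  rw [add_mul]
  apply add_le_add
  · calc _ ≤ (x/K) * L + 2 * L * 1 / c * (x/K) + L / c * (x / K) := by
          have q1' := q1.trans hpow
          have q2' := q2.trans hpow
          have q3' := q3.trans hpow
          gcongr
      _ = (x * L * (1 + 3 / c)) * (1 / K) := by field_simp; ring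
      _ ≤ (x * L * (1 + 3 / c)) * (2 / ((K+1:ℕ):ℝ)) := by gcongr
      _ = _ := by rw [hC1, hLdef]; ring
  · have : √(C2 * (l^7 / ((K+1:ℕ):ℝ))) * x = √(C2 * (l^7 / ((K+1:ℕ):ℝ)) * x^2) := by
      rw [Real.sqrt_mul (x := C2 * (l^7 / ((K+1:ℕ):ℝ))) (by positivity) (x^2), Real.sqrt_sq hxr.le]
    rw [this]
    apply Real.sqrt_le_sqrt
    have a1 : 1 + L ≤ 2 * L := by linarith
    calc _ ≤ (2 * L)^4 * (L^2 * (2 * ((x:ℝ)^2 / K * (8 / c * L + 2 * (2 * L))))) := by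
          have : 8 / c ≤ 8 / c * L := le_mul_of_one_le_right (by positivity) hL1
          gcongr
      _ = (L^7 * (32 * (8 / c + 4)) * x^2) * (1 / K) := by ring
      _ ≤ (L^7 * (32 * (8 / c + 4)) * x^2) * (2 / ((K+1:ℕ):ℝ)) := by gcongr
      _ = _ := by rw [hC2, hLdef]; ring

end Part10

section Part11
lemma dio_alpha (α : ℝ) (hirr : Irrational α)
    (hft : ∃ N : ℝ, 0 < N ∧ {pq : ℤ × ℤ | 1 ≤ pq.2 ∧ IsCoprime pq.1 pq.2 ∧ |α - (pq.1 : ℝ) / (pq.2 : ℝ)| ≤ 1 / (pq.2 : ℝ) ^ N}.Finite) :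
    ∃ c : ℝ, 0 < c ∧ ∃ N : ℕ, Dio c N α := by
  obtain ⟨N0, hN0, hfin⟩ := hft
  set S := {pq : ℤ × ℤ | 1 ≤ pq.2 ∧ IsCoprime pq.1 pq.2 ∧ |α - (pq.1 : ℝ) / (pq.2 : ℝ)| ≤ 1 / (pq.2 : ℝ) ^ N0} with hS
  set T := insert (1:ℝ) ((fun pq : ℤ × ℤ => |α - (pq.1 : ℝ) / (pq.2 : ℝ)|) '' S) with hT
  have hTf : T.Finite := (hfin.image _).insert 1
  obtain ⟨c, hcT, hcmin⟩ := Set.exists_min_image T id hTf ⟨1, Set.mem_insert _ _⟩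
  simp only [id] at hcmin
  have hcpos : 0 < c := by
    rcases hcT with rfl | ⟨pq, _, rfl⟩
    · exact one_pos
    · rw [abs_pos, sub_ne_zero]
      intro h
      apply hirr
      exact ⟨(pq.1 : ℚ) / pq.2, by push_cast; exact h.symm⟩
  have hc1 : c ≤ 1 := hcmin 1 (Set.mem_insert _ _)
  refine ⟨c, hcpos, ⌈N0⌉₊, ?_⟩
  intro q hq p
  have hq0 : (0:ℝ) < q := by exact_mod_cast hq
  have hq1 : (1:ℝ) ≤ q := by exact_mod_cast hq
  set r : ℚ := (p:ℚ) / (q:ℤ) with hr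
  have hden : r.den ≤ q := by
    have := Rat.den_dvd p q
    rw [Rat.divInt_eq_div, ← hr] at this
    exact Nat.le_of_dvd hq (by exact_mod_cast this)
  have hd1 : 1 ≤ r.den := r.pos
  have hdr : (1:ℝ) ≤ r.den := by exact_mod_cast hd1
  have hrr : (r:ℝ) = (r.num:ℝ) / (r.den:ℝ) := Rat.cast_def r
  have hrr2 : (r:ℝ) = (p:ℝ) / q := by rw [hr]; push_cast; rfl
  have key : c / (q:ℝ)^⌈N0⌉₊ ≤ |α - r| := by
    by_cases hin : ((r.num, (r.den:ℤ)) : ℤ × ℤ) ∈ S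
    · have := hcmin _ (Set.mem_insert_of_mem _ ⟨_, hin, rfl⟩)
      simp only [Int.cast_natCast] at this
      rw [← hrr] at this
      exact (div_le_self hcpos.le (one_le_pow₀ hq1)).trans this
    · have h1 : 1 / (r.den:ℝ)^N0 ≤ |α - r| := by
        by_contra hcon
        apply hin
        refine ⟨Int.ofNat_le.mpr hd1, ?_, ?_⟩
        · exact Int.isCoprime_iff_gcd_eq_one.mpr r.reduced
        · simp only [Int.cast_natCast]
          rw [← hrr]; exact (not_le.mp hcon).le
      refine le_trans ?_ h1
      have h2 : (r.den:ℝ)^N0 ≤ (q:ℝ)^⌈N0⌉₊ := by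
        calc (r.den:ℝ)^N0 ≤ (q:ℝ)^N0 := Real.rpow_le_rpow (by positivity) (by exact_mod_cast hden) hN0.le
          _ ≤ (q:ℝ)^((⌈N0⌉₊:ℕ):ℝ) := Real.rpow_le_rpow_of_exponent_le hq1 (Nat.le_ceil _)
          _ = _ := Real.rpow_natCast _ _
      have h3 : 0 < (r.den:ℝ)^N0 := by positivity
      gcongr
  refine key.trans ?_
  have : (q:ℝ) * α - p = q * (α - r) := by rw [hrr2]; field_simp
  rw [this, abs_mul, abs_of_pos hq0]
  exact le_mul_of_one_le_left (abs_nonneg _) hq1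

lemma dio_inv (α : ℝ) (hα : 1 < α) (c : ℝ) (hc : 0 < c) (N : ℕ) (h : Dio c N α) :
    ∃ c' : ℝ, 0 < c' ∧ Dio c' N (1/α) := by
  have ha : 0 < α := by linarith
  set θ := 1/α with hθ
  have hθ0 : 0 < θ := by positivity
  have hθ1 : θ < 1 := by rw [hθ, div_lt_one ha]; exact hα
  refine ⟨min θ (θ * c / 2^N), by positivity, ?_⟩
  intro m hm k
  have hm1 : (1:ℝ) ≤ m := by exact_mod_cast hm
  have triv : min θ (θ * c / 2^N) / (m:ℝ)^N ≤ θ := by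
    refine (div_le_self (by positivity) (one_le_pow₀ hm1)).trans (min_le_left _ _)
  rcases le_or_gt k 0 with hk | hk
  · have : (k:ℝ) ≤ 0 := by exact_mod_cast hk
    refine triv.trans (le_trans ?_ (le_abs_self _))
    nlinarith
  · rcases le_or_gt (2 * (m:ℤ)) k with hk2 | hk2
    · have : (2 * m : ℝ) ≤ k := by exact_mod_cast hk2
      refine triv.trans (le_trans ?_ (neg_le_abs _))
      nlinarith
    · lift k to ℕ using hk.le
      have hk1 : 1 ≤ k := by omega
      have hkr : (0:ℝ) < k := by exact_mod_cast hk1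
      have := h k hk1 m
      have e : (m:ℝ) * θ - ((k:ℤ):ℝ) = -(θ * (k * α - ((m:ℤ):ℝ))) := by
        rw [hθ]; push_cast; field_simp; ring
      rw [e, abs_neg, abs_mul, abs_of_pos hθ0]
      calc _ ≤ (θ * c / 2^N) / (m:ℝ)^N := by gcongr; exact min_le_right _ _
        _ = θ * (c / (2 * m:ℝ)^N) := by rw [mul_pow]; field_simp
        _ ≤ θ * (c / (k:ℝ)^N) := by
            have : (k:ℝ) ≤ 2 * m := by exact_mod_cast (by omega : k ≤ 2 * m)
            gcongr
        _ ≤ _ := by gcongr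

lemma dio_mul (θ : ℝ) (c : ℝ) (hc : 0 < c) (N : ℕ) (h : Dio c N θ) (j : ℤ) (hj : j ≠ 0) :
    ∃ c' : ℝ, 0 < c' ∧ Dio c' N (j * θ) := by
  have hj' : 0 < j.natAbs := Int.natAbs_pos.mpr hj
  refine ⟨c / (j.natAbs:ℝ)^N, by positivity, ?_⟩
  intro m hm k
  have hh : ∀ k : ℤ, c / (j.natAbs:ℝ)^N / (m:ℝ)^N ≤ |(m:ℝ) * ((j.natAbs:ℝ) * θ) - k| := by
    intro k
    have := h (m * j.natAbs) (Nat.mul_pos hm hj') k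
    push_cast at this ⊢
    rw [div_div, ← mul_pow, ← mul_assoc, mul_comm _ (m:ℝ)]
    simpa using this
  rcases Int.natAbs_eq j with e | e
  · have : (j:ℝ) = (j.natAbs:ℝ) := by
      rw [← Int.cast_natCast (R := ℝ)]; exact_mod_cast e
    rw [this]; exact hh k
  · have : (j:ℝ) = -(j.natAbs:ℝ) := by
      rw [← Int.cast_natCast (R := ℝ)]; exact_mod_cast e
    rw [this]
    have h2 := hh (-k)
    rw [← abs_neg] at h2
    convert h2 using 2
    push_cast; ring

end Part11

section Part12
/-- the mean of a continuous function -/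
def Imean (g : C(AddCircle (1:ℝ), ℂ)) : ℂ := ∫ t, g t ∂(AddCircle.haarAddCircle)

lemma cm_integrable (g : C(AddCircle (1:ℝ), ℂ)) : MeasureTheory.Integrable g (AddCircle.haarAddCircle) :=
  g.continuous.integrable_of_hasCompactSupport (HasCompactSupport.of_compactSpace _)

lemma Imean_add (g h : C(AddCircle (1:ℝ), ℂ)) : Imean (g + h) = Imean g + Imean h := by
  unfold Imean
  rw [← MeasureTheory.integral_add (cm_integrable g) (cm_integrable h)]
  rfl

lemma Imean_smul (a : ℂ) (g : C(AddCircle (1:ℝ), ℂ)) : Imean (a • g) = a * Imean g := by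
  unfold Imean
  rw [← MeasureTheory.integral_const_mul]
  rfl

lemma Imean_sub (g h : C(AddCircle (1:ℝ), ℂ)) : Imean (g - h) = Imean g - Imean h := by
  unfold Imean
  rw [← MeasureTheory.integral_sub (cm_integrable g) (cm_integrable h)]
  rfl

lemma Imean_le (g : C(AddCircle (1:ℝ), ℂ)) : ‖Imean g‖ ≤ ‖g‖ := by
  unfold Imean
  have := MeasureTheory.norm_integral_le_of_norm_le_const (μ := (AddCircle.haarAddCircle (T := 1))) 
    (Eventually.of_forall (fun t => g.norm_coe_le_norm t))
  simpa using this

lemma Imean_fourier (k : ℤ) : Imean (fourier k) = if k = 0 then 1 else 0 := by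
  have h := congrFun (fourierCoeff_fourier (T := (1:ℝ)) k) 0
  unfold fourierCoeff at h
  simp only [neg_zero, fourier_zero, one_smul] at h
  unfold Imean
  rw [h]
  by_cases hk : k = 0
  · subst hk; simp
  · rw [if_neg hk, Pi.single_eq_of_ne (Ne.symm hk)]

/-- equidistribution weighted by the von Mangoldt function -/
def Eqd (θ : ℝ) (g : C(AddCircle (1:ℝ), ℂ)) : Prop := ∀ ε : ℝ, 0 < ε → ∃ X0 : ℕ, ∀ x ≥ X0, 
  ‖∑ n ∈ Finset.Ioc 0 x, vonMangoldt n • (g (((n:ℝ) * θ : ℝ) : AddCircle (1:ℝ)) - Imean g)‖ ≤ ε * x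

lemma psi_bound (x : ℕ) : ∑ n ∈ Finset.Ioc 0 x, vonMangoldt n ≤ 6 * x := by
  have h := Chebyshev.psi_le_const_mul_self (x := (x:ℝ)) (Nat.cast_nonneg x)
  unfold Chebyshev.psi at h
  rw [Nat.floor_natCast] at h
  have h4 : Real.log 4 ≤ 2 := by
    rw [show (4:ℝ) = 2^2 by norm_num, Real.log_pow]
    have := Real.log_two_lt_d9
    push_cast; linarith
  have : (0:ℝ) ≤ x := Nat.cast_nonneg x
  nlinarith

lemma eqd_fourier (θ : ℝ) (hD : ∀ j : ℤ, j ≠ 0 → ∃ c : ℝ, 0 < c ∧ ∃ N : ℕ, Dio c N (j * θ)) (k : ℤ) : Eqd θ (fourier k) := by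
  intro ε hε
  by_cases hk : k = 0
  · subst hk
    refine ⟨0, fun x _ => ?_⟩
    rw [Imean_fourier, if_pos rfl]
    simp only [fourier_zero, sub_self, smul_zero, Finset.sum_const_zero, norm_zero]
    positivity
  · obtain ⟨c, hc, N, h⟩ := hD k hk
    obtain ⟨X0, hX⟩ := exp_sum_small c hc N _ h ε hε
    refine ⟨X0, fun x hx => ?_⟩
    rw [Imean_fourier, if_neg hk]
    refine le_trans (le_of_eq ?_) (hX x hx)
    congr 1
    apply Finset.sum_congr rfl
    intro n _
    rw [sub_zero, fourier_coe_apply]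
    unfold ee
    congr 2
    push_cast; ring

lemma eqd_add (θ : ℝ) (g h : C(AddCircle (1:ℝ), ℂ)) (hg : Eqd θ g) (hh : Eqd θ h) : Eqd θ (g + h) := by
  intro ε hε
  obtain ⟨X1, h1⟩ := hg (ε/2) (by positivity)
  obtain ⟨X2, h2⟩ := hh (ε/2) (by positivity)
  refine ⟨max X1 X2, fun x hx => ?_⟩
  have a1 := h1 x (le_trans (le_max_left _ _) hx)
  have a2 := h2 x (le_trans (le_max_right _ _) hx)
  rw [Imean_add]
  have : ∀ n ∈ Finset.Ioc 0 x, vonMangoldt n • ((g + h) (((n:ℝ) * θ : ℝ) : AddCircle (1:ℝ)) - (Imean g + Imean h)) = 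
     vonMangoldt n • (g (((n:ℝ) * θ : ℝ) : AddCircle (1:ℝ)) - Imean g) + vonMangoldt n • (h (((n:ℝ) * θ : ℝ) : AddCircle (1:ℝ)) - Imean h) := by
    intro n _
    rw [← smul_add]; congr 1
    rw [ContinuousMap.add_apply]; ring
  rw [Finset.sum_congr rfl this, Finset.sum_add_distrib]
  refine (norm_add_le _ _).trans ?_
  linarith

lemma eqd_smul (θ : ℝ) (a : ℂ) (g : C(AddCircle (1:ℝ), ℂ)) (hg : Eqd θ g) : Eqd θ (a • g) := by
  intro ε hε
  obtain ⟨X1, h1⟩ := hg (ε/(‖a‖+1)) (by positivity)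
  refine ⟨X1, fun x hx => ?_⟩
  have a1 := h1 x hx
  rw [Imean_smul]
  have : ∀ n ∈ Finset.Ioc 0 x, vonMangoldt n • ((a • g) (((n:ℝ) * θ : ℝ) : AddCircle (1:ℝ)) - a * Imean g) = 
     a • (vonMangoldt n • (g (((n:ℝ) * θ : ℝ) : AddCircle (1:ℝ)) - Imean g)) := by
    intro n _
    rw [smul_comm, ContinuousMap.smul_apply, smul_eq_mul, smul_eq_mul, mul_sub]
  rw [Finset.sum_congr rfl this, ← Finset.smul_sum, norm_smul]
  calc _ ≤ (‖a‖ + 1) * (ε/(‖a‖+1) * x) := by gcongr; linarith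
    _ = _ := by field_simp

lemma eqd_all (θ : ℝ) (hD : ∀ j : ℤ, j ≠ 0 → ∃ c : ℝ, 0 < c ∧ ∃ N : ℕ, Dio c N (j * θ)) (g : C(AddCircle (1:ℝ), ℂ)) : Eqd θ g := by
  have hspan : ∀ g ∈ Submodule.span ℂ (Set.range (@fourier (1:ℝ))), Eqd θ g := by
    intro g hg
    induction hg using Submodule.span_induction with
    | mem x hx => obtain ⟨k, rfl⟩ := hx; exact eqd_fourier θ hD k
    | zero => 
      intro ε hε
      refine ⟨0, fun x _ => ?_⟩
      have : Imean 0 = 0 := by simp [Imean]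
      rw [this]; simp; positivity
    | add x y _ _ hx hy => exact eqd_add θ x y hx hy
    | smul a x _ hx => exact eqd_smul θ a x hx
  have hcl : g ∈ closure ((Submodule.span ℂ (Set.range (@fourier (1:ℝ))) : Submodule ℂ C(AddCircle (1:ℝ), ℂ)) : Set C(AddCircle (1:ℝ), ℂ)) := by
    have := span_fourier_closure_eq_top (T := (1:ℝ))
    rw [← Submodule.topologicalClosure_coe, this]; trivial
  intro ε hε
  obtain ⟨g', hg', hd⟩ := Metric.mem_closure_iff.mp hcl (ε/24) (by positivity)
  obtain ⟨X0, h0⟩ := hspan g' hg' (ε/2) (by positivity)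
  refine ⟨X0, fun x hx => ?_⟩
  have a1 := h0 x hx
  rw [dist_eq_norm] at hd
  have e : ∀ n ∈ Finset.Ioc 0 x, vonMangoldt n • (g (((n:ℝ) * θ : ℝ) : AddCircle (1:ℝ)) - Imean g) = 
     vonMangoldt n • (g' (((n:ℝ) * θ : ℝ) : AddCircle (1:ℝ)) - Imean g') + 
     vonMangoldt n • ((g - g') (((n:ℝ) * θ : ℝ) : AddCircle (1:ℝ)) - Imean (g - g')) := by
    intro n _
    rw [← smul_add, Imean_sub, ContinuousMap.sub_apply]; congr 1; ring
  rw [Finset.sum_congr rfl e, Finset.sum_add_distrib]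
  refine (norm_add_le _ _).trans ?_
  have a2 : ‖∑ n ∈ Finset.Ioc 0 x, vonMangoldt n • ((g - g') (((n:ℝ) * θ : ℝ) : AddCircle (1:ℝ)) - Imean (g - g'))‖ ≤ 
     ∑ n ∈ Finset.Ioc 0 x, vonMangoldt n * (ε/12) := by
    refine (norm_sum_le _ _).trans (Finset.sum_le_sum fun n _ => ?_)
    rw [norm_smul, Real.norm_of_nonneg vonMangoldt_nonneg]
    apply mul_le_mul_of_nonneg_left _ vonMangoldt_nonneg
    refine (norm_sub_le _ _).trans ?_
    have b1 := (g - g').norm_coe_le_norm (((n:ℝ) * θ : ℝ) : AddCircle (1:ℝ))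
    have b2 := Imean_le (g - g')
    linarith
  rw [← Finset.sum_mul] at a2
  have := psi_bound x
  nlinarith

end Part12

section Part13
/-- trapezoid function -/
def trap (r s η : ℝ) (t : AddCircle (1:ℝ)) : ℝ := max 0 (min 1 ((s + η - ‖t - ((-r : ℝ) : AddCircle (1:ℝ))‖) / η))

lemma trap_cont (r s η : ℝ) : Continuous (trap r s η) := by
  unfold trap; fun_prop

/-- trapezoid as a complex continuous map -/
def trapC (r s η : ℝ) : C(AddCircle (1:ℝ), ℂ) := ⟨fun t => ((trap r s η t : ℝ) : ℂ), Complex.continuous_ofReal.comp (trap_cont r s η)⟩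

lemma trap_nonneg (r s η : ℝ) (t : AddCircle (1:ℝ)) : 0 ≤ trap r s η t := le_max_left _ _
lemma trap_le_one (r s η : ℝ) (t : AddCircle (1:ℝ)) : trap r s η t ≤ 1 := max_le zero_le_one (min_le_left _ _)
lemma trap_eq_one (r s η : ℝ) (hη : 0 < η) (t : AddCircle (1:ℝ)) (h : ‖t - ((-r : ℝ) : AddCircle (1:ℝ))‖ ≤ s) : trap r s η t = 1 := by
  unfold trap
  have : 1 ≤ (s + η - ‖t - ((-r : ℝ) : AddCircle (1:ℝ))‖) / η := by
    rw [le_div_iff₀ hη]; linarith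
  rw [min_eq_left this]; simp
lemma trap_eq_zero (r s η : ℝ) (hη : 0 < η) (t : AddCircle (1:ℝ)) (h : s + η ≤ ‖t - ((-r : ℝ) : AddCircle (1:ℝ))‖) : trap r s η t = 0 := by
  unfold trap
  have : (s + η - ‖t - ((-r : ℝ) : AddCircle (1:ℝ))‖) / η ≤ 0 := 
    div_nonpos_of_nonpos_of_nonneg (by linarith) hη.le
  rw [max_eq_left]
  exact (min_le_right _ _).trans this

/-- real mean of trapezoid -/
def trapI (r s η : ℝ) : ℝ := ∫ t, trap r s η t

lemma Imean_trap (r s η : ℝ) : Imean (trapC r s η) = ((trapI r s η : ℝ) : ℂ) := by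
  unfold Imean trapI
  rw [AddCircle.integral_haarAddCircle]
  simp only [inv_one, one_smul]
  exact integral_ofReal

lemma trap_integrable (r s η : ℝ) : MeasureTheory.Integrable (trap r s η) :=
  (trap_cont r s η).integrable_of_hasCompactSupport (HasCompactSupport.of_compactSpace _)

lemma ball_integral (r u : ℝ) : ∫ t, (Metric.closedBall ((-r : ℝ) : AddCircle (1:ℝ)) u).indicator (fun _ => (1:ℝ)) t = 
    max 0 (min 1 (2 * u)) := by
  rw [MeasureTheory.integral_indicator Metric.isClosed_closedBall.measurableSet]
  simp only [MeasureTheory.integral_const, smul_eq_mul, mul_one, MeasureTheory.measureReal_restrict_apply_univ]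
  rw [MeasureTheory.measureReal_def, AddCircle.volume_closedBall, ENNReal.toReal_ofReal', max_comm]

lemma ind_integrable (r u : ℝ) : MeasureTheory.Integrable ((Metric.closedBall ((-r : ℝ) : AddCircle (1:ℝ)) u).indicator (fun _ => (1:ℝ))) :=
  (MeasureTheory.integrable_const _).indicator Metric.isClosed_closedBall.measurableSet

lemma trapI_le (r s η : ℝ) (hη : 0 < η) (hs : 0 ≤ s + η) : trapI r s η ≤ 2 * (s + η) := by
  have h : trapI r s η ≤ ∫ t, (Metric.closedBall ((-r : ℝ) : AddCircle (1:ℝ)) (s + η)).indicator (fun _ => (1:ℝ)) t := by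
    apply MeasureTheory.integral_mono (trap_integrable _ _ _) (ind_integrable _ _)
    intro t
    by_cases ht : t ∈ Metric.closedBall ((-r : ℝ) : AddCircle (1:ℝ)) (s + η)
    · rw [Set.indicator_of_mem ht]; exact trap_le_one _ _ _ _
    · rw [Set.indicator_of_notMem ht]
      rw [Metric.mem_closedBall, dist_eq_norm, not_le] at ht
      rw [trap_eq_zero _ _ _ hη _ ht.le]
  rw [ball_integral] at h
  exact h.trans (max_le (by linarith) (min_le_right _ _))

lemma le_trapI (r s η : ℝ) (hη : 0 < η) (hs : s ≤ 1/2) : 2 * s ≤ trapI r s η := by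
  have h : ∫ t, (Metric.closedBall ((-r : ℝ) : AddCircle (1:ℝ)) s).indicator (fun _ => (1:ℝ)) t ≤ trapI r s η := by
    apply MeasureTheory.integral_mono (ind_integrable _ _) (trap_integrable _ _ _)
    intro t
    by_cases ht : t ∈ Metric.closedBall ((-r : ℝ) : AddCircle (1:ℝ)) s
    · rw [Set.indicator_of_mem ht]
      rw [Metric.mem_closedBall, dist_eq_norm] at ht
      rw [trap_eq_one _ _ _ hη _ ht]
    · rw [Set.indicator_of_notMem ht]; exact trap_nonneg _ _ _ _
  rw [ball_integral] at h
  refine le_trans ?_ h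
  exact le_max_of_le_right (le_min (by linarith) le_rfl)

open Classical in
/-- Beatty indicator -/
def fB (θ : ℝ) (n : ℕ) : ℝ := if ‖(((n:ℝ) * θ : ℝ) : AddCircle (1:ℝ)) - ((-(θ/2) : ℝ) : AddCircle (1:ℝ))‖ < θ/2 then 1 else 0

lemma fB_nonneg (θ : ℝ) (n : ℕ) : 0 ≤ fB θ n := by unfold fB; split_ifs <;> simp
lemma fB_le_one (θ : ℝ) (n : ℕ) : fB θ n ≤ 1 := by unfold fB; split_ifs <;> simp

lemma fB_le (θ η : ℝ) (hη : 0 < η) (n : ℕ) : fB θ n ≤ trap (θ/2) (θ/2) η (((n:ℝ) * θ : ℝ) : AddCircle (1:ℝ)) := by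
  unfold fB; split_ifs with h
  · rw [trap_eq_one _ _ _ hη _ h.le]
  · exact trap_nonneg _ _ _ _

lemma le_fB (θ η : ℝ) (hη : 0 < η) (n : ℕ) : trap (θ/2) (θ/2 - η) η (((n:ℝ) * θ : ℝ) : AddCircle (1:ℝ)) ≤ fB θ n := by
  unfold fB; split_ifs with h
  · exact trap_le_one _ _ _ _
  · rw [trap_eq_zero _ _ _ hη]
    linarith

lemma eqd_trap (θ : ℝ) (hD : ∀ j : ℤ, j ≠ 0 → ∃ c : ℝ, 0 < c ∧ ∃ N : ℕ, Dio c N (j * θ)) (r s η ε : ℝ) (hε : 0 < ε) :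
    ∃ X0 : ℕ, ∀ x ≥ X0, |∑ n ∈ Finset.Ioc 0 x, vonMangoldt n * (trap r s η (((n:ℝ) * θ : ℝ) : AddCircle (1:ℝ)) - trapI r s η)| ≤ ε * x := by
  obtain ⟨X0, h⟩ := eqd_all θ hD (trapC r s η) ε hε
  refine ⟨X0, fun x hx => ?_⟩
  have := h x hx
  rw [Imean_trap] at this
  rw [← Real.norm_eq_abs, ← Complex.norm_real]
  convert this using 2
  push_cast
  apply Finset.sum_congr rfl
  intro n _
  rw [Complex.real_smul]
  rfl

lemma eqd_fB (θ : ℝ) (hθ0 : 0 < θ) (hθ1 : θ < 1) (hD : ∀ j : ℤ, j ≠ 0 → ∃ c : ℝ, 0 < c ∧ ∃ N : ℕ, Dio c N (j * θ)) (ε : ℝ) (hε : 0 < ε) :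
    ∃ X0 : ℕ, ∀ x ≥ X0, |∑ n ∈ Finset.Ioc 0 x, vonMangoldt n * (fB θ n - θ)| ≤ ε * x := by
  set η := ε / 24 with hη
  have hη0 : 0 < η := by positivity
  obtain ⟨X1, h1⟩ := eqd_trap θ hD (θ/2) (θ/2) η (ε/2) (by positivity)
  obtain ⟨X2, h2⟩ := eqd_trap θ hD (θ/2) (θ/2 - η) η (ε/2) (by positivity)
  refine ⟨max X1 X2, fun x hx => ?_⟩
  have a1 := (abs_le.mp (h1 x (le_trans (le_max_left _ _) hx))).2
  have a2 := (abs_le.mp (h2 x (le_trans (le_max_right _ _) hx))).1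
  have hI1 := trapI_le (θ/2) (θ/2) η hη0 (by positivity)
  have hI2 := le_trapI (θ/2) (θ/2 - η) η hη0 (by linarith)
  have hpsi := psi_bound x
  rw [abs_le]
  constructor
  · have : ∑ n ∈ Finset.Ioc 0 x, vonMangoldt n * (trap (θ/2) (θ/2 - η) η (((n:ℝ) * θ : ℝ) : AddCircle (1:ℝ)) - trapI (θ/2) (θ/2 - η) η)
        ≤ ∑ n ∈ Finset.Ioc 0 x, (vonMangoldt n * (fB θ n - θ) + vonMangoldt n * (2 * η)) := by
      apply Finset.sum_le_sum
      intro n _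
      rw [← mul_add]
      apply mul_le_mul_of_nonneg_left _ vonMangoldt_nonneg
      have := le_fB θ η hη0 n
      linarith
    rw [Finset.sum_add_distrib, ← Finset.sum_mul] at this
    nlinarith
  · have : ∑ n ∈ Finset.Ioc 0 x, vonMangoldt n * (fB θ n - θ) ≤ 
      ∑ n ∈ Finset.Ioc 0 x, (vonMangoldt n * (trap (θ/2) (θ/2) η (((n:ℝ) * θ : ℝ) : AddCircle (1:ℝ)) - trapI (θ/2) (θ/2) η) + vonMangoldt n * (2 * η)) := by
      apply Finset.sum_le_sum
      intro n _
      rw [← mul_add]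
      apply mul_le_mul_of_nonneg_left _ vonMangoldt_nonneg
      have := fB_le θ η hη0 n
      linarith
    rw [Finset.sum_add_distrib, ← Finset.sum_mul] at this
    nlinarith

lemma beatty_iff (α : ℝ) (hα : 1 < α) (hirr : Irrational α) (p : ℕ) (hp : 0 < p) :
    (∃ m : ℕ, 0 < m ∧ (p : ℤ) = ⌊α * (m : ℝ)⌋) ↔ 
     ‖(((p:ℝ) * (1/α) : ℝ) : AddCircle (1:ℝ)) - ((-((1/α)/2) : ℝ) : AddCircle (1:ℝ))‖ < (1/α)/2 := by
  have ha : 0 < α := by linarith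
  have hpr : (0:ℝ) < p := by exact_mod_cast hp
  have e : (((p:ℝ) * (1/α) : ℝ) : AddCircle (1:ℝ)) - ((-((1/α)/2) : ℝ) : AddCircle (1:ℝ)) = (((p + 1/2) * (1/α) : ℝ) : AddCircle (1:ℝ)) := by
    rw [← AddCircle.coe_sub]; congr 1; ring
  rw [e]
  have hn : ‖(((p + 1/2) * (1/α) : ℝ) : AddCircle (1:ℝ))‖ = |(p + 1/2) * (1/α) - round ((p + 1/2) * (1/α))| := UnitAddCircle.norm_eq
  rw [hn]
  have key : ∀ m : ℤ, |(p + 1/2) * (1/α) - m| < (1/α)/2 ↔ ((p:ℝ) < α * m ∧ α * m < p + 1) := by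
    intro m
    have : (p + 1/2) * (1/α) - (m:ℝ) = (p + 1/2 - α * m) * (1/α) := by field_simp
    rw [this, abs_mul, abs_of_pos (by positivity : 0 < 1/α), div_eq_mul_inv (1/α), mul_comm (1/α), 
      mul_lt_mul_iff_left₀ (by positivity), abs_lt]
    constructor
    · rintro ⟨h1, h2⟩; constructor <;> linarith
    · rintro ⟨h1, h2⟩; constructor <;> linarith
  constructor
  · rintro ⟨m, hm, h⟩
    symm at h
    rw [Int.floor_eq_iff] at h
    push_cast at h
    refine lt_of_le_of_lt (round_le _ (m:ℤ)) ((key m).mpr ⟨?_, by push_cast; exact h.2⟩)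
    push_cast
    refine lt_of_le_of_ne h.1 ?_
    intro heq
    have := hirr.mul_natCast (m := m) hm.ne'
    rw [← heq] at this
    exact Nat.not_irrational p this
  · intro h
    rw [key] at h
    set m := round ((p + 1/2) * (1/α)) with hm
    have hm0 : 0 < m := by
      have : (0:ℝ) < α * m := hpr.trans h.1
      have : (0:ℝ) < m := pos_of_mul_pos_right this ha.le
      exact_mod_cast this
    refine ⟨m.toNat, by omega, ?_⟩
    symm
    rw [Int.floor_eq_iff]
    have : ((m.toNat : ℕ) : ℝ) = (m:ℝ) := by
      have : ((m.toNat : ℕ) : ℤ) = m := Int.toNat_of_nonneg hm0.le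
      exact_mod_cast this
    rw [this]; push_cast
    exact ⟨h.1.le, h.2⟩

end Part13

section Part14
lemma sqrt_log_small (ε : ℝ) (hε : 0 < ε) : ∃ X0 : ℕ, ∀ x ≥ X0, √(x:ℝ) * Real.log x ≤ ε * x := by
  have h := (isLittleO_log_rpow_atTop (by norm_num : (0:ℝ) < 1/2)).bound hε
  have h2 := (tendsto_natCast_atTop_atTop (R := ℝ)).eventually h
  obtain ⟨X0, hX⟩ := eventually_atTop.mp h2
  refine ⟨X0 + 1, fun x hx => ?_⟩
  have := hX x (by omega)
  rw [← Real.sqrt_eq_rpow, Real.norm_of_nonneg (Real.log_natCast_nonneg x), Real.norm_of_nonneg (Real.sqrt_nonneg _)] at this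
  calc √(x:ℝ) * Real.log x ≤ √(x:ℝ) * (ε * √(x:ℝ)) := by gcongr
    _ = ε * (√(x:ℝ) * √(x:ℝ)) := by ring
    _ = _ := by rw [Real.mul_self_sqrt (Nat.cast_nonneg x)]

/-- prime weight -/
def pw (g : ℕ → ℝ) (n : ℕ) : ℝ := if n.Prime then Real.log n * g n else 0

lemma abs_pw_le (g : ℕ → ℝ) (hg : ∀ n, |g n| ≤ 1) (n : ℕ) : |pw g n| ≤ vonMangoldt n := by
  unfold pw; split_ifs with h
  · rw [vonMangoldt_apply_prime h, abs_mul, abs_of_nonneg (Real.log_natCast_nonneg n)]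
    exact mul_le_of_le_one_right (Real.log_natCast_nonneg n) (hg n)
  · simp [vonMangoldt_nonneg]

lemma pw_bound (g : ℕ → ℝ) (hg : ∀ n, |g n| ≤ 1) 
    (H : ∀ ε : ℝ, 0 < ε → ∃ X0 : ℕ, ∀ x ≥ X0, |∑ n ∈ Finset.Ioc 0 x, vonMangoldt n * g n| ≤ ε * x) (ε : ℝ) (hε : 0 < ε) :
    ∃ C : ℝ, 0 ≤ C ∧ ∀ k : ℕ, |∑ n ∈ Finset.Ioc 0 k, pw g n| ≤ ε * k + C := by
  obtain ⟨X1, h1⟩ := H (ε/2) (by positivity)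
  obtain ⟨X2, h2⟩ := sqrt_log_small (ε/4) (by positivity)
  refine ⟨6 * (X1 + X2 + 1 : ℕ), by positivity, fun k => ?_⟩
  by_cases hk : X1 + X2 + 1 ≤ k
  · have a1 := h1 k (by omega)
    have a2 := h2 k (by omega)
    have a3 := Chebyshev.psi_sub_theta_le (x := (k:ℝ)) (by exact_mod_cast (by omega : 1 ≤ k))
    rw [Chebyshev.psi_sub_theta_eq_sum_not_prime, Nat.floor_natCast, Finset.sum_filter] at a3
    have a4 : |∑ n ∈ Finset.Ioc 0 k, pw g n - ∑ n ∈ Finset.Ioc 0 k, vonMangoldt n * g n| ≤ 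
        ∑ n ∈ Finset.Ioc 0 k, if ¬ n.Prime then vonMangoldt n else 0 := by
      rw [← Finset.sum_sub_distrib]
      refine (Finset.abs_sum_le_sum_abs _ _).trans (Finset.sum_le_sum fun n _ => ?_)
      unfold pw
      by_cases h : n.Prime
      · rw [if_pos h, if_neg (not_not.mpr h), vonMangoldt_apply_prime h]; simp
      · rw [if_neg h, if_pos h, zero_sub, abs_neg, abs_mul, abs_of_nonneg vonMangoldt_nonneg]
        exact mul_le_of_le_one_right vonMangoldt_nonneg (hg n)
    have a5 := abs_sub_abs_le_abs_sub (∑ n ∈ Finset.Ioc 0 k, pw g n) (∑ n ∈ Finset.Ioc 0 k, vonMangoldt n * g n)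
    have : (0:ℝ) ≤ 6 * (X1 + X2 + 1 : ℕ) := by positivity
    linarith
  · have a1 := psi_bound k
    have a2 : |∑ n ∈ Finset.Ioc 0 k, pw g n| ≤ ∑ n ∈ Finset.Ioc 0 k, vonMangoldt n :=
      (Finset.abs_sum_le_sum_abs _ _).trans (Finset.sum_le_sum fun n _ => abs_pw_le g hg n)
    have a3 : (k:ℝ) ≤ (X1 + X2 + 1 : ℕ) := by exact_mod_cast (by omega)
    have : 0 ≤ ε * k := by positivity
    linarith

lemma sum_primesLE_eq (g : ℕ → ℝ) (t : ℕ) : ∑ p ∈ Nat.primesLE t, g p = ∑ n ∈ Finset.Ioc 0 t, if n.Prime then g n else 0 := by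
  rw [← Finset.sum_filter]
  apply Finset.sum_congr _ (fun _ _ => rfl)
  ext n
  simp only [Nat.mem_primesLE, Finset.mem_filter, Finset.mem_Ioc]
  constructor
  · rintro ⟨h1, h2⟩; exact ⟨⟨h2.pos, h1⟩, h2⟩
  · rintro ⟨⟨_, h1⟩, h2⟩; exact ⟨h1, h2⟩

lemma remove_log (g : ℕ → ℝ) (hg : ∀ n, |g n| ≤ 1) 
    (H : ∀ ε : ℝ, 0 < ε → ∃ X0 : ℕ, ∀ x ≥ X0, |∑ n ∈ Finset.Ioc 0 x, vonMangoldt n * g n| ≤ ε * x) (ε : ℝ) (hε : 0 < ε) :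
    ∃ Y0 : ℕ, ∀ y ≥ Y0, ∀ t ≤ y, |∑ p ∈ Nat.primesLE t, g p| ≤ ε * y / Real.log y := by
  obtain ⟨C, hC, hA⟩ := pw_bound g hg H (ε/6) (by positivity)
  obtain ⟨X2, h2⟩ := sqrt_log_small (ε/6) (by positivity)
  obtain ⟨X3, h3⟩ := exists_nat_gt (4 * C / (ε/6))
  refine ⟨X2 + X3 + 2, fun y hy t ht => ?_⟩
  rw [sum_primesLE_eq]
  set z := Nat.sqrt y with hz
  have hz1 : 1 ≤ z := Nat.le_sqrt.mpr (by omega)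
  have hy0 : (0:ℝ) < y := by exact_mod_cast (by omega : 0 < y)
  have hly : 0 < Real.log y := Real.log_pos (by exact_mod_cast (by omega : 1 < y))
  have hzs : (z:ℝ) ≤ √y := Real.nat_sqrt_le_real_sqrt
  have b2 := h2 y (by omega)
  have b3 : 4 * C ≤ ε/6 * y := by
    have : (X3:ℝ) ≤ y := by exact_mod_cast (by omega : X3 ≤ y)
    rw [div_lt_iff₀ (by positivity)] at h3
    nlinarith
  have triv : ∀ s : ℕ, |∑ n ∈ Finset.Ioc 0 s, (if n.Prime then g n else 0)| ≤ (s:ℝ) := by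
    intro s
    refine (Finset.abs_sum_le_sum_abs _ _).trans ?_
    refine (Finset.sum_le_sum (g := fun _ => (1:ℝ)) ?_).trans (by simp)
    intro n _
    split_ifs
    · exact hg n
    · simp
  rw [le_div_iff₀ hly]
  rcases le_or_gt t z with htz | htz
  · have : (t:ℝ) ≤ z := by exact_mod_cast htz
    have h5 : |∑ n ∈ Finset.Ioc 0 t, if n.Prime then g n else 0| ≤ √y := (triv t).trans (by linarith)
    calc _ ≤ √y * Real.log y := by gcongr
      _ ≤ ε/6 * y := b2
      _ ≤ _ := by nlinarith
  · have hsplit : ∑ n ∈ Finset.Ioc 0 t, (if n.Prime then g n else 0) = 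
        ∑ n ∈ Finset.Ioc 0 z, (if n.Prime then g n else 0) + ∑ n ∈ Finset.Ioc z t, (if n.Prime then g n else 0) := by
      rw [Finset.sum_Ioc_consecutive _ (Nat.zero_le z) htz.le]
    have hlz : Real.log y ≤ 2 * Real.log ((z+1 : ℕ):ℝ) := by
      have : Real.log y ≤ Real.log (((z+1:ℕ):ℝ)^2) := by
        apply Real.log_le_log hy0
        have := Nat.lt_succ_sqrt y
        rw [sq]; exact_mod_cast this.le
      rwa [Real.log_pow] at this
    have hlz0 : 0 < Real.log ((z+1 : ℕ):ℝ) := by linarith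
    have hab := abel_antitone (fun n : ℕ => 1 / Real.log n) (pw g) (z+1) (t+1) (2 * (ε/6 * y + C)) (by positivity) ?_ ?_ ?_
    · have e : ∑ n ∈ Finset.Ioc z t, (if n.Prime then g n else 0) = ∑ n ∈ Finset.Ico (z+1) (t+1), (1 / Real.log n) • pw g n := by
        rw [Ioc_eq_Ico]
        apply Finset.sum_congr rfl
        intro n hn
        unfold pw
        split_ifs with hp
        · have : 0 < Real.log n := Real.log_pos (by exact_mod_cast hp.one_lt)
          rw [smul_eq_mul]; field_simp
        · simp
      rw [← e, Real.norm_eq_abs] at hab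
      have hb : |∑ n ∈ Finset.Ioc z t, (if n.Prime then g n else 0)| * Real.log y ≤ 4 * (ε/6 * y + C) := by
        calc _ ≤ (2 * (ε/6 * y + C) * (1 / Real.log ((z+1:ℕ):ℝ))) * (2 * Real.log ((z+1 : ℕ):ℝ)) := by
              gcongr
          _ = _ := by field_simp; ring
      have ha : |∑ n ∈ Finset.Ioc 0 z, (if n.Prime then g n else 0)| * Real.log y ≤ ε/6 * y := by
        refine le_trans ?_ b2
        gcongr
        exact (triv z).trans hzs
      rw [hsplit]
      have := abs_add_le (∑ n ∈ Finset.Ioc 0 z, (if n.Prime then g n else 0)) (∑ n ∈ Finset.Ioc z t, (if n.Prime then g n else 0))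
      have := mul_le_mul_of_nonneg_right this hly.le
      rw [add_mul] at this
      linarith
    · intro i hi
      have : 0 < Real.log i := Real.log_pos (by exact_mod_cast (by omega : 1 < i))
      apply one_div_le_one_div_of_le this
      apply Real.log_le_log
      · exact_mod_cast (by omega : 0 < i)
      · push_cast; linarith
    · intro i hi; have := Real.log_natCast_nonneg i; positivity
    · intro k hk1 hk2
      obtain ⟨k, rfl⟩ : ∃ j, k = j + 1 := ⟨k - 1, by omega⟩
      rw [← Ioc_eq_Ico]
      have e : ∑ n ∈ Finset.Ioc z k, pw g n = ∑ n ∈ Finset.Ioc 0 k, pw g n - ∑ n ∈ Finset.Ioc 0 z, pw g n := by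
        rw [← Finset.sum_Ioc_consecutive _ (Nat.zero_le z) (by omega : z ≤ k)]; ring
      rw [e]
      have c1 := hA k
      have c2 := hA z
      have d1 : (k:ℝ) ≤ y := by exact_mod_cast (by omega : k ≤ y)
      have d2 : (z:ℝ) ≤ y := by exact_mod_cast (by omega : z ≤ y)
      have := norm_sub_le (∑ n ∈ Finset.Ioc 0 k, pw g n) (∑ n ∈ Finset.Ioc 0 z, pw g n)
      rw [Real.norm_eq_abs, Real.norm_eq_abs, Real.norm_eq_abs] at this
      rw [Real.norm_eq_abs]
      nlinarith

lemma main_final (α : ℝ) (hα : 1 < α) (hirr : Irrational α)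
    (hft : ∃ N : ℝ, 0 < N ∧ {pq : ℤ × ℤ | 1 ≤ pq.2 ∧ IsCoprime pq.1 pq.2 ∧ |α - (pq.1 : ℝ) / (pq.2 : ℝ)| ≤ 1 / (pq.2 : ℝ) ^ N}.Finite) :
    Tendsto (fun X : ℕ => ∑ n ∈ Finset.Icc 2 X, (moebius n : ℝ) / n * fB (1/α) n.minFac) atTop (nhds (-(1/α))) := by
  have ha : 0 < α := by linarith
  have hθ0 : 0 < 1/α := by positivity
  have hθ1 : 1/α < 1 := by rw [div_lt_one ha]; exact hα
  obtain ⟨c, hc, N, hD⟩ := dio_alpha α hirr hft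
  obtain ⟨c', hc', hD'⟩ := dio_inv α hα c hc N hD
  have hD2 : ∀ j : ℤ, j ≠ 0 → ∃ c : ℝ, 0 < c ∧ ∃ N : ℕ, Dio c N (j * (1/α)) := by
    intro j hj
    obtain ⟨c2, h2, h3⟩ := dio_mul (1/α) c' hc' N hD' j hj
    exact ⟨c2, h2, N, h3⟩
  apply reduction (fB (1/α)) (1/α) (fB_nonneg _) (fB_le_one _) hθ0.le hθ1.le
  intro ε hε
  apply remove_log (fun n => fB (1/α) n - 1/α) _ _ ε hε
  · intro n
    have := fB_nonneg (1/α) n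
    have := fB_le_one (1/α) n
    rw [abs_le]; constructor <;> linarith
  · intro ε hε
    exact eqd_fB (1/α) hθ0 hθ1 hD2 ε hε

open Classical in
theorem final (α : ℝ) (hα : 1 < α) (hirr : Irrational α)
    (hft : ∃ N : ℝ, 0 < N ∧
      {pq : ℤ × ℤ | 1 ≤ pq.2 ∧ IsCoprime pq.1 pq.2 ∧
        |α - (pq.1 : ℝ) / (pq.2 : ℝ)| ≤ 1 / (pq.2 : ℝ) ^ N}.Finite) :
    Tendsto (fun X : ℕ =>
        ∑ n ∈ Finset.Icc 2 X,
          if (∃ m : ℕ, 0 < m ∧ (n.minFac : ℤ) = ⌊α * (m : ℝ)⌋) then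
            (moebius n : ℝ) / (n : ℝ)
          else 0)
      atTop (nhds (-1 / α)) := by
  have h := main_final α hα hirr hft
  rw [neg_div]
  refine h.congr fun X => ?_
  apply Finset.sum_congr rfl
  intro n _
  have hb := beatty_iff α hα hirr n.minFac (Nat.minFac_pos n)
  unfold fB
  by_cases hcase : ∃ m : ℕ, 0 < m ∧ (n.minFac : ℤ) = ⌊α * (m : ℝ)⌋
  · rw [if_pos hcase, if_pos (hb.mp hcase), mul_one]
  · rw [if_neg hcase, if_neg (fun h => hcase (hb.mpr h)), mul_zero]

end Part14

open Classical in
/-- The Möbius sum over `n` whose smallest prime factor is a Beatty prime `⌊α n⌋`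
converges to `-1/α` for `α > 1` irrational of finite type. -/
theorem beatty_mobius_sum (α : ℝ) (hα : 1 < α) (hirr : Irrational α)
    (hft : ∃ N : ℝ, 0 < N ∧
      {pq : ℤ × ℤ | 1 ≤ pq.2 ∧ IsCoprime pq.1 pq.2 ∧
        |α - (pq.1 : ℝ) / (pq.2 : ℝ)| ≤ 1 / (pq.2 : ℝ) ^ N}.Finite) :
    Tendsto (fun X : ℕ =>
        ∑ n ∈ Finset.Icc 2 X,
          if (∃ m : ℕ, 0 < m ∧ (n.minFac : ℤ) = ⌊α * (m : ℝ)⌋) then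
            (moebius n : ℝ) / (n : ℝ)
          else 0)
      atTop (nhds (-1 / α)) := by
  exact final α hα hirr hft

end AlladiGen
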